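/- (Full boundary C² estimate for the Legendre transform.) For every K > 0 there exist constants ε > 0 and C₃₄ > 0, depending only on n, Ω, Ω̃, h, h̃, θ, θ̃ and K, with the following property. Let f ∈ 𝒜 with ‖f‖_{C²(Ω̄ × closure(Ω̃))} ≤ K satisfy condition (OSC), sup |D_x f| ≤ ε and sup |D_{xp} f| ≤ ε. Let u be a smooth uniformly convex solution of the second boundary value problem with data (f, c) and ũ its Legendre transform. Then max_{y ∈ ∂Ω̃} ‖D²ũ(y)‖ ≤ C₃₄, where ‖·‖ denotes the operator norm. -/

import Mathlib

open Set MeasureTheory Matrix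
open scoped Topology RealInnerProductSpace NNReal

noncomputable section

abbrev Euc (n : ℕ) := EuclideanSpace ℝ (Fin n)

variable {n : ℕ}

/-- Hessian matrix of `u` at `x`. -/
def Hess (u : Euc n → ℝ) (x : Euc n) : Matrix (Fin n) (Fin n) ℝ :=
  fun i j => iteratedFDeriv ℝ 2 u x ![EuclideanSpace.single i 1, EuclideanSpace.single j 1]

/-- `A ≤ B` in the sense of symmetric matrices. -/
def MatLE (A B : Matrix (Fin n) (Fin n) ℝ) : Prop := (B - A).PosSemidef

/-- The Minkowski mean-curvature operator `div (∇u / √(1 - |∇u|²))`. -/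
def MinkDiv (u : Euc n → ℝ) (x : Euc n) : ℝ :=
  ∑ i, fderiv ℝ (fun y => (Real.sqrt (1 - ‖gradient u y‖ ^ 2))⁻¹ * gradient u y i) x
    (EuclideanSpace.single i 1)

/-- The Euclidean mean-curvature operator `div (∇u / √(1 + |∇u|²))`. -/
def EucDiv (u : Euc n → ℝ) (x : Euc n) : ℝ :=
  ∑ i, fderiv ℝ (fun y => (Real.sqrt (1 + ‖gradient u y‖ ^ 2))⁻¹ * gradient u y i) x
    (EuclideanSpace.single i 1)

/-- `S(p) = (1/v)(Iₙ + p pᵀ / v²)`, `v = √(1-|p|²)`. -/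
def Smat (p : Euc n) : Matrix (Fin n) (Fin n) ℝ :=
  (Real.sqrt (1 - ‖p‖ ^ 2))⁻¹ •
    ((1 : Matrix (Fin n) (Fin n) ℝ) +
      (1 - ‖p‖ ^ 2)⁻¹ • Matrix.vecMulVec (fun i => p i) (fun j => p j))

/-- `B(p) = Iₙ + p pᵀ / (v (1 + v))`, `v = √(1-|p|²)`. -/
def Bmat (p : Euc n) : Matrix (Fin n) (Fin n) ℝ :=
  (1 : Matrix (Fin n) (Fin n) ℝ) +
    (Real.sqrt (1 - ‖p‖ ^ 2) * (1 + Real.sqrt (1 - ‖p‖ ^ 2)))⁻¹ •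
      Matrix.vecMulVec (fun i => p i) (fun j => p j)

/-- `A(x) = (1/v)·B(∇u)·D²u·B(∇u)`: its eigenvalues are the principal curvatures. -/
def Amat (u : Euc n → ℝ) (x : Euc n) : Matrix (Fin n) (Fin n) ℝ :=
  (Real.sqrt (1 - ‖gradient u x‖ ^ 2))⁻¹ •
    (Bmat (gradient u x) * Hess u x * Bmat (gradient u x))

/-- supremum of the quadratic form of `A` over the unit sphere (the operator
norm / largest eigenvalue for a positive semidefinite symmetric `A`). -/
def quadSup (A : Matrix (Fin n) (Fin n) ℝ) : ℝ :=
  ⨆ ξ : Metric.sphere (0 : Euc n) 1,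
    (fun i => (ξ : Euc n) i) ⬝ᵥ A.mulVec (fun i => (ξ : Euc n) i)

/-- The domains `Ω = {h̃ > 0}`, `Ω̃ = {h > 0}` are bounded uniformly convex domains
with smooth boundary, described by the defining functions `h̃` and `h`. -/
def DomainSetup (Ω Ωt : Set (Euc n)) (ht h : Euc n → ℝ) (θt θ : ℝ) : Prop :=
  IsOpen Ω ∧ IsOpen Ωt ∧ Bornology.IsBounded Ω ∧ Bornology.IsBounded Ωt ∧
  Ω.Nonempty ∧ Ωt.Nonempty ∧
  ContDiff ℝ (⊤ : ℕ∞) ht ∧ ContDiff ℝ (⊤ : ℕ∞) h ∧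
  Ω = {x | 0 < ht x} ∧ Ωt = {y | 0 < h y} ∧
  (∀ x ∈ frontier Ω, ‖gradient ht x‖ = 1) ∧
  (∀ y ∈ frontier Ωt, ‖gradient h y‖ = 1) ∧
  0 < θt ∧ 0 < θ ∧
  (∀ x : Euc n, MatLE (Hess ht x) ((-θt) • (1 : Matrix (Fin n) (Fin n) ℝ))) ∧
  (∀ y : Euc n, MatLE (Hess h y) ((-θ) • (1 : Matrix (Fin n) (Fin n) ℝ)))

/-- `f ∈ 𝒜`: `f` is `C²` on `Ω̄ × closure Ω̃` and concave in `x`. -/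
def InA (Ω Ωt : Set (Euc n)) (f : Euc n × Euc n → ℝ) : Prop :=
  ContDiffOn ℝ 2 f (closure Ω ×ˢ closure Ωt) ∧
  ∀ p ∈ closure Ωt, ConcaveOn ℝ (closure Ω) (fun x => f (x, p))

/-- Condition (OSC): `osc f ≤ (n/2)(|Ω̃|/|Ω|)^{1/n}`. -/
def OSCcond (Ω Ωt : Set (Euc n)) (f : Euc n × Euc n → ℝ) : Prop :=
  ∀ x ∈ closure Ω, ∀ y ∈ closure Ω, ∀ p ∈ closure Ωt, ∀ q ∈ closure Ωt,
    |f (x, p) - f (y, q)| ≤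
      ((n : ℝ) / 2) * ((volume Ωt).toReal / (volume Ω).toReal) ^ ((1 : ℝ) / n)

/-- `‖f‖_{C²(Ω̄ × closure Ω̃)} ≤ K`. -/
def C2Bound (Ω Ωt : Set (Euc n)) (f : Euc n × Euc n → ℝ) (K : ℝ) : Prop :=
  ContDiffOn ℝ 2 f (closure Ω ×ˢ closure Ωt) ∧
  ∀ z ∈ closure Ω ×ˢ closure Ωt,
    |f z| ≤ K ∧ ‖fderiv ℝ f z‖ ≤ K ∧ ‖iteratedFDeriv ℝ 2 f z‖ ≤ K

/-- `sup |D_x f| ≤ ε` on `Ω̄ × closure Ω̃`. -/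
def DxBound (Ω Ωt : Set (Euc n)) (f : Euc n × Euc n → ℝ) (ε : ℝ) : Prop :=
  ∀ x ∈ closure Ω, ∀ p ∈ closure Ωt, ‖fderiv ℝ (fun x' => f (x', p)) x‖ ≤ ε

/-- `sup |D_{xp} f| ≤ ε` on `Ω̄ × closure Ω̃`. -/
def DxpBound (Ω Ωt : Set (Euc n)) (f : Euc n × Euc n → ℝ) (ε : ℝ) : Prop :=
  ∀ x ∈ closure Ω, ∀ p ∈ closure Ωt,
    ‖fderiv ℝ (fun p' => fderiv ℝ (fun x' => f (x', p')) x) p‖ ≤ ε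

/-- A strictly convex solution of the second boundary value problem. -/
def IsStrictSol (Ω Ωt : Set (Euc n)) (f : Euc n × Euc n → ℝ) (c : ℝ) (u : Euc n → ℝ) : Prop :=
  ContDiffOn ℝ 2 u (closure Ω) ∧
  (∀ x ∈ closure Ω, (Hess u x).PosDef) ∧
  (∀ x ∈ closure Ω, ‖gradient u x‖ < 1) ∧
  (∀ x ∈ Ω, MinkDiv u x = f (x, gradient u x) + c) ∧
  gradient u '' Ω = Ωt

/-- A smooth uniformly convex solution of the second boundary value problem. -/
def IsSmoothSol (Ω Ωt : Set (Euc n)) (f : Euc n × Euc n → ℝ) (c : ℝ) (u : Euc n → ℝ) : Prop :=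
  ContDiffOn ℝ (⊤ : ℕ∞) u (closure Ω) ∧
  (∃ δ : ℝ, 0 < δ ∧ ∀ x ∈ closure Ω, MatLE (δ • (1 : Matrix (Fin n) (Fin n) ℝ)) (Hess u x)) ∧
  (∀ x ∈ closure Ω, ‖gradient u x‖ < 1) ∧
  (∀ x ∈ Ω, MinkDiv u x = f (x, gradient u x) + c) ∧
  gradient u '' Ω = Ωt

/-- A uniformly convex `C^{2}` solution of the second boundary value problem. -/
def IsUCSol (Ω Ωt : Set (Euc n)) (f : Euc n × Euc n → ℝ) (c : ℝ) (u : Euc n → ℝ) : Prop :=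
  ContDiffOn ℝ 2 u (closure Ω) ∧
  (∃ δ : ℝ, 0 < δ ∧ ∀ x ∈ closure Ω, MatLE (δ • (1 : Matrix (Fin n) (Fin n) ℝ)) (Hess u x)) ∧
  (∀ x ∈ closure Ω, ‖gradient u x‖ < 1) ∧
  (∀ x ∈ Ω, MinkDiv u x = f (x, gradient u x) + c) ∧
  gradient u '' Ω = Ωt

/-- A uniformly convex `C^{4,α}` solution of the second boundary value problem
for the Minkowski mean-curvature operator. -/
def IsC4Sol (Ω Ωt : Set (Euc n)) (f : Euc n × Euc n → ℝ) (c : ℝ) (u : Euc n → ℝ)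
    (α : ℝ) : Prop :=
  ContDiffOn ℝ 4 u (closure Ω) ∧
  (∃ C : ℝ≥0, HolderOnWith C (Real.toNNReal α) (fun x => iteratedFDeriv ℝ 4 u x) (closure Ω)) ∧
  (∃ δ : ℝ, 0 < δ ∧ ∀ x ∈ closure Ω, MatLE (δ • (1 : Matrix (Fin n) (Fin n) ℝ)) (Hess u x)) ∧
  (∀ x ∈ closure Ω, ‖gradient u x‖ < 1) ∧
  (∀ x ∈ Ω, MinkDiv u x = f (x, gradient u x) + c) ∧
  gradient u '' Ω = Ωt

/-- A uniformly convex `C^{4,α}` solution of the second boundary value problem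
for the Euclidean mean-curvature operator. -/
def IsC4SolE (Ω Ωt : Set (Euc n)) (f : Euc n × Euc n → ℝ) (c : ℝ) (u : Euc n → ℝ)
    (α : ℝ) : Prop :=
  ContDiffOn ℝ 4 u (closure Ω) ∧
  (∃ C : ℝ≥0, HolderOnWith C (Real.toNNReal α) (fun x => iteratedFDeriv ℝ 4 u x) (closure Ω)) ∧
  (∃ δ : ℝ, 0 < δ ∧ ∀ x ∈ closure Ω, MatLE (δ • (1 : Matrix (Fin n) (Fin n) ℝ)) (Hess u x)) ∧
  (∀ x ∈ Ω, EucDiv u x = f (x, gradient u x) + c) ∧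
  gradient u '' Ω = Ωt

/-- `ũ` is the Legendre transform of `u`. -/
def IsLegendre (Ω Ωt : Set (Euc n)) (u ut : Euc n → ℝ) : Prop :=
  ContDiffOn ℝ (⊤ : ℕ∞) ut (closure Ωt) ∧
  (∀ x ∈ closure Ω, ut (gradient u x) = ⟪x, gradient u x⟫ - u x) ∧
  (∀ x ∈ closure Ω, gradient ut (gradient u x) = x) ∧
  (∀ x ∈ closure Ω, Hess ut (gradient u x) = (Hess u x)⁻¹)

/-! ### Second order jets and the second derivative test -/

section Jets

variable {E : Type*} [NormedAddCommGroup E] [InnerProductSpace ℝ E]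

/-- `g` is differentiable near `y`, with derivative `g'` at `y`, and the second derivative of `g`
at `y` in the direction `v` is `q v`. -/
def HasJet (g : E → ℝ) (y : E) (g' : E →L[ℝ] ℝ) (q : E → ℝ) : Prop :=
  ∃ D : E → E →L[ℝ] ℝ, (∀ᶠ z in 𝓝 y, HasFDerivAt g (D z) z) ∧ D y = g' ∧
    ∀ v, HasLineDerivAt ℝ (fun z => D z v) (q v) y v

theorem HasJet.hasFDerivAt {g : E → ℝ} {y : E} {g' : E →L[ℝ] ℝ} {q : E → ℝ}
    (hg : HasJet g y g' q) : HasFDerivAt g g' y := by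
  obtain ⟨D, hD, rfl, -⟩ := hg
  exact hD.self_of_nhds

theorem HasJet.add {g k : E → ℝ} {y : E} {g' k' : E →L[ℝ] ℝ} {q p : E → ℝ}
    (hg : HasJet g y g' q) (hk : HasJet k y k' p) :
    HasJet (fun z => g z + k z) y (g' + k') (fun v => q v + p v) := by
  obtain ⟨D, hD, rfl, hq⟩ := hg
  obtain ⟨D', hD', rfl, hp⟩ := hk
  refine ⟨fun z => D z + D' z, ?_, rfl, fun v => ?_⟩
  · filter_upwards [hD, hD'] with z h1 h2 using h1.add h2
  · exact HasDerivAt.add (hq v) (hp v)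

theorem HasJet.const_mul {g : E → ℝ} {y : E} {g' : E →L[ℝ] ℝ} {q : E → ℝ}
    (a : ℝ) (hg : HasJet g y g' q) :
    HasJet (fun z => a * g z) y (a • g') (fun v => a * q v) := by
  obtain ⟨D, hD, rfl, hq⟩ := hg
  refine ⟨fun z => a • D z, ?_, rfl, fun v => ?_⟩
  · filter_upwards [hD] with z h1 using h1.const_mul a
  · exact HasDerivAt.const_mul a (hq v)

theorem HasJet.sum {ι : Type*} (t : Finset ι) {g : ι → E → ℝ} {y : E} {g' : ι → E →L[ℝ] ℝ}
    {q : ι → E → ℝ} (hg : ∀ i, HasJet (g i) y (g' i) (q i)) :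
    HasJet (fun z => ∑ i ∈ t, g i z) y (∑ i ∈ t, g' i) (fun v => ∑ i ∈ t, q i v) := by
  classical
  induction t using Finset.induction_on with
  | empty =>
    refine ⟨fun _ => 0, ?_, by simp, fun v => ?_⟩
    · exact Filter.Eventually.of_forall fun z => by simpa using hasFDerivAt_const (0 : ℝ) z
    · simpa [HasLineDerivAt] using hasDerivAt_const (0 : ℝ) (0 : ℝ)
  | insert i t hi ih =>
    simpa [Finset.sum_insert hi] using (hg i).add ih

/-- At a local maximum the second derivative is nonpositive in every direction. -/
theorem HasJet.nonpos_of_isLocalMax {g : E → ℝ} {y : E} {g' : E →L[ℝ] ℝ} {q : E → ℝ}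
    (hg : HasJet g y g' q) (hmax : IsLocalMax g y) (v : E) : q v ≤ 0 := by
  have hg'0 : g' = 0 := hmax.hasFDerivAt_eq_zero hg.hasFDerivAt
  obtain ⟨D, hD, hDy, hq⟩ := hg
  by_contra! hpos
  set φ : ℝ → ℝ := fun t => g (y + t • v) with hφ
  have hline : Filter.Tendsto (fun t : ℝ => y + t • v) (𝓝 0) (𝓝 y) := by
    have : Continuous fun t : ℝ => y + t • v := by fun_prop
    simpa using this.tendsto 0
  have hφd : ∀ᶠ t in 𝓝 (0 : ℝ), HasDerivAt φ (D (y + t • v) v) t := by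
    filter_upwards [hline.eventually hD] with t ht
    have h1 : HasDerivAt (fun t : ℝ => y + t • v) v t := by
      simpa using ((hasDerivAt_id t).smul_const v).const_add y
    exact ht.comp_hasDerivAt t h1
  have hderiv : deriv φ =ᶠ[𝓝 0] fun t => D (y + t • v) v :=
    hφd.mono fun t ht => ht.deriv
  have h2 : deriv (deriv φ) 0 = q v := by
    rw [hderiv.deriv_eq]
    exact (hq v).deriv
  have h1 : deriv φ 0 = 0 := by
    rw [hderiv.self_of_nhds]
    simp [hDy, hg'0]
  have hmin : IsLocalMin φ 0 :=
    isLocalMin_of_deriv_deriv_pos (by rw [h2]; exact hpos) h1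
      hφd.self_of_nhds.continuousAt
  have hmax' : ∀ᶠ t in 𝓝 (0 : ℝ), φ t ≤ φ 0 := by
    have := hline.eventually hmax
    simpa [hφ] using this
  have hconst : φ =ᶠ[𝓝 0] fun _ => φ 0 := by
    filter_upwards [hmin, hmax'] with t h3 h4 using le_antisymm h4 h3
  have h5 : deriv φ =ᶠ[𝓝 0] fun _ => (0 : ℝ) := by
    filter_upwards [hconst.deriv] with t ht
    simpa using ht
  rw [h5.deriv_eq] at h2
  simp at h2
  exact hpos.ne h2

theorem HasJet.nonneg_of_isLocalMin {g : E → ℝ} {y : E} {g' : E →L[ℝ] ℝ} {q : E → ℝ}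
    (hg : HasJet g y g' q) (hmin : IsLocalMin g y) (v : E) : 0 ≤ q v := by
  have h1 := (hg.const_mul (-1)).nonpos_of_isLocalMax
    (show IsLocalMax (fun z => -1 * g z) y by simpa using hmin.neg) v
  linarith

/-- Maximum principle for the operator `g ↦ ∑ i, D²g (v i) (v i) + Dg w`. -/
theorem le_of_jet_pos {ι : Type*} [Fintype ι] {D : Set E} (hD : IsOpen D)
    (hcpt : IsCompact (closure D)) (v : E → ι → E) (w : E → E) {g : E → ℝ}
    (hcont : ContinuousOn g (closure D)) {c : ℝ} (hbdry : ∀ y ∈ frontier D, g y ≤ c)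
    (hjet : ∀ y ∈ D, ∃ (g' : E →L[ℝ] ℝ) (q : E → ℝ), HasJet g y g' q ∧
      0 < ∑ i, q (v y i) + g' (w y)) :
    ∀ y ∈ closure D, g y ≤ c := by
  intro y hy
  obtain ⟨z, hz, hmax⟩ := hcpt.exists_isMaxOn ⟨y, hy⟩ hcont
  refine (hmax hy).trans ?_
  by_cases hzD : z ∈ D
  · exfalso
    obtain ⟨g', q, hg, hpos⟩ := hjet z hzD
    have hloc : IsLocalMax g z :=
      (hmax.on_subset subset_closure).isLocalMax (hD.mem_nhds hzD)
    have h0 : g' = 0 := hloc.hasFDerivAt_eq_zero hg.hasFDerivAt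
    have : ∑ i, q (v z i) ≤ 0 :=
      Finset.sum_nonpos fun i _ => hg.nonpos_of_isLocalMax hloc _
    simp [h0] at hpos
    linarith
  · exact hbdry z ⟨hz, by rwa [hD.interior_eq]⟩

end Jets

/-! ### Boundary derivatives on superlevel sets -/

section Boundary

variable {E : Type*} [NormedAddCommGroup E] [InnerProductSpace ℝ E]

/-- A direction along which a defining function increases points into the superlevel set. -/
theorem eventually_mem_of_inner_pos {D : Set E} {h : E → ℝ} {y b w : E}
    (hDeq : D = {z | 0 < h z}) (hh : HasFDerivAt h (innerSL ℝ b) y) (hy : h y = 0)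
    (hw : 0 < ⟪b, w⟫) : ∀ᶠ t : ℝ in 𝓝[>] 0, y + t • w ∈ D := by
  have h1 : HasDerivAt (fun t : ℝ => h (y + t • w)) ⟪b, w⟫ 0 := by
    have := hh.hasLineDerivAt w
    simpa [HasLineDerivAt] using this
  have h2 := (hasDerivAt_iff_tendsto_slope.1 h1).mono_left
    (nhdsWithin_mono 0 (fun t (ht : 0 < t) => ht.ne'))
  filter_upwards [h2.eventually (lt_mem_nhds hw), self_mem_nhdsWithin] with t ht htpos
  rw [hDeq, mem_ofPred_eq]
  simp only [slope_def_field, zero_smul, add_zero, hy, sub_zero] at ht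
  exact (div_pos_iff_of_pos_right htpos).1 ht

/-- One-sided first derivative test at a boundary point. -/
theorem deriv_nonpos_of_isMaxOn {D : Set E} {h g : E → ℝ} {y b w : E} {g' : E →L[ℝ] ℝ}
    (hDeq : D = {z | 0 < h z}) (hh : HasFDerivAt h (innerSL ℝ b) y) (hy : h y = 0)
    (hw : 0 < ⟪b, w⟫) (hg : HasFDerivWithinAt g g' (closure D) y)
    (hmax : IsMaxOn g (closure D) y) : g' w ≤ 0 := by
  refine IsLocalMaxOn.hasFDerivWithinAt_nonpos hmax.localize hg
    (mem_posTangentConeAt_of_frequently_mem ?_)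
  exact ((eventually_mem_of_inner_pos hDeq hh hy hw).mono
    fun t ht => subset_closure ht).frequently

/-- A function vanishing on the boundary has vanishing tangential derivatives there. -/
theorem deriv_tangential_eq_zero {D : Set E} {h g : E → ℝ} {y b e : E} {g' : E →L[ℝ] ℝ}
    (hD : IsOpen D)
    (hDeq : D = {z | 0 < h z}) (hh : HasFDerivAt h (innerSL ℝ b) y) (hy : y ∈ frontier D)
    (hy0 : h y = 0) (hb : ‖b‖ = 1) (hsuper : ∀ z, h z ≤ h y + ⟪b, z - y⟫) (he : ⟪b, e⟫ = 0)
    (hg : HasFDerivWithinAt g g' (closure D) y) (hzero : ∀ z ∈ frontier D, g z = 0) :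
    g' e = 0 := by
  have key : ∀ η : ℝ, 0 < η → |g' e| ≤ η * (‖g'‖ + ‖e‖ + η) := by
    intro η hη
    have hlo := (hasFDerivWithinAt_iff_isLittleO.1 hg).def hη
    rw [eventually_nhdsWithin_iff, Metric.eventually_nhds_iff] at hlo
    obtain ⟨δ, hδ, hball⟩ := hlo
    have hin : 0 < ⟪b, e + η • b⟫ := by
      rw [inner_add_right, he, inner_smul_right, real_inner_self_eq_norm_sq, hb]
      simpa using hη
    have hlim : Filter.Tendsto (fun t : ℝ => t * (‖e‖ + η)) (𝓝[>] 0) (𝓝 0) := by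
      have : Continuous (fun t : ℝ => t * (‖e‖ + η)) := by fun_prop
      simpa using (this.tendsto 0).mono_left nhdsWithin_le_nhds
    obtain ⟨t, ⟨htD, htδ⟩, ht0 : 0 < t⟩ :=
      (((eventually_mem_of_inner_pos hDeq hh hy0 hin).and
        (hlim.eventually (gt_mem_nhds hδ))).and self_mem_nhdsWithin).exists
    have hout : y + t • e ∉ D := by
      rw [hDeq]
      have := hsuper (y + t • e)
      simp only [add_sub_cancel_left, inner_smul_right, he, hy0] at this
      simpa using this
    obtain ⟨z, hzs, hzf⟩ : (segment ℝ (y + t • e) (y + t • (e + η • b)) ∩ frontier D).Nonempty := by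
      by_contra hemp
      rw [not_nonempty_iff_eq_empty] at hemp
      have hsub := (convex_segment (𝕜 := ℝ) (y + t • e) (y + t • (e + η • b))).isPreconnected
        |>.subset_of_closure_inter_subset hD ⟨_, right_mem_segment ℝ _ _, htD⟩ (by
          rintro x ⟨hx1, hx2⟩
          by_contra hxD
          have : x ∈ segment ℝ (y + t • e) (y + t • (e + η • b)) ∩ frontier D :=
            ⟨hx2, hx1, by rwa [hD.interior_eq]⟩
          rw [hemp] at this
          exact this)
      exact hout (hsub (left_mem_segment ℝ _ _))
    obtain ⟨s, hs, rfl⟩ : ∃ s ∈ Icc (0 : ℝ) 1, z = y + t • (e + (s * η) • b) := by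
      rw [segment_eq_image'] at hzs
      obtain ⟨s, hs, rfl⟩ := hzs
      refine ⟨s, hs, ?_⟩
      simp only [smul_add, add_sub_add_left_eq_sub, add_sub_cancel_left, smul_smul]
      rw [add_assoc, mul_left_comm]
    have hsη : |s * η| ≤ η := by
      rw [abs_of_nonneg (mul_nonneg hs.1 hη.le)]
      nlinarith [hs.2]
    have hnorm : ‖e + (s * η) • b‖ ≤ ‖e‖ + η := by
      refine (norm_add_le _ _).trans ?_
      rw [norm_smul, hb, Real.norm_eq_abs]
      linarith
    have hest := hball (y := y + t • (e + (s * η) • b)) (by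
      rw [dist_eq_norm, add_sub_cancel_left, norm_smul, Real.norm_eq_abs, abs_of_pos ht0]
      exact (mul_le_mul_of_nonneg_left hnorm ht0.le).trans_lt htδ) (frontier_subset_closure hzf)
    rw [hzero _ hzf, hzero _ hy, add_sub_cancel_left, sub_zero, zero_sub, norm_neg, map_smul,
      norm_smul, norm_smul, Real.norm_eq_abs t, abs_of_pos ht0, ← mul_assoc, mul_comm η t,
      mul_assoc] at hest
    have hest' := le_of_mul_le_mul_left hest ht0
    have hsplit : g' e = g' (e + (s * η) • b) - (s * η) * g' b := by simp
    have hgb : |g' b| ≤ ‖g'‖ := by simpa [hb] using g'.le_opNorm b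
    calc |g' e| ≤ |g' (e + (s * η) • b)| + |s * η| * |g' b| := by
          rw [hsplit, ← abs_mul]; exact abs_sub _ _
      _ ≤ η * (‖e‖ + η) + η * ‖g'‖ := by
          refine add_le_add (hest'.trans ?_) ?_
          · exact mul_le_mul_of_nonneg_left hnorm hη.le
          · exact mul_le_mul hsη hgb (abs_nonneg _) hη.le
      _ = η * (‖g'‖ + ‖e‖ + η) := by ring
  by_contra hne
  have hpos : 0 < |g' e| := abs_pos.2 hne
  have hlim : Filter.Tendsto (fun η : ℝ => η * (‖g'‖ + ‖e‖ + η)) (𝓝[>] 0) (𝓝 0) := by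
    have : Continuous (fun η : ℝ => η * (‖g'‖ + ‖e‖ + η)) := by fun_prop
    simpa using (this.tendsto 0).mono_left nhdsWithin_le_nhds
  obtain ⟨η, h1, h2⟩ := ((hlim.eventually (gt_mem_nhds hpos)).and self_mem_nhdsWithin).exists
  exact absurd (key η h2) (not_le.2 h1)

end Boundary

/-! ### The dual problem: interior differential inequalities -/

/-- A solution of the dual equation `∑ i ⟪r i y, (T y)⁻¹ (r i y)⟫ = F y` on the superlevel set
`D = {h > 0}`, where `T` is the derivative of a gradient map `G` satisfying `ht ∘ G = 0` on the
boundary, together with the quantitative bounds needed for second derivative estimates. -/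
structure DualSystem (E : Type*) [NormedAddCommGroup E] [InnerProductSpace ℝ E]
    (ι : Type*) [Fintype ι] (Λ κ θt ε : ℝ) where
  /-- the domain -/
  D : Set E
  /-- defining function of the domain -/
  h : E → ℝ
  /-- gradient of `h` -/
  b : E → E
  /-- Hessian of `h` -/
  B : E → E →L[ℝ] E
  /-- third derivative of `h` -/
  B1 : E → E →L[ℝ] E →L[ℝ] E
  /-- defining function of the target -/
  ht : E → ℝ
  /-- gradient of `ht` -/
  bt : E → E
  /-- Hessian of `ht` -/
  Bt : E → E →L[ℝ] E
  /-- frame of vector fields whose Gram operator is the coefficient matrix -/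
  r : ι → E → E
  /-- first derivative of the frame -/
  r1 : ι → E → E →L[ℝ] E
  /-- second derivative of the frame -/
  r2 : ι → E → E →L[ℝ] E →L[ℝ] E
  /-- gradient map -/
  G : E → E
  /-- derivative of the gradient map -/
  T : E → E →L[ℝ] E
  /-- second derivative of the gradient map -/
  T1 : E → E →L[ℝ] E →L[ℝ] E
  /-- third derivative of the gradient map -/
  T2 : E → E →L[ℝ] E →L[ℝ] E →L[ℝ] E
  /-- the preimages `(T y)⁻¹ (r i y)` -/
  v : E → ι → E
  /-- right-hand side -/
  F : E → ℝ
  /-- derivative of the right-hand side in the gradient variable -/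
  fx : E → E
  /-- derivative of the right-hand side in the position variable -/
  fp : E → E →L[ℝ] ℝ
  /-- second directional derivative of the right-hand side -/
  qF : E → E → ℝ
  one_le : 1 ≤ Λ
  κ_pos : 0 < κ
  θt_pos : 0 < θt
  ε_nonneg : 0 ≤ ε
  ε_le_one : ε ≤ 1
  ε_small : 4 * ε * Λ ≤ κ
  card_le : (Fintype.card ι : ℝ) ≤ Λ
  D_open : IsOpen D
  D_convex : Convex ℝ D
  D_compact : IsCompact (closure D)
  D_eq : D = {y | 0 < h y}
  h_deriv : ∀ y, HasFDerivAt h (innerSL ℝ (b y)) y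
  b_deriv : ∀ y, HasFDerivAt b (B y) y
  B_deriv : ∀ y, HasFDerivAt B (B1 y) y
  h_super : ∀ y z, h z ≤ h y + ⟪b y, z - y⟫
  h_le : ∀ y ∈ closure D, h y ≤ Λ
  B_le : ∀ y ∈ closure D, ‖B y‖ ≤ Λ
  B1_le : ∀ y ∈ closure D, ‖B1 y‖ ≤ Λ
  b_le : ∀ y ∈ closure D, ‖b y‖ ≤ Λ
  b_norm : ∀ y ∈ frontier D, ‖b y‖ = 1
  ht_deriv : ∀ x, HasFDerivAt ht (innerSL ℝ (bt x)) x
  bt_deriv : ∀ x, HasFDerivAt bt (Bt x) x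
  Bt_neg : ∀ x a, ⟪Bt x a, a⟫ ≤ -θt * ‖a‖ ^ 2
  bt_le : ∀ y ∈ closure D, ‖bt (G y)‖ ≤ Λ
  Bt_le : ∀ y ∈ closure D, ‖Bt (G y)‖ ≤ Λ
  bt_lip : ∀ y ∈ closure D, ∀ z ∈ closure D, ‖bt (G y) - bt (G z)‖ ≤ Λ * ‖G y - G z‖
  G_diam : ∀ y ∈ closure D, ∀ z ∈ closure D, ‖G y - G z‖ ≤ Λ
  ht_nonneg : ∀ y ∈ closure D, 0 ≤ ht (G y)
  ht_frontier : ∀ y ∈ frontier D, ht (G y) = 0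
  bt_norm : ∀ y ∈ frontier D, ‖bt (G y)‖ = 1
  r_deriv : ∀ i, ∀ y ∈ D, HasFDerivAt (r i) (r1 i y) y
  r1_deriv : ∀ i, ∀ y ∈ D, HasFDerivAt (r1 i) (r2 i y) y
  r_le : ∀ i, ∀ y ∈ D, ‖r i y‖ ≤ Λ
  r1_le : ∀ i, ∀ y ∈ D, ‖r1 i y‖ ≤ Λ
  r2_le : ∀ i, ∀ y ∈ D, ‖r2 i y‖ ≤ Λ
  r_frame : ∀ y ∈ D, ∀ z, ‖z‖ ^ 2 ≤ ∑ i, ⟪r i y, z⟫ ^ 2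
  G_deriv : ∀ y ∈ closure D, HasFDerivWithinAt G (T y) (closure D) y
  T_deriv : ∀ y ∈ closure D, HasFDerivWithinAt T (T1 y) (closure D) y
  T1_deriv : ∀ y ∈ D, HasFDerivAt T1 (T2 y) y
  T_symm : ∀ y ∈ closure D, ∀ a c, ⟪T y a, c⟫ = ⟪a, T y c⟫
  T_pos : ∀ y ∈ closure D, ∀ a, a ≠ 0 → 0 < ⟪T y a, a⟫
  T1_swap : ∀ y ∈ closure D, ∀ a c, T1 y a c = T1 y c a
  T1_symm : ∀ y ∈ closure D, ∀ a c d, ⟪T1 y a c, d⟫ = ⟪T1 y a d, c⟫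
  T2_swap : ∀ y ∈ D, ∀ a c, ⟪T2 y a a c, c⟫ = ⟪T2 y c c a, a⟫
  v_spec : ∀ y ∈ D, ∀ i, T y (v y i) = r i y
  equation : ∀ y ∈ D, ∑ i, ⟪r i y, v y i⟫ = F y
  F_le : ∀ y ∈ D, F y ≤ Λ
  F_jet : ∀ y ∈ D, HasJet F y ((innerSL ℝ (fx y)).comp (T y) + fp y) (qF y)
  qF_le : ∀ y ∈ D, ∀ a, ‖a‖ = 1 → qF y a ≤ 2 * ε * ‖T y a‖ + Λ + ⟪fx y, T1 y a a⟫
  fp_le : ∀ y ∈ D, ‖fp y‖ ≤ Λ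
  barrier : ∀ y ∈ D, ∑ i, ⟪B y (v y i), v y i⟫ + ⟪b y, fx y⟫ ≤ -κ
  fx_le : ∀ y ∈ D, ‖fx y‖ ≤ ε

namespace DualSystem

variable {E : Type*} [NormedAddCommGroup E] [InnerProductSpace ℝ E]
  {ι : Type*} [Fintype ι] {Λ κ θt ε : ℝ} (S : DualSystem E ι Λ κ θt ε)

theorem closure_mem_nhds {y : E} (hy : y ∈ S.D) : closure S.D ∈ 𝓝 y :=
  Filter.mem_of_superset (S.D_open.mem_nhds hy) subset_closure

theorem G_hasFDerivAt {y : E} (hy : y ∈ S.D) : HasFDerivAt S.G (S.T y) y :=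
  (S.G_deriv y (subset_closure hy)).hasFDerivAt (S.closure_mem_nhds hy)

theorem T_hasFDerivAt {y : E} (hy : y ∈ S.D) : HasFDerivAt S.T (S.T1 y) y :=
  (S.T_deriv y (subset_closure hy)).hasFDerivAt (S.closure_mem_nhds hy)

theorem T_continuousOn : ContinuousOn S.T (closure S.D) :=
  fun y hy => (S.T_deriv y hy).continuousWithinAt

theorem G_continuousOn : ContinuousOn S.G (closure S.D) :=
  fun y hy => (S.G_deriv y hy).continuousWithinAt

theorem T_nonneg {y : E} (hy : y ∈ closure S.D) (a : E) : 0 ≤ ⟪S.T y a, a⟫ := by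
  rcases eq_or_ne a 0 with rfl | ha
  · simp
  · exact (S.T_pos y hy a ha).le

/-- Completing the square. -/
theorem two_mul_inner_sub_le {y : E} (hy : y ∈ S.D) (i : ι) (w : E) :
    2 * ⟪S.r i y, w⟫ - ⟪S.T y w, w⟫ ≤ ⟪S.r i y, S.v y i⟫ := by
  have h1 := S.T_nonneg (subset_closure hy) (S.v y i - w)
  rw [map_sub, inner_sub_left, inner_sub_right, inner_sub_right, S.v_spec y hy i,
    S.T_symm y (subset_closure hy) w (S.v y i), S.v_spec y hy i, real_inner_comm (S.r i y) w] at h1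
  linarith

theorem norm_sq_le_of_mem {y : E} (hy : y ∈ S.D) (z : E) :
    ‖z‖ ^ 2 ≤ Λ * ⟪S.T y z, z⟫ := by
  rcases eq_or_ne z 0 with rfl | hz
  · simp
  have hτ := S.T_pos y (subset_closure hy) z hz
  set τ := ⟪S.T y z, z⟫ with hτdef
  have h1 : ∀ i, ⟪S.r i y, z⟫ ^ 2 / τ ≤ ⟪S.r i y, S.v y i⟫ := by
    intro i
    have := S.two_mul_inner_sub_le hy i ((⟪S.r i y, z⟫ / τ) • z)
    rw [map_smul, inner_smul_right, inner_smul_right, inner_smul_left, ← hτdef] at this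
    refine le_trans (le_of_eq ?_) this
    simp only [conj_trivial]
    field_simp
    ring
  have h2 : (∑ i, ⟪S.r i y, z⟫ ^ 2) / τ ≤ Λ := by
    rw [Finset.sum_div]
    exact (Finset.sum_le_sum fun i _ => h1 i).trans ((S.equation y hy).le.trans (S.F_le y hy))
  rw [div_le_iff₀ hτ] at h2
  exact (S.r_frame y hy z).trans h2

theorem norm_sq_le {y : E} (hy : y ∈ closure S.D) (z : E) :
    ‖z‖ ^ 2 ≤ Λ * ⟪S.T y z, z⟫ := by
  have hcont : ContinuousOn (fun y => Λ * ⟪S.T y z, z⟫) (closure S.D) :=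
    continuousOn_const.mul ((S.T_continuousOn.clm_apply continuousOn_const).inner
      continuousOn_const)
  exact ContinuousWithinAt.closure_le hy continuousWithinAt_const
    ((hcont y hy).mono subset_closure) fun x hx => S.norm_sq_le_of_mem hx z

theorem norm_v_le {y : E} (hy : y ∈ S.D) (i : ι) : ‖S.v y i‖ ≤ Λ ^ 2 := by
  have h1 := S.norm_sq_le_of_mem hy (S.v y i)
  rw [S.v_spec y hy i] at h1
  have h2 := real_inner_le_norm (S.r i y) (S.v y i)
  have h3 := S.r_le i y hy
  have h0 := S.one_le
  by_contra! hlt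
  have hv : 0 < ‖S.v y i‖ := lt_trans (by positivity) hlt
  have h4 : ⟪S.r i y, S.v y i⟫ ≤ Λ * ‖S.v y i‖ :=
    h2.trans (mul_le_mul_of_nonneg_right h3 hv.le)
  have h5 : ‖S.v y i‖ ^ 2 ≤ Λ * (Λ * ‖S.v y i‖) :=
    h1.trans (mul_le_mul_of_nonneg_left h4 (by linarith))
  nlinarith

theorem jet_h (y : E) : HasJet S.h y (innerSL ℝ (S.b y)) (fun v => ⟪S.B y v, v⟫) := by
  refine ⟨fun z => innerSL ℝ (S.b z), Filter.Eventually.of_forall S.h_deriv, rfl, fun v => ?_⟩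
  have : HasFDerivAt (fun z => ⟪S.b z, v⟫) (((innerSL ℝ v : E →L[ℝ] ℝ)).comp (S.B y)) y := by
    refine (((innerSL ℝ v).hasFDerivAt).comp y (S.b_deriv y)).congr_of_eventuallyEq ?_
    exact Filter.Eventually.of_forall fun z => by simp [real_inner_comm]
  simpa [real_inner_comm] using this.hasLineDerivAt v

theorem jet_inner_b (ξ y : E) : HasJet (fun z => ⟪ξ, S.b z⟫) y ((innerSL ℝ ξ).comp (S.B y))
    (fun v => ⟪ξ, S.B1 y v v⟫) := by
  refine ⟨fun z => (innerSL ℝ ξ).comp (S.B z), Filter.Eventually.of_forall fun z => ?_, rfl,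
    fun v => ?_⟩
  · exact ((innerSL ℝ ξ).hasFDerivAt).comp z (S.b_deriv z)
  · have h1 : HasFDerivAt (fun z => S.B z v) ((S.B1 y).flip v) y := by
      simpa using (S.B_deriv y).clm_apply (hasFDerivAt_const v y)
    simpa [Function.comp_def] using (((innerSL ℝ ξ).hasFDerivAt).comp y h1).hasLineDerivAt v

theorem jet_T (ξ : E) {y : E} (hy : y ∈ S.D) : HasJet (fun z => ⟪S.T z ξ, ξ⟫) y
    ((innerSL ℝ ξ).comp ((S.T1 y).flip ξ)) (fun v => ⟪S.T2 y v v ξ, ξ⟫) := by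
  refine ⟨fun z => (innerSL ℝ ξ).comp ((S.T1 z).flip ξ), ?_, rfl, fun v => ?_⟩
  · filter_upwards [S.D_open.mem_nhds hy] with z hz
    have h1 : HasFDerivAt (fun z => S.T z ξ) ((S.T1 z).flip ξ) z := by
      simpa using (S.T_hasFDerivAt hz).clm_apply (hasFDerivAt_const ξ z)
    refine (((innerSL ℝ ξ).hasFDerivAt).comp z h1).congr_of_eventuallyEq ?_
    exact Filter.Eventually.of_forall fun z => by simp [real_inner_comm]
  · have h1 : HasFDerivAt (fun z => S.T1 z v ξ) (((S.T2 y).flip v).flip ξ) y := by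
      have h2 : HasFDerivAt (fun z => S.T1 z v) ((S.T2 y).flip v) y := by
        simpa using (S.T1_deriv y hy).clm_apply (hasFDerivAt_const v y)
      simpa using h2.clm_apply (hasFDerivAt_const ξ y)
    simpa [real_inner_comm, Function.comp_def] using
      (((innerSL ℝ ξ).hasFDerivAt).comp y h1).hasLineDerivAt v

theorem jet_r (i : ι) (ξ : E) {y : E} (hy : y ∈ S.D) : HasJet (fun z => ⟪S.r i z, ξ⟫) y
    ((innerSL ℝ ξ).comp (S.r1 i y)) (fun v => ⟪S.r2 i y v v, ξ⟫) := by
  refine ⟨fun z => (innerSL ℝ ξ).comp (S.r1 i z), ?_, rfl, fun v => ?_⟩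
  · filter_upwards [S.D_open.mem_nhds hy] with z hz
    refine (((innerSL ℝ ξ).hasFDerivAt).comp z (S.r_deriv i z hz)).congr_of_eventuallyEq ?_
    exact Filter.Eventually.of_forall fun z => by simp [real_inner_comm]
  · have h1 : HasFDerivAt (fun z => S.r1 i z v) ((S.r2 i y).flip v) y := by
      simpa using (S.r1_deriv i y hy).clm_apply (hasFDerivAt_const v y)
    simpa [real_inner_comm, Function.comp_def] using
      (((innerSL ℝ ξ).hasFDerivAt).comp y h1).hasLineDerivAt v

theorem jet_comp {ψ : E → ℝ} {N : E → E} {H : E → E →L[ℝ] E}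
    (hψ : ∀ x, HasFDerivAt ψ (innerSL ℝ (N x)) x) (hN : ∀ x, HasFDerivAt N (H x) x)
    {y : E} (hy : y ∈ S.D) : HasJet (fun z => ψ (S.G z)) y
      ((innerSL ℝ (N (S.G y))).comp (S.T y))
      (fun v => ⟪H (S.G y) (S.T y v), S.T y v⟫ + ⟪N (S.G y), S.T1 y v v⟫) := by
  refine ⟨fun z => (innerSL ℝ (N (S.G z))).comp (S.T z), ?_, rfl, fun v => ?_⟩
  · filter_upwards [S.D_open.mem_nhds hy] with z hz
    exact (hψ (S.G z)).comp z (S.G_hasFDerivAt hz)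
  · have h1 : HasFDerivAt (fun z => S.T z v) ((S.T1 y).flip v) y := by
      simpa using (S.T_hasFDerivAt hy).clm_apply (hasFDerivAt_const v y)
    have h2 : HasFDerivAt (fun z => N (S.G z)) ((H (S.G y)).comp (S.T y)) y :=
      (hN (S.G y)).comp y (S.G_hasFDerivAt hy)
    have h3 := (h2.inner ℝ h1).hasLineDerivAt v
    simpa [fderivInnerCLM_apply, add_comm] using h3

/-- The equation linearised at `y` by convexity: the function below has a minimum at `y`. -/
theorem touching_jet {y : E} (hy : y ∈ S.D) :
    HasJet (fun z => ∑ i, ⟪S.T z (S.v y i), S.v y i⟫ +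
        (-2 * ∑ i, ⟪S.r i z, S.v y i⟫ + S.F z)) y
      (∑ i, (innerSL ℝ (S.v y i)).comp ((S.T1 y).flip (S.v y i)) +
        (((-2 : ℝ) • ∑ i, (innerSL ℝ (S.v y i)).comp (S.r1 i y)) +
          ((innerSL ℝ (S.fx y)).comp (S.T y) + S.fp y)))
      (fun a => ∑ i, ⟪S.T2 y a a (S.v y i), S.v y i⟫ +
        (-2 * ∑ i, ⟪S.r2 i y a a, S.v y i⟫ + S.qF y a)) :=
  (HasJet.sum _ fun i => S.jet_T (S.v y i) hy).add
    (((HasJet.sum _ fun i => S.jet_r i (S.v y i) hy).const_mul (-2)).add (S.F_jet y hy))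

theorem touching_isLocalMin {y : E} (hy : y ∈ S.D) :
    IsLocalMin (fun z => ∑ i, ⟪S.T z (S.v y i), S.v y i⟫ +
        (-2 * ∑ i, ⟪S.r i z, S.v y i⟫ + S.F z)) y := by
  filter_upwards [S.D_open.mem_nhds hy] with z hz
  have h0 : ∑ i, ⟪S.T y (S.v y i), S.v y i⟫ + (-2 * ∑ i, ⟪S.r i y, S.v y i⟫ + S.F y) = 0 := by
    simp only [S.v_spec y hy, S.equation y hy]
    ring
  rw [h0, ← S.equation z hz, Finset.mul_sum, ← Finset.sum_add_distrib, ← Finset.sum_add_distrib]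
  refine Finset.sum_nonneg fun i _ => ?_
  linarith [S.two_mul_inner_sub_le hz i (S.v y i)]

theorem sum_T1_inner {y : E} (hy : y ∈ S.D) (e : E) :
    ⟪e, ∑ i, S.T1 y (S.v y i) (S.v y i)⟫ =
      2 * ∑ i, ⟪S.v y i, S.r1 i y e⟫ - ⟪S.fx y, S.T y e⟫ - S.fp y e := by
  have h1 := (S.touching_isLocalMin hy).hasFDerivAt_eq_zero (S.touching_jet hy).hasFDerivAt
  have h2 := congrArg (fun l : E →L[ℝ] ℝ => l e) h1
  simp only [_root_.add_apply, _root_.sum_apply,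
    ContinuousLinearMap.comp_apply, ContinuousLinearMap.flip_apply, innerSL_apply_apply,
    _root_.smul_apply, smul_eq_mul, _root_.zero_apply] at h2
  have h3 : ∀ i, ⟪S.v y i, S.T1 y e (S.v y i)⟫ = ⟪e, S.T1 y (S.v y i) (S.v y i)⟫ := by
    intro i
    rw [S.T1_swap y (subset_closure hy) e, real_inner_comm, S.T1_symm y (subset_closure hy),
      real_inner_comm]
  simp only [h3] at h2
  rw [inner_sum]
  linarith

/-- The linearised operator applied to a function of the gradient is bounded. -/
theorem operator_comp_le {N : E → E} {H : E → E →L[ℝ] E} {y : E} (hy : y ∈ S.D) {c : ℝ}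
    (hN : ‖N (S.G y)‖ ≤ c) (hH : ‖H (S.G y)‖ ≤ c) :
    |∑ i, (⟪H (S.G y) (S.T y (S.v y i)), S.T y (S.v y i)⟫ +
      ⟪N (S.G y), S.T1 y (S.v y i) (S.v y i)⟫) +
      ((innerSL ℝ (N (S.G y))).comp (S.T y)) (S.fx y)| ≤ 4 * Λ ^ 4 * c := by
  have hc : 0 ≤ c := (norm_nonneg _).trans hN
  have hΛ := S.one_le
  have hΛ0 : 0 ≤ Λ := by linarith
  set x := S.G y
  have e1 : ∑ i, (⟪H x (S.T y (S.v y i)), S.T y (S.v y i)⟫ +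
      ⟪N x, S.T1 y (S.v y i) (S.v y i)⟫) +
      ((innerSL ℝ (N x)).comp (S.T y)) (S.fx y) =
      ∑ i, ⟪H x (S.r i y), S.r i y⟫ + 2 * ∑ i, ⟪S.v y i, S.r1 i y (N x)⟫ - S.fp y (N x) := by
    have h1 := S.sum_T1_inner hy (N x)
    rw [inner_sum] at h1
    rw [Finset.sum_add_distrib, h1, ContinuousLinearMap.comp_apply, innerSL_apply_apply,
      ← S.T_symm y (subset_closure hy), real_inner_comm (N x)]
    simp only [S.v_spec y hy]
    ring
  have b1 : |∑ i, ⟪H x (S.r i y), S.r i y⟫| ≤ Λ * (c * Λ * Λ) := by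
    refine (Finset.abs_sum_le_sum_abs _ _).trans
      ((Finset.sum_le_card_nsmul _ _ (c * Λ * Λ) fun i _ => ?_).trans ?_)
    · refine (abs_real_inner_le_norm _ _).trans ?_
      gcongr
      · exact ((H x).le_opNorm _).trans (by gcongr; exact S.r_le i y hy)
      · exact S.r_le i y hy
    · rw [nsmul_eq_mul, Finset.card_univ]
      exact mul_le_mul_of_nonneg_right S.card_le (by positivity)
  have b2 : |∑ i, ⟪S.v y i, S.r1 i y (N x)⟫| ≤ Λ * (Λ ^ 2 * (Λ * c)) := by
    refine (Finset.abs_sum_le_sum_abs _ _).trans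
      ((Finset.sum_le_card_nsmul _ _ (Λ ^ 2 * (Λ * c)) fun i _ => ?_).trans ?_)
    · refine (abs_real_inner_le_norm _ _).trans ?_
      gcongr
      · exact S.norm_v_le hy i
      · exact ((S.r1 i y).le_opNorm _).trans (by gcongr; exact S.r1_le i y hy)
    · rw [nsmul_eq_mul, Finset.card_univ]
      exact mul_le_mul_of_nonneg_right S.card_le (by positivity)
  have b3 : |S.fp y (N x)| ≤ Λ * c :=
    ((S.fp y).le_opNorm _).trans (by gcongr; exact S.fp_le y hy)
  rw [e1]
  have p1 : Λ ^ 3 * c ≤ Λ ^ 4 * c :=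
    mul_le_mul_of_nonneg_right (pow_le_pow_right₀ hΛ (by norm_num)) hc
  have p2 : Λ * c ≤ Λ ^ 4 * c :=
    mul_le_mul_of_nonneg_right (by simpa using pow_le_pow_right₀ hΛ (show 1 ≤ 4 by norm_num)) hc
  rw [abs_le] at *
  constructor <;> nlinarith

/-- The linearised operator applied to a pure second derivative is bounded from below. -/
theorem operator_T_ge {y ξ : E} (hy : y ∈ S.D) (hξ : ‖ξ‖ = 1) :
    -(3 * Λ ^ 4) - 2 * ε * ‖S.T y ξ‖ ≤
      ∑ i, ⟪S.T2 y (S.v y i) (S.v y i) ξ, ξ⟫ +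
        ((innerSL ℝ ξ).comp ((S.T1 y).flip ξ)) (S.fx y) := by
  have hΛ := S.one_le
  have hΛ0 : 0 ≤ Λ := by linarith
  have h1 := (S.touching_jet hy).nonneg_of_isLocalMin (S.touching_isLocalMin hy) ξ
  have h2 := S.qF_le y hy ξ hξ
  have b2 : |∑ i, ⟪S.r2 i y ξ ξ, S.v y i⟫| ≤ Λ * (Λ * Λ ^ 2) := by
    refine (Finset.abs_sum_le_sum_abs _ _).trans
      ((Finset.sum_le_card_nsmul _ _ (Λ * Λ ^ 2) fun i _ => ?_).trans ?_)
    · refine (abs_real_inner_le_norm _ _).trans ?_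
      gcongr
      · refine ((S.r2 i y).le_opNorm₂ ξ ξ).trans ?_
        rw [hξ, mul_one, mul_one]
        exact S.r2_le i y hy
      · exact S.norm_v_le hy i
    · rw [nsmul_eq_mul, Finset.card_univ]
      exact mul_le_mul_of_nonneg_right S.card_le (by positivity)
  have e1 : ((innerSL ℝ ξ).comp ((S.T1 y).flip ξ)) (S.fx y) = ⟪S.fx y, S.T1 y ξ ξ⟫ := by
    rw [ContinuousLinearMap.comp_apply, ContinuousLinearMap.flip_apply, innerSL_apply_apply,
      S.T1_swap y (subset_closure hy), real_inner_comm, S.T1_symm y (subset_closure hy),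
      real_inner_comm]
  have e2 : ∑ i, ⟪S.T2 y (S.v y i) (S.v y i) ξ, ξ⟫ = ∑ i, ⟪S.T2 y ξ ξ (S.v y i), S.v y i⟫ :=
    Finset.sum_congr rfl fun i _ => S.T2_swap y hy _ _
  rw [e1, e2]
  have p2 : Λ ≤ Λ ^ 4 := by simpa using pow_le_pow_right₀ hΛ (show 1 ≤ 4 by norm_num)
  rw [abs_le] at b2
  nlinarith

end DualSystem

/-! ### The dual problem: boundary estimates -/

namespace DualSystem

variable {E : Type*} [NormedAddCommGroup E] [InnerProductSpace ℝ E]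
  {ι : Type*} [Fintype ι] {Λ κ θt ε : ℝ} (S : DualSystem E ι Λ κ θt ε)

theorem h_continuous : Continuous S.h :=
  continuous_iff_continuousAt.2 fun y => (S.h_deriv y).continuousAt

theorem h_frontier {y : E} (hy : y ∈ frontier S.D) : S.h y = 0 := by
  refine le_antisymm ?_ ?_
  · have : y ∉ S.D := by
      have := hy.2
      rwa [S.D_open.interior_eq] at this
    rw [S.D_eq] at this
    simpa using this
  · have hsub : closure S.D ⊆ {y | 0 ≤ S.h y} := by
      refine closure_minimal ?_ (isClosed_le continuous_const S.h_continuous)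
      rw [S.D_eq]
      intro z hz
      simp only [mem_ofPred_eq] at hz ⊢
      exact hz.le
    exact hsub hy.1

theorem ht_comp_hasFDerivWithinAt {y : E} (hy : y ∈ closure S.D) :
    HasFDerivWithinAt (fun z => S.ht (S.G z)) ((innerSL ℝ (S.bt (S.G y))).comp (S.T y))
      (closure S.D) y :=
  (S.ht_deriv (S.G y)).comp_hasFDerivWithinAt y (S.G_deriv y hy)

theorem mul_ht_le_h {a : ℝ} (ha : 0 < a) (haκ : 4 * Λ ^ 5 * a < κ) :
    ∀ y ∈ closure S.D, a * S.ht (S.G y) + -1 * S.h y ≤ 0 := by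
  refine le_of_jet_pos S.D_open S.D_compact S.v S.fx ?_ ?_ ?_
  · refine ContinuousOn.add (continuousOn_const.mul fun y hy => ?_)
      (continuousOn_const.mul S.h_continuous.continuousOn)
    exact (S.ht_comp_hasFDerivWithinAt hy).continuousWithinAt
  · intro y hy
    simp [S.ht_frontier y hy, S.h_frontier hy]
  · intro y hy
    refine ⟨_, _, ((S.jet_comp S.ht_deriv S.bt_deriv hy).const_mul a).add
      ((S.jet_h y).const_mul (-1)), ?_⟩
    have h1 := S.operator_comp_le (N := S.bt) (H := S.Bt) hy (S.bt_le y (subset_closure hy))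
      (S.Bt_le y (subset_closure hy))
    have h2 := S.barrier y hy
    rw [Finset.sum_add_distrib, ← Finset.mul_sum, ← Finset.mul_sum]
    simp only [_root_.add_apply, _root_.smul_apply, innerSL_apply_apply, smul_eq_mul] at h1 ⊢
    have h3 := mul_le_mul_of_nonneg_left (abs_le.1 h1).1 ha.le
    nlinarith

/-- At the boundary `T` maps the normal of the target to a multiple of the normal of the domain. -/
theorem conormal {y : E} (hy : y ∈ frontier S.D) :
    S.T y (S.bt (S.G y)) = ⟪S.T y (S.bt (S.G y)), S.b y⟫ • S.b y := by
  have hyc := frontier_subset_closure hy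
  set w := S.T y (S.bt (S.G y)) with hw
  set e := w - ⟪w, S.b y⟫ • S.b y with he
  have hb := S.b_norm y hy
  have h1 : ⟪S.b y, e⟫ = 0 := by
    rw [he, inner_sub_right, inner_smul_right, real_inner_self_eq_norm_sq, hb,
      real_inner_comm]
    ring
  have h2 : ⟪S.bt (S.G y), S.T y e⟫ = 0 := by
    simpa using deriv_tangential_eq_zero S.D_open S.D_eq (S.h_deriv y) hy (S.h_frontier hy) hb
      (S.h_super y) h1 (S.ht_comp_hasFDerivWithinAt hyc) S.ht_frontier
  rw [← S.T_symm y hyc, ← hw] at h2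
  have h3 : ⟪e, e⟫ = 0 := by
    nth_rewrite 1 [he]
    rw [inner_sub_left, inner_smul_left, h1, h2]
    simp
  exact sub_eq_zero.1 (inner_self_eq_zero.1 h3)

/-- Strict obliqueness. -/
theorem obliqueness {a : ℝ} (ha : 0 < a) (haκ : 4 * Λ ^ 5 * a < κ) {y : E}
    (hy : y ∈ frontier S.D) :
    ∃ μ : ℝ, S.T y (S.bt (S.G y)) = μ • S.b y ∧ 0 < μ ∧ a * μ ≤ 1 ∧
      0 < ⟪S.b y, S.bt (S.G y)⟫ ∧ a ≤ Λ * ⟪S.b y, S.bt (S.G y)⟫ := by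
  have hyc := frontier_subset_closure hy
  have hb := S.b_norm y hy
  have hcon := S.conormal hy
  set μ := ⟪S.T y (S.bt (S.G y)), S.b y⟫ with hμ
  have hbb : (0 : ℝ) < ⟪S.b y, S.b y⟫ := by
    rw [real_inner_self_eq_norm_sq, hb]; norm_num
  have hΛ : 0 < Λ := by linarith [S.one_le]
  have hmain : a * μ ≤ 1 := by
    have h1 := deriv_nonpos_of_isMaxOn (w := S.b y) S.D_eq (S.h_deriv y) (S.h_frontier hy) hbb
      (((S.ht_comp_hasFDerivWithinAt hyc).const_mul a).add
        ((S.h_deriv y).hasFDerivWithinAt.const_mul (-1)))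
      (fun z hz => by
        have := S.mul_ht_le_h ha haκ z hz
        simpa [S.ht_frontier y hy, S.h_frontier hy] using this)
    simp only [_root_.add_apply, _root_.smul_apply, ContinuousLinearMap.comp_apply,
      innerSL_apply_apply, smul_eq_mul, real_inner_self_eq_norm_sq, hb] at h1
    rw [← S.T_symm y hyc, ← hμ] at h1
    linarith
  have hnn : 0 ≤ μ := by
    have h1 := deriv_nonpos_of_isMaxOn (w := S.b y) S.D_eq (S.h_deriv y) (S.h_frontier hy) hbb
      ((S.ht_comp_hasFDerivWithinAt hyc).const_mul (-1))
      (fun z hz => by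
        have := S.ht_nonneg z hz
        simpa [S.ht_frontier y hy] using this)
    simp only [_root_.smul_apply, ContinuousLinearMap.comp_apply,
      innerSL_apply_apply, smul_eq_mul] at h1
    rw [← S.T_symm y hyc, ← hμ] at h1
    linarith
  have hpos : 1 ≤ Λ * (μ * ⟪S.b y, S.bt (S.G y)⟫) := by
    have := S.norm_sq_le hyc (S.bt (S.G y))
    rw [hcon, inner_smul_left, S.bt_norm y hy] at this
    simpa using this
  set χ := ⟪S.b y, S.bt (S.G y)⟫
  have hμχ : 0 < μ * χ := by
    by_contra! hle
    nlinarith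
  have hμpos : 0 < μ := lt_of_le_of_ne hnn (by rintro h0; rw [← h0] at hμχ; simp at hμχ)
  have hχ : 0 < χ := (mul_pos_iff_of_pos_left hμpos).1 hμχ
  refine ⟨μ, hcon, hμpos, hmain, hχ, ?_⟩
  have h1 : a * 1 ≤ a * (Λ * (μ * χ)) := mul_le_mul_of_nonneg_left hpos ha.le
  have h2 : (a * μ) * (Λ * χ) ≤ 1 * (Λ * χ) := mul_le_mul_of_nonneg_right hmain (by positivity)
  linarith

/-- Decomposition of the second derivatives at the boundary into tangential and oblique parts. -/
theorem inner_T_le_of_frontier {y : E} (hy : y ∈ frontier S.D) {μ M : ℝ}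
    (hμ : S.T y (S.bt (S.G y)) = μ • S.b y) (hχ : 0 < ⟪S.b y, S.bt (S.G y)⟫)
    (hM : ∀ τ : E, ⟪τ, S.b y⟫ = 0 → ⟪S.T y τ, τ⟫ ≤ M * ‖τ‖ ^ 2) {ξ : E} (hξ : ‖ξ‖ = 1) :
    ⟪S.T y ξ, ξ⟫ ≤ M * (1 - 2 * ⟪ξ, S.b y⟫ * (⟪ξ, S.bt (S.G y)⟫ / ⟪S.b y, S.bt (S.G y)⟫) +
      ⟪ξ, S.b y⟫ ^ 2 / ⟪S.b y, S.bt (S.G y)⟫ ^ 2) +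
      ⟪ξ, S.b y⟫ ^ 2 * (μ / ⟪S.b y, S.bt (S.G y)⟫) := by
  have hyc := frontier_subset_closure hy
  have hnu := S.bt_norm y hy
  set ν := S.bt (S.G y)
  set χ := ⟪S.b y, ν⟫ with hχdef
  set p := ⟪ξ, S.b y⟫ with hp
  set τ := ξ - (p / χ) • ν with hτ
  have hτb : ⟪τ, S.b y⟫ = 0 := by
    rw [hτ, inner_sub_left, inner_smul_left, real_inner_comm (S.b y) ν, ← hχdef, ← hp]
    simp only [conj_trivial]
    field_simp
    ring
  have hnorm : ‖τ‖ ^ 2 = 1 - 2 * p * (⟪ξ, ν⟫ / χ) + p ^ 2 / χ ^ 2 := by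
    rw [hτ, norm_sub_sq_real, hξ, inner_smul_right, norm_smul, hnu, Real.norm_eq_abs, mul_one,
      sq_abs]
    ring
  have hξτ : ξ = τ + (p / χ) • ν := by rw [hτ]; abel
  have hexp : ⟪S.T y ξ, ξ⟫ = ⟪S.T y τ, τ⟫ + p ^ 2 * (μ / χ) := by
    have h1 : ⟪S.T y τ, ν⟫ = 0 := by
      rw [S.T_symm y hyc, hμ, inner_smul_right, hτb, mul_zero]
    have h2 : ⟪S.T y ν, τ⟫ = 0 := by
      rw [S.T_symm y hyc, real_inner_comm, h1]
    have h3 : ⟪S.T y ν, ν⟫ = μ * χ := by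
      rw [hμ, inner_smul_left]
      rfl
    rw [hξτ, map_add, map_smul, inner_add_left, inner_add_right, inner_add_right, inner_smul_left,
      inner_smul_left, inner_smul_right, inner_smul_right, h1, h2, h3]
    simp only [conj_trivial]
    field_simp
    ring
  rw [hexp, ← hnorm]
  linarith [hM τ hτb]

theorem norm_T_le {y : E} (hy : y ∈ closure S.D) {M : ℝ}
    (hM : ∀ η : E, ‖η‖ = 1 → ⟪S.T y η, η⟫ ≤ M) {ξ : E} (hξ : ‖ξ‖ = 1) : ‖S.T y ξ‖ ≤ M := by
  rcases eq_or_ne (S.T y ξ) 0 with h0 | h0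
  · rw [h0, norm_zero]
    exact (S.T_nonneg hy ξ).trans (hM ξ hξ)
  set η := ‖S.T y ξ‖⁻¹ • S.T y ξ with hη
  have hη1 : ‖η‖ = 1 := norm_smul_inv_norm (𝕜 := ℝ) h0
  have h1 := S.T_nonneg hy (ξ - η)
  rw [map_sub, inner_sub_left, inner_sub_right, inner_sub_right, S.T_symm y hy η ξ,
    real_inner_comm (S.T y ξ) η] at h1
  have h2 : ⟪S.T y ξ, η⟫ = ‖S.T y ξ‖ := by
    rw [hη, inner_smul_right, real_inner_self_eq_norm_sq]
    have := norm_ne_zero_iff.2 h0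
    field_simp
  linarith [hM ξ hξ, hM η hη1]

theorem inner_T_continuousOn (t : Set E) :
    ContinuousOn (fun p : E × E => ⟪S.T p.1 p.2, p.2⟫) (closure S.D ×ˢ t) := by
  have h1 : ContinuousOn (fun p : E × E => S.T p.1) (closure S.D ×ˢ t) :=
    S.T_continuousOn.comp continuousOn_fst fun p hp => hp.1
  exact (h1.clm_apply continuousOn_snd).inner continuousOn_snd

variable [FiniteDimensional ℝ E]

/-- Second derivatives are controlled by their boundary values. -/
theorem inner_T_le_of_frontier_bound {M : ℝ}
    (hM : ∀ y ∈ frontier S.D, ∀ ξ : E, ‖ξ‖ = 1 → ⟪S.T y ξ, ξ⟫ ≤ M) :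
    ∀ y ∈ closure S.D, ∀ ξ : E, ‖ξ‖ = 1 →
      ⟪S.T y ξ, ξ⟫ ≤ 2 * M + 2 * (Λ * (3 * Λ ^ 4 + 1) / κ) := by
  intro y hy ξ hξ
  have hκ := S.κ_pos
  obtain ⟨⟨y₁, ξ₁⟩, ⟨hy₁, hξ₁⟩, hmax⟩ := (S.D_compact.prod (isCompact_sphere (0 : E) 1)).exists_isMaxOn
    ⟨(y, ξ), hy, by simpa using hξ⟩ (S.inner_T_continuousOn _)
  have hξ₁' : ‖ξ₁‖ = 1 := by simpa using hξ₁
  set m := ⟪S.T y₁ ξ₁, ξ₁⟫ with hm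
  have hle : ∀ z ∈ closure S.D, ∀ η : E, ‖η‖ = 1 → ⟪S.T z η, η⟫ ≤ m := fun z hz η hη =>
    hmax (show (z, η) ∈ closure S.D ×ˢ Metric.sphere (0 : E) 1 from ⟨hz, by simpa using hη⟩)
  refine (hle y hy ξ hξ).trans ?_
  have hm0 : 0 ≤ m := S.T_nonneg hy₁ ξ₁
  set A := (3 * Λ ^ 4 + 1 + 2 * ε * m) / κ with hA
  have hAκ : A * κ = 3 * Λ ^ 4 + 1 + 2 * ε * m := by rw [hA]; field_simp
  have hΛ := S.one_le
  have hε := S.ε_nonneg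
  have hA0 : 0 ≤ A := by rw [hA]; positivity
  have hmp := le_of_jet_pos S.D_open S.D_compact S.v S.fx
    (g := fun z => ⟪S.T z ξ₁, ξ₁⟫ + -A * S.h z) (c := M) ?_ ?_ ?_ y₁ hy₁
  · have h1 : m ≤ M + A * Λ := by
      have := mul_le_mul_of_nonneg_left (S.h_le y₁ hy₁) hA0
      linarith
    have h2 : A * Λ = Λ * (3 * Λ ^ 4 + 1) / κ + 2 * ε * Λ / κ * m := by
      rw [hA]; field_simp
    have h3 : 2 * ε * Λ / κ ≤ 1 / 2 := by
      rw [div_le_iff₀ hκ]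
      linarith [S.ε_small]
    nlinarith
  · exact ((S.T_continuousOn.clm_apply continuousOn_const).inner continuousOn_const).add
      (continuousOn_const.mul S.h_continuous.continuousOn)
  · intro z hz
    simpa [S.h_frontier hz] using hM z hz ξ₁ hξ₁'
  · intro z hz
    refine ⟨_, _, (S.jet_T ξ₁ hz).add ((S.jet_h z).const_mul (-A)), ?_⟩
    have h1 := S.operator_T_ge hz hξ₁'
    have h2 := mul_le_mul_of_nonneg_left (S.barrier z hz) hA0
    have h3 : 2 * ε * ‖S.T z ξ₁‖ ≤ 2 * ε * m := mul_le_mul_of_nonneg_left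
      (S.norm_T_le (subset_closure hz) (hle z (subset_closure hz)) hξ₁') (by linarith)
    rw [Finset.sum_add_distrib, ← Finset.mul_sum]
    simp only [_root_.add_apply, _root_.smul_apply, innerSL_apply_apply, smul_eq_mul] at h1 ⊢
    linarith

end DualSystem

namespace DualSystem

variable {E : Type*} [NormedAddCommGroup E] [InnerProductSpace ℝ E]
  {ι : Type*} [Fintype ι] {Λ κ θt ε : ℝ} (S : DualSystem E ι Λ κ θt ε)

/-- The gradient map is expanding. -/
theorem norm_sub_le_mul_norm_G_sub {y z : E} (hy : y ∈ closure S.D) (hz : z ∈ closure S.D) :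
    ‖y - z‖ ≤ Λ * ‖S.G y - S.G z‖ := by
  set e := y - z with he
  have hΛ := S.one_le
  have hmem : ∀ t ∈ Icc (0 : ℝ) 1, z + t • e ∈ closure S.D := fun t ht =>
    S.D_convex.closure.add_smul_sub_mem hz hy ht
  have hd : ∀ t ∈ Icc (0 : ℝ) 1, HasDerivWithinAt (fun t : ℝ => ⟪e, S.G (z + t • e)⟫)
      ⟪e, S.T (z + t • e) e⟫ (Icc 0 1) t := by
    intro t ht
    have h1 : HasDerivWithinAt (fun t : ℝ => z + t • e) e (Icc 0 1) t := by
      simpa using (((hasDerivAt_id t).smul_const e).const_add z).hasDerivWithinAt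
    have h2 := (S.G_deriv _ (hmem t ht)).comp_hasDerivWithinAt t h1 hmem
    exact ((innerSL ℝ e).hasFDerivAt).comp_hasDerivWithinAt t h2
  obtain ⟨t, ht, hslope⟩ := exists_hasDerivAt_eq_slope (fun t : ℝ => ⟪e, S.G (z + t • e)⟫)
    (fun t => ⟪e, S.T (z + t • e) e⟫) zero_lt_one (fun t ht => (hd t ht).continuousWithinAt)
    (fun t ht => (hd t (Ioo_subset_Icc_self ht)).hasDerivAt (Icc_mem_nhds ht.1 ht.2))
  have h1 := S.norm_sq_le (hmem t (Ioo_subset_Icc_self ht)) e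
  have h2 : z + e = y := by rw [he]; abel
  simp only [one_smul, zero_smul, add_zero, h2, sub_zero, div_one, ← inner_sub_right] at hslope
  rw [real_inner_comm, hslope] at h1
  have h3 := real_inner_le_norm e (S.G y - S.G z)
  rcases (norm_nonneg e).eq_or_lt with h0 | h0
  · rw [← h0]; positivity
  · have h4 : ‖e‖ * ‖e‖ ≤ ‖e‖ * (Λ * ‖S.G y - S.G z‖) := by nlinarith
    exact le_of_mul_le_mul_left h4 h0

theorem norm_b_sub_le {y z : E} (hy : y ∈ closure S.D) (hz : z ∈ closure S.D) :
    ‖S.b y - S.b z‖ ≤ Λ ^ 2 * ‖S.G y - S.G z‖ := by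
  have h1 := S.D_convex.closure.norm_image_sub_le_of_norm_hasFDerivWithin_le
    (fun x _ => (S.b_deriv x).hasFDerivWithinAt) (fun x hx => S.B_le x hx) hz hy
  have h2 := mul_le_mul_of_nonneg_left (S.norm_sub_le_mul_norm_G_sub hy hz)
    (zero_le_one.trans S.one_le)
  linarith

theorem abs_inner_b_le {y y₀ ξ : E} (hy : y ∈ closure S.D) (hy₀ : y₀ ∈ closure S.D)
    (hξ : ‖ξ‖ = 1) (hξb : ⟪ξ, S.b y₀⟫ = 0) : |⟪ξ, S.b y⟫| ≤ Λ ^ 2 * ‖S.G y - S.G y₀‖ := by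
  have h1 : ⟪ξ, S.b y⟫ = ⟪ξ, S.b y - S.b y₀⟫ := by rw [inner_sub_right, hξb, sub_zero]
  rw [h1]
  refine (abs_real_inner_le_norm _ _).trans ?_
  rw [hξ, one_mul]
  exact S.norm_b_sub_le hy hy₀

theorem abs_inner_b_bt_sub_le {y y₀ : E} (hy : y ∈ frontier S.D) (hy₀ : y₀ ∈ frontier S.D) :
    |⟪S.b y, S.bt (S.G y)⟫ - ⟪S.b y₀, S.bt (S.G y₀)⟫| ≤ 2 * Λ ^ 2 * ‖S.G y - S.G y₀‖ := by
  have hyc := frontier_subset_closure hy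
  have hyc₀ := frontier_subset_closure hy₀
  have h1 : ⟪S.b y, S.bt (S.G y)⟫ - ⟪S.b y₀, S.bt (S.G y₀)⟫ =
      ⟪S.b y - S.b y₀, S.bt (S.G y)⟫ + ⟪S.b y₀, S.bt (S.G y) - S.bt (S.G y₀)⟫ := by
    rw [inner_sub_left, inner_sub_right]; ring
  have h2 := abs_real_inner_le_norm (S.b y - S.b y₀) (S.bt (S.G y))
  have h3 := abs_real_inner_le_norm (S.b y₀) (S.bt (S.G y) - S.bt (S.G y₀))
  rw [S.bt_norm y hy, mul_one] at h2
  rw [S.b_norm y₀ hy₀, one_mul] at h3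
  have h4 := S.norm_b_sub_le hyc hyc₀
  have h5 := S.bt_lip y hyc y₀ hyc₀
  have hΛ := S.one_le
  have h6 : Λ * ‖S.G y - S.G y₀‖ ≤ Λ ^ 2 * ‖S.G y - S.G y₀‖ :=
    mul_le_mul_of_nonneg_right (by nlinarith) (norm_nonneg _)
  rw [h1]
  refine (abs_add_le _ _).trans ?_
  linarith

/-- Comparison of second derivatives in a fixed direction along the boundary. -/
theorem inner_T_le_comparison {a : ℝ} (ha : 0 < a) (haκ : 4 * Λ ^ 5 * a < κ) {M : ℝ}
    (hM1 : 1 ≤ M) {y y₀ ξ : E} (hy : y ∈ frontier S.D) (hy₀ : y₀ ∈ frontier S.D)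
    (hM : ∀ τ : E, ⟪τ, S.b y⟫ = 0 → ⟪S.T y τ, τ⟫ ≤ M * ‖τ‖ ^ 2)
    (hξ : ‖ξ‖ = 1) (hξb : ⟪ξ, S.b y₀⟫ = 0) :
    ⟪S.T y ξ, ξ⟫ ≤ M * (1 - 2 * (⟪ξ, S.bt (S.G y₀)⟫ / ⟪S.b y₀, S.bt (S.G y₀)⟫) * ⟪ξ, S.b y⟫ +
      (7 * Λ ^ 4 * (Λ / a) ^ 2 + Λ ^ 4 * (Λ / a / a)) * ‖S.G y - S.G y₀‖ ^ 2) := by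
  have hyc := frontier_subset_closure hy
  have hyc₀ := frontier_subset_closure hy₀
  have hΛ := S.one_le
  obtain ⟨μ, hμ, hμ0, haμ, hχ, hΛχ⟩ := S.obliqueness ha haκ hy
  obtain ⟨-, -, -, -, hχ₀, hΛχ₀⟩ := S.obliqueness ha haκ hy₀
  have h1 := S.inner_T_le_of_frontier hy hμ hχ hM hξ
  have hp := S.abs_inner_b_le hyc hyc₀ hξ hξb
  have hχχ := S.abs_inner_b_bt_sub_le hy hy₀
  have hχ₀1 : ⟪S.b y₀, S.bt (S.G y₀)⟫ ≤ 1 := by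
    have := real_inner_le_norm (S.b y₀) (S.bt (S.G y₀))
    rwa [S.b_norm y₀ hy₀, S.bt_norm y₀ hy₀, mul_one] at this
  have hn₀ : |⟪ξ, S.bt (S.G y₀)⟫| ≤ 1 := by
    have := abs_real_inner_le_norm ξ (S.bt (S.G y₀))
    rwa [hξ, S.bt_norm y₀ hy₀, mul_one] at this
  have hnn : |⟪ξ, S.bt (S.G y₀)⟫ - ⟪ξ, S.bt (S.G y)⟫| ≤ Λ ^ 2 * ‖S.G y - S.G y₀‖ := by
    rw [← inner_sub_right]
    refine (abs_real_inner_le_norm _ _).trans ?_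
    rw [hξ, one_mul, norm_sub_rev]
    refine (S.bt_lip y hyc y₀ hyc₀).trans ?_
    exact mul_le_mul_of_nonneg_right (by nlinarith) (norm_nonneg _)
  set d := ‖S.G y - S.G y₀‖ with hd
  have hd0 : 0 ≤ d := norm_nonneg _
  set χ := ⟪S.b y, S.bt (S.G y)⟫
  set χ₀ := ⟪S.b y₀, S.bt (S.G y₀)⟫
  set p := ⟪ξ, S.b y⟫
  set q := ⟪ξ, S.bt (S.G y)⟫
  set q₀ := ⟪ξ, S.bt (S.G y₀)⟫
  set m := Λ / a with hm
  have hm0 : 0 < m := by positivity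
  have hmχ : 1 / χ ≤ m := by rw [hm, div_le_div_iff₀ hχ ha]; linarith
  have hmχ₀ : 1 / χ₀ ≤ m := by rw [hm, div_le_div_iff₀ hχ₀ ha]; linarith
  have hμa : μ ≤ 1 / a := by rw [le_div_iff₀ ha]; linarith
  have hquot : |q₀ / χ₀ - q / χ| ≤ 3 * Λ ^ 2 * d * m ^ 2 := by
    have e1 : q₀ / χ₀ - q / χ = (q₀ * (χ - χ₀) + (q₀ - q) * χ₀) * ((1 / χ) * (1 / χ₀)) := by
      field_simp; ring
    have e2 : |q₀ * (χ - χ₀) + (q₀ - q) * χ₀| ≤ 3 * Λ ^ 2 * d := by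
      refine (abs_add_le _ _).trans ?_
      rw [abs_mul, abs_mul, abs_of_pos hχ₀]
      have i1 : |q₀| * |χ - χ₀| ≤ 1 * (2 * Λ ^ 2 * d) := by gcongr
      have i2 : |q₀ - q| * χ₀ ≤ Λ ^ 2 * d * 1 := by gcongr
      linarith
    have e3 : (1 / χ) * (1 / χ₀) ≤ m ^ 2 := by
      rw [sq]; gcongr
    rw [e1, abs_mul, abs_of_pos (show 0 < (1 / χ) * (1 / χ₀) by positivity)]
    gcongr
  have hp2 : p ^ 2 ≤ Λ ^ 4 * d ^ 2 := by
    rw [← sq_abs]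
    calc |p| ^ 2 ≤ (Λ ^ 2 * d) ^ 2 := by gcongr
      _ = _ := by ring
  have t1 : 2 * p * (q₀ / χ₀ - q / χ) ≤ 6 * Λ ^ 4 * m ^ 2 * d ^ 2 := by
    have i1 : |p| * |q₀ / χ₀ - q / χ| ≤ (Λ ^ 2 * d) * (3 * Λ ^ 2 * d * m ^ 2) := by gcongr
    have i2 := le_abs_self (p * (q₀ / χ₀ - q / χ))
    rw [abs_mul] at i2
    nlinarith
  have t2 : p ^ 2 / χ ^ 2 ≤ Λ ^ 4 * d ^ 2 * m ^ 2 := by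
    have : p ^ 2 / χ ^ 2 = p ^ 2 * (1 / χ) ^ 2 := by field_simp
    rw [this]; gcongr
  have t3 : p ^ 2 * (μ / χ) ≤ M * (Λ ^ 4 * d ^ 2 * (m / a)) := by
    have i1 : μ / χ ≤ m / a := by
      have : μ / χ = (1 / χ) * μ := by field_simp
      rw [this, div_eq_mul_one_div m a]
      gcongr
    have i2 : p ^ 2 * (μ / χ) ≤ Λ ^ 4 * d ^ 2 * (m / a) := by gcongr
    have i3 : 0 ≤ Λ ^ 4 * d ^ 2 * (m / a) := by positivity
    nlinarith
  have hMpos : 0 ≤ M := by linarith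
  calc ⟪S.T y ξ, ξ⟫ ≤ _ := h1
    _ ≤ M * (1 - 2 * p * (q / χ) + p ^ 2 / χ ^ 2) + M * (Λ ^ 4 * d ^ 2 * (m / a)) := by gcongr
    _ = M * (1 - 2 * (q₀ / χ₀) * p + (2 * p * (q₀ / χ₀ - q / χ) + p ^ 2 / χ ^ 2 +
          Λ ^ 4 * d ^ 2 * (m / a))) := by ring
    _ ≤ M * (1 - 2 * (q₀ / χ₀) * p + (6 * Λ ^ 4 * m ^ 2 * d ^ 2 + Λ ^ 4 * d ^ 2 * m ^ 2 +
          Λ ^ 4 * d ^ 2 * (m / a))) := by gcongr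
    _ = _ := by ring

/-- Second derivatives at the boundary in arbitrary directions are controlled by tangential
ones. -/
theorem inner_T_le_of_tangential {a : ℝ} (ha : 0 < a) (haκ : 4 * Λ ^ 5 * a < κ) {M : ℝ}
    (hM1 : 1 ≤ M) {y ξ : E} (hy : y ∈ frontier S.D)
    (hM : ∀ τ : E, ⟪τ, S.b y⟫ = 0 → ⟪S.T y τ, τ⟫ ≤ M * ‖τ‖ ^ 2) (hξ : ‖ξ‖ = 1) :
    ⟪S.T y ξ, ξ⟫ ≤ M * ((1 + Λ / a) ^ 2 + Λ / a / a) := by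
  have hΛ := S.one_le
  obtain ⟨μ, hμ, hμ0, haμ, hχ, hΛχ⟩ := S.obliqueness ha haκ hy
  have h1 := S.inner_T_le_of_frontier hy hμ hχ hM hξ
  have hq : |⟪ξ, S.bt (S.G y)⟫| ≤ 1 := by
    have := abs_real_inner_le_norm ξ (S.bt (S.G y))
    rwa [hξ, S.bt_norm y hy, mul_one] at this
  have hp : |⟪ξ, S.b y⟫| ≤ 1 := by
    have := abs_real_inner_le_norm ξ (S.b y)
    rwa [hξ, S.b_norm y hy, mul_one] at this
  set χ := ⟪S.b y, S.bt (S.G y)⟫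
  set p := ⟪ξ, S.b y⟫
  set q := ⟪ξ, S.bt (S.G y)⟫
  set m := Λ / a with hm
  have hm0 : 0 < m := by positivity
  have hmχ : 1 / χ ≤ m := by rw [hm, div_le_div_iff₀ hχ ha]; linarith
  have hμa : μ ≤ 1 / a := by rw [le_div_iff₀ ha]; linarith
  have hp2 : p ^ 2 ≤ 1 := by rw [← sq_abs]; nlinarith [abs_nonneg p]
  have t1 : -(2 * p * (q / χ)) ≤ 2 * m := by
    have e1 : 2 * p * (q / χ) = 2 * (p * (q * (1 / χ))) := by field_simp
    have i1 : |p| * (|q| * (1 / χ)) ≤ 1 * (1 * m) := by gcongr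
    have i2 := neg_abs_le (p * (q * (1 / χ)))
    rw [abs_mul, abs_mul, abs_of_pos (show 0 < 1 / χ by positivity)] at i2
    linarith
  have t2 : p ^ 2 / χ ^ 2 ≤ 1 * m ^ 2 := by
    have : p ^ 2 / χ ^ 2 = p ^ 2 * (1 / χ) ^ 2 := by field_simp
    rw [this]; gcongr
  have t3 : p ^ 2 * (μ / χ) ≤ M * (m / a) := by
    have i1 : μ / χ ≤ m / a := by
      have : μ / χ = (1 / χ) * μ := by field_simp
      rw [this, div_eq_mul_one_div m a]
      gcongr
    have i2 : p ^ 2 * (μ / χ) ≤ 1 * (m / a) := by gcongr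
    have i3 : 0 ≤ m / a := by positivity
    nlinarith
  have hMpos : 0 ≤ M := by linarith
  have h2 : M * (1 - 2 * p * (q / χ) + p ^ 2 / χ ^ 2) ≤ M * ((1 + m) ^ 2) :=
    mul_le_mul_of_nonneg_left (by nlinarith) hMpos
  linarith

/-- Lower bound for the normal derivative of a tangential second derivative, obtained by
differentiating the boundary condition twice. -/
theorem le_inner_T1_normal {a : ℝ} (ha : 0 < a) (haκ : 4 * Λ ^ 5 * a < κ) {y ξ : E}
    (hy : y ∈ frontier S.D) (hξ : ‖ξ‖ = 1) (hξb : ⟪ξ, S.b y⟫ = 0) :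
    θt * ⟪S.T y ξ, ξ⟫ ^ 2 - Λ / a ≤ ⟪S.T1 y (S.bt (S.G y)) ξ, ξ⟫ := by
  have hyc := frontier_subset_closure hy
  have hΛ := S.one_le
  obtain ⟨μ, hμ, hμ0, haμ, -, -⟩ := S.obliqueness ha haκ hy
  have hμb : ⟪S.T y (S.bt (S.G y)), S.b y⟫ = μ := by
    rw [hμ, inner_smul_left, real_inner_self_eq_norm_sq, S.b_norm y hy]; simp
  have hν : HasFDerivWithinAt (fun z => S.bt (S.G z)) ((S.Bt (S.G y)).comp (S.T y))
      (closure S.D) y := (S.bt_deriv (S.G y)).comp_hasFDerivWithinAt y (S.G_deriv y hyc)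
  have hw := (S.T_deriv y hyc).clm_apply hν
  have hg := (hw.inner ℝ (hasFDerivWithinAt_const ξ y (closure S.D))).sub
    ((hw.inner ℝ (S.b_deriv y).hasFDerivWithinAt).mul
      ((S.b_deriv y).hasFDerivWithinAt.inner ℝ (hasFDerivWithinAt_const ξ y (closure S.D))))
  have h0 := deriv_tangential_eq_zero S.D_open S.D_eq (S.h_deriv y) hy (S.h_frontier hy)
    (S.b_norm y hy) (S.h_super y) (e := ξ) (by rw [real_inner_comm, hξb]) hg (fun z hz => by
      have hc := S.conormal hz
      simp only [Pi.sub_apply, Pi.mul_apply]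
      nth_rewrite 1 [hc]
      rw [inner_smul_left]
      simp)
  have hξb' : ⟪S.b y, ξ⟫ = 0 := by rw [real_inner_comm, hξb]
  simp only [_root_.sub_apply, _root_.add_apply, _root_.smul_apply, smul_eq_mul,
    ContinuousLinearMap.comp_apply, ContinuousLinearMap.prod_apply, fderivInnerCLM_apply,
    ContinuousLinearMap.flip_apply, _root_.zero_apply, inner_zero_right, hξb', hμb, zero_mul,
    zero_add, add_zero, inner_add_left] at h0
  have h1 : ⟪S.T1 y ξ (S.bt (S.G y)), ξ⟫ = ⟪S.T1 y (S.bt (S.G y)) ξ, ξ⟫ := by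
    rw [S.T1_swap y hyc]
  have h2 : ⟪S.T y (S.Bt (S.G y) (S.T y ξ)), ξ⟫ ≤ -θt * ‖S.T y ξ‖ ^ 2 := by
    rw [S.T_symm y hyc]
    exact S.Bt_neg _ _
  have h3 : -(Λ / a) ≤ μ * ⟪S.B y ξ, ξ⟫ := by
    have i1 : |⟪S.B y ξ, ξ⟫| ≤ Λ := by
      refine (abs_real_inner_le_norm _ _).trans ?_
      rw [hξ, mul_one]
      simpa [hξ] using (S.B y).le_of_opNorm_le (S.B_le y hyc) ξ
    have i2 : μ ≤ 1 / a := by rw [le_div_iff₀ ha]; linarith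
    have i3 : μ * |⟪S.B y ξ, ξ⟫| ≤ 1 / a * Λ := by gcongr
    have i4 := neg_abs_le (μ * ⟪S.B y ξ, ξ⟫)
    rw [abs_mul, abs_of_pos hμ0] at i4
    have i5 : 1 / a * Λ = Λ / a := by field_simp
    linarith
  have h4 : ⟪S.T y ξ, ξ⟫ ^ 2 ≤ ‖S.T y ξ‖ ^ 2 := by
    have i1 := abs_real_inner_le_norm (S.T y ξ) ξ
    rw [hξ, mul_one] at i1
    rw [← sq_abs]
    gcongr
  have h5 := mul_le_mul_of_nonneg_left h4 S.θt_pos.le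
  linarith

/-- The operator applied to a component of the gradient of the defining function. -/
theorem abs_operator_inner_b_le {y ξ : E} (hy : y ∈ S.D) (hξ : ‖ξ‖ = 1) :
    |∑ i, ⟪ξ, S.B1 y (S.v y i) (S.v y i)⟫ + ((innerSL ℝ ξ).comp (S.B y)) (S.fx y)| ≤
      2 * Λ ^ 6 := by
  have hΛ := S.one_le
  have hΛ0 : 0 ≤ Λ := by linarith
  have hyc := subset_closure hy
  have h1 : |∑ i, ⟪ξ, S.B1 y (S.v y i) (S.v y i)⟫| ≤ Λ * (Λ * Λ ^ 2 * Λ ^ 2) := by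
    refine (Finset.abs_sum_le_sum_abs _ _).trans
      ((Finset.sum_le_card_nsmul _ _ (Λ * Λ ^ 2 * Λ ^ 2) fun i _ => ?_).trans ?_)
    · refine (abs_real_inner_le_norm _ _).trans ?_
      rw [hξ, one_mul]
      refine ((S.B1 y).le_opNorm₂ _ _).trans ?_
      have := S.norm_v_le hy i
      have := S.B1_le y hyc
      gcongr
    · rw [nsmul_eq_mul, Finset.card_univ]
      exact mul_le_mul_of_nonneg_right S.card_le (by positivity)
  have h2 : |((innerSL ℝ ξ).comp (S.B y)) (S.fx y)| ≤ Λ * 1 := by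
    rw [ContinuousLinearMap.comp_apply, innerSL_apply_apply]
    refine (abs_real_inner_le_norm _ _).trans ?_
    rw [hξ, one_mul]
    refine ((S.B y).le_opNorm _).trans ?_
    have := S.B_le y hyc
    have := (S.fx_le y hy).trans S.ε_le_one
    gcongr
  have h3 : Λ ≤ Λ ^ 6 := le_self_pow₀ hΛ (by norm_num)
  refine (abs_add_le _ _).trans ?_
  nlinarith

/-- Upper bound for the normal derivative of the maximal tangential second derivative, by a
barrier argument. -/
theorem inner_T1_normal_le {a : ℝ} (ha : 0 < a) (haκ : 4 * Λ ^ 5 * a < κ) {M Ce C₁ A : ℝ}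
    (hM1 : 1 ≤ M) {y₀ ξ : E} (hy₀ : y₀ ∈ frontier S.D)
    (hM : ∀ y ∈ frontier S.D, ∀ τ : E, ⟪τ, S.b y⟫ = 0 → ⟪S.T y τ, τ⟫ ≤ M * ‖τ‖ ^ 2)
    (hCe : ∀ y ∈ closure S.D, ∀ η : E, ‖η‖ = 1 → ⟪S.T y η, η⟫ ≤ Ce * M)
    (hξ : ‖ξ‖ = 1) (hξb : ⟪ξ, S.b y₀⟫ = 0) (hmax : ⟪S.T y₀ ξ, ξ⟫ = M)
    (hC₁ : C₁ = 7 * Λ ^ 4 * (Λ / a) ^ 2 + Λ ^ 4 * (Λ / a / a))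
    (hA : A = (3 * Λ ^ 4 + 2 * Ce + 4 * (Λ / a) * Λ ^ 6 + 8 * C₁ * Λ ^ 5 + 1) / κ) :
    ⟪S.T1 y₀ (S.bt (S.G y₀)) ξ, ξ⟫ ≤ M * (A + 2 * (Λ / a) * Λ) := by
  have hyc₀ := frontier_subset_closure hy₀
  have hΛ := S.one_le
  have hκ := S.κ_pos
  have hε := S.ε_nonneg
  have hε1 := S.ε_le_one
  have hMpos : 0 < M := by linarith
  obtain ⟨-, -, -, -, hχ₀, hΛχ₀⟩ := S.obliqueness ha haκ hy₀
  have hC₁0 : 0 ≤ C₁ := by rw [hC₁]; positivity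
  have hCe0 : 0 ≤ Ce := by
    have h1 := hCe y₀ hyc₀ ξ hξ
    rw [hmax] at h1
    by_contra! hlt
    nlinarith
  have hA0 : 0 ≤ A := by rw [hA]; positivity
  have hAκ : A * κ = 3 * Λ ^ 4 + 2 * Ce + 4 * (Λ / a) * Λ ^ 6 + 8 * C₁ * Λ ^ 5 + 1 := by
    rw [hA]; field_simp
  set k := ⟪ξ, S.bt (S.G y₀)⟫ / ⟪S.b y₀, S.bt (S.G y₀)⟫ with hk
  have hk_le : |k| ≤ Λ / a := by
    have hn₀ : |⟪ξ, S.bt (S.G y₀)⟫| ≤ 1 := by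
      have := abs_real_inner_le_norm ξ (S.bt (S.G y₀))
      rwa [hξ, S.bt_norm y₀ hy₀, mul_one] at this
    rw [hk, abs_div, abs_of_pos hχ₀, div_le_div_iff₀ hχ₀ ha]
    nlinarith
  have hχ₀1 : ⟪S.b y₀, S.bt (S.G y₀)⟫ ≤ 1 := by
    have := real_inner_le_norm (S.b y₀) (S.bt (S.G y₀))
    rwa [S.b_norm y₀ hy₀, S.bt_norm y₀ hy₀, mul_one] at this
  set ψ : E → ℝ := fun x => ‖x - S.G y₀‖ ^ 2 with hψ
  have hψd : ∀ x, HasFDerivAt ψ (innerSL ℝ ((2 : ℝ) • (x - S.G y₀))) x := by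
    intro x
    have := ((hasFDerivAt_id x).sub_const (S.G y₀)).norm_sq
    refine this.congr_fderiv ?_
    ext v
    simp
  have hNd : ∀ x, HasFDerivAt (fun x => (2 : ℝ) • (x - S.G y₀))
      ((2 : ℝ) • ContinuousLinearMap.id ℝ E) x := fun x =>
    ((hasFDerivAt_id x).sub_const (S.G y₀)).const_smul (2 : ℝ)
  have hjet : ∀ y ∈ S.D, HasJet (fun z => ⟪S.T z ξ, ξ⟫ + M * (2 * k * ⟪ξ, S.b z⟫ +
      (-C₁ * ψ (S.G z) + -A * S.h z))) y _ _ := fun y hy =>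
    (S.jet_T ξ hy).add ((((S.jet_inner_b ξ y).const_mul (2 * k)).add
      (((S.jet_comp hψd hNd hy).const_mul (-C₁)).add ((S.jet_h y).const_mul (-A)))).const_mul M)
  have hle : ∀ y ∈ closure S.D, ⟪S.T y ξ, ξ⟫ + M * (2 * k * ⟪ξ, S.b y⟫ +
      (-C₁ * ψ (S.G y) + -A * S.h y)) ≤ M := by
    refine le_of_jet_pos S.D_open S.D_compact S.v S.fx ?_ ?_ ?_
    · have c1 : ContinuousOn S.b (closure S.D) :=
        fun y _ => (S.b_deriv y).continuousAt.continuousWithinAt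
      have c2 := S.G_continuousOn
      have c3 := S.h_continuous
      have c4 : ContinuousOn (fun y => ⟪S.T y ξ, ξ⟫) (closure S.D) :=
        (S.T_continuousOn.clm_apply continuousOn_const).inner continuousOn_const
      have c5 : ContinuousOn (fun y => ⟪ξ, S.b y⟫) (closure S.D) := continuousOn_const.inner c1
      simp only [hψ]
      fun_prop
    · intro y hy
      have h1 := S.inner_T_le_comparison ha haκ hM1 hy hy₀ (hM y hy) hξ hξb
      rw [← hk, ← hC₁] at h1
      rw [S.h_frontier hy]
      simp only [hψ]
      linarith
    · intro y hy
      refine ⟨_, _, hjet y hy, ?_⟩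
      have h1 := S.operator_T_ge hy hξ
      have h2 := S.abs_operator_inner_b_le hy hξ
      have hyc := subset_closure hy
      have hd := S.G_diam y hyc y₀ hyc₀
      have h3 := S.operator_comp_le (N := fun x => (2 : ℝ) • (x - S.G y₀))
        (H := fun _ => (2 : ℝ) • ContinuousLinearMap.id ℝ E) (c := 2 * Λ) hy
        (by rw [norm_smul]; simpa using hd)
        (by
          refine (norm_smul_le (2 : ℝ) (ContinuousLinearMap.id ℝ E)).trans ?_
          have := ContinuousLinearMap.norm_id_le (𝕜 := ℝ) (E := E)
          simp only [Real.norm_ofNat]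
          linarith)
      have h4 := S.barrier y hy
      have h5 : 2 * ε * ‖S.T y ξ‖ ≤ 2 * Ce * M := by
        have i1 := S.norm_T_le hyc (hCe y hyc) hξ
        have i2 : ε * ‖S.T y ξ‖ ≤ 1 * (Ce * M) := by gcongr
        linarith
      rw [Finset.sum_add_distrib, ← Finset.mul_sum, Finset.sum_add_distrib, ← Finset.mul_sum,
        Finset.sum_add_distrib, ← Finset.mul_sum, ← Finset.mul_sum]
      simp only [_root_.add_apply, _root_.smul_apply, smul_eq_mul] at h1 h2 h3 ⊢
      generalize ((innerSL ℝ ξ).comp ((S.T1 y).flip ξ)) (S.fx y) = z1 at h1 ⊢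
      generalize ((innerSL ℝ ξ).comp (S.B y)) (S.fx y) = z2 at h2 ⊢
      generalize ((innerSL ℝ ((2 : ℝ) • (S.G y - S.G y₀))).comp (S.T y)) (S.fx y) = z3 at h3 ⊢
      rw [innerSL_apply_apply]
      have g1 : -(4 * (Λ / a) * Λ ^ 6) ≤
          2 * k * (∑ i, ⟪ξ, S.B1 y (S.v y i) (S.v y i)⟫ + z2) := by
        have i1 : |k| * |∑ i, ⟪ξ, S.B1 y (S.v y i) (S.v y i)⟫ + z2| ≤ Λ / a * (2 * Λ ^ 6) := by
          gcongr
        rw [← abs_mul] at i1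
        linarith [neg_abs_le (k * (∑ i, ⟪ξ, S.B1 y (S.v y i) (S.v y i)⟫ + z2))]
      have g2 := mul_le_mul_of_nonneg_left (abs_le.1 h3).2 hC₁0
      have g3 := mul_le_mul_of_nonneg_left h4 hA0
      have g4 : 3 * Λ ^ 4 ≤ 3 * Λ ^ 4 * M := by
        have : 0 ≤ 3 * Λ ^ 4 := by positivity
        nlinarith
      have g5 := mul_le_mul_of_nonneg_left (add_le_add g1 (add_le_add (neg_le_neg g2)
        (neg_le_neg g3))) hMpos.le
      have g6 : A * -κ = -(A * κ) := by ring
      rw [g6, hAκ] at g5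
      nlinarith
  have hTd : HasFDerivWithinAt (fun z => ⟪S.T z ξ, ξ⟫) ((innerSL ℝ ξ).comp ((S.T1 y₀).flip ξ))
      (closure S.D) y₀ := by
    have h1 : HasFDerivWithinAt (fun z => S.T z ξ) ((S.T1 y₀).flip ξ) (closure S.D) y₀ := by
      simpa using (S.T_deriv y₀ hyc₀).clm_apply (hasFDerivWithinAt_const ξ y₀ _)
    exact HasFDerivWithinAt.congr (((innerSL ℝ ξ).hasFDerivAt).comp_hasFDerivWithinAt y₀ h1)
      (fun z _ => by simp [real_inner_comm]) (by simp [real_inner_comm])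
  have hbd : HasFDerivWithinAt (fun z => ⟪ξ, S.b z⟫) ((innerSL ℝ ξ).comp (S.B y₀))
      (closure S.D) y₀ := (S.jet_inner_b ξ y₀).hasFDerivAt.hasFDerivWithinAt
  have hψG : HasFDerivWithinAt (fun z => ψ (S.G z))
      ((innerSL ℝ ((2 : ℝ) • (S.G y₀ - S.G y₀))).comp (S.T y₀)) (closure S.D) y₀ :=
    (hψd (S.G y₀)).comp_hasFDerivWithinAt y₀ (S.G_deriv y₀ hyc₀)
  have hfin := deriv_nonpos_of_isMaxOn (w := S.bt (S.G y₀)) S.D_eq (S.h_deriv y₀)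
    (S.h_frontier hy₀) hχ₀
    (hTd.add (((hbd.const_mul (2 * k)).add
      ((hψG.const_mul (-C₁)).add ((S.h_deriv y₀).hasFDerivWithinAt.const_mul (-A)))).const_mul M))
    (fun z hz => by
      have := hle z hz
      simpa [hψ, hξb, hmax, S.h_frontier hy₀] using this)
  simp only [_root_.add_apply, _root_.smul_apply, smul_eq_mul, ContinuousLinearMap.comp_apply,
    ContinuousLinearMap.flip_apply, innerSL_apply_apply, sub_self, smul_zero, inner_zero_left,
    mul_zero, zero_add] at hfin
  rw [real_inner_comm] at hfin
  have hBν : |⟪ξ, S.B y₀ (S.bt (S.G y₀))⟫| ≤ Λ := by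
    refine (abs_real_inner_le_norm _ _).trans ?_
    rw [hξ, one_mul]
    simpa [S.bt_norm y₀ hy₀] using (S.B y₀).le_of_opNorm_le (S.B_le y₀ hyc₀) (S.bt (S.G y₀))
  have g1 : -(2 * (Λ / a) * Λ) ≤ 2 * k * ⟪ξ, S.B y₀ (S.bt (S.G y₀))⟫ := by
    have i1 : |k| * |⟪ξ, S.B y₀ (S.bt (S.G y₀))⟫| ≤ Λ / a * Λ := by gcongr
    rw [← abs_mul] at i1
    linarith [neg_abs_le (k * ⟪ξ, S.B y₀ (S.bt (S.G y₀))⟫)]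
  have g2 := mul_le_mul_of_nonneg_left hχ₀1 hA0
  have g3 := mul_le_mul_of_nonneg_left (add_le_add g1 (neg_le_neg g2)) hMpos.le
  linarith

variable [FiniteDimensional ℝ E]

/-- The tangential second derivatives are bounded at the boundary. -/
theorem tangential_le {a Cb Ce C₁ A : ℝ} (ha : 0 < a) (haκ : 4 * Λ ^ 5 * a < κ)
    (hCb : Cb = (1 + Λ / a) ^ 2 + Λ / a / a)
    (hCe : Ce = 2 * Cb + 2 * (Λ * (3 * Λ ^ 4 + 1) / κ))
    (hC₁ : C₁ = 7 * Λ ^ 4 * (Λ / a) ^ 2 + Λ ^ 4 * (Λ / a / a))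
    (hA : A = (3 * Λ ^ 4 + 2 * Ce + 4 * (Λ / a) * Λ ^ 6 + 8 * C₁ * Λ ^ 5 + 1) / κ)
    {y ξ : E} (hy : y ∈ frontier S.D) (hξ : ‖ξ‖ = 1) (hξb : ⟪ξ, S.b y⟫ = 0) :
    ⟪S.T y ξ, ξ⟫ ≤ max 1 ((A + 2 * (Λ / a) * Λ + Λ / a) / θt) := by
  have hΛ := S.one_le
  have hκ := S.κ_pos
  have hθ := S.θt_pos
  have hfc : IsClosed (frontier S.D) := isClosed_frontier
  set Z : Set (E × E) := (frontier S.D ×ˢ Metric.sphere (0 : E) 1) ∩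
    {p | ⟪p.2, S.b p.1⟫ = 0} with hZ
  have hbc : Continuous S.b := continuous_iff_continuousAt.2 fun y => (S.b_deriv y).continuousAt
  have hZc : IsCompact Z := by
    refine ((S.D_compact.of_isClosed_subset hfc frontier_subset_closure).prod
      (isCompact_sphere (0 : E) 1)).inter_right ?_
    exact isClosed_eq (by fun_prop) continuous_const
  obtain ⟨⟨y₀, ξ₀⟩, ⟨⟨hy₀, hξ₀⟩, hξb₀⟩, hmax⟩ := hZc.exists_isMaxOn
    ⟨(y, ξ), ⟨hy, by simpa using hξ⟩, hξb⟩
    ((S.inner_T_continuousOn univ).mono fun p hp =>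
      ⟨frontier_subset_closure hp.1.1, mem_univ _⟩)
  have hξ₀' : ‖ξ₀‖ = 1 := by simpa using hξ₀
  simp only [mem_ofPred_eq] at hξb₀ hy₀
  set M := ⟪S.T y₀ ξ₀, ξ₀⟫ with hMdef
  have hle : ∀ z ∈ frontier S.D, ∀ η : E, ‖η‖ = 1 → ⟪η, S.b z⟫ = 0 → ⟪S.T z η, η⟫ ≤ M :=
    fun z hz η hη hηb => hmax (show (z, η) ∈ Z from ⟨⟨hz, by simpa using hη⟩, hηb⟩)
  refine (hle y hy ξ hξ hξb).trans ?_
  rcases le_total M 1 with hM1 | hM1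
  · exact hM1.trans (le_max_left _ _)
  refine le_trans ?_ (le_max_right _ _)
  have hM : ∀ z ∈ frontier S.D, ∀ τ : E, ⟪τ, S.b z⟫ = 0 → ⟪S.T z τ, τ⟫ ≤ M * ‖τ‖ ^ 2 := by
    intro z hz τ hτ
    rcases eq_or_ne τ 0 with rfl | h0
    · simp
    have h0' := norm_ne_zero_iff.2 h0
    have h1 := hle z hz (‖τ‖⁻¹ • τ) (norm_smul_inv_norm (𝕜 := ℝ) h0)
      (by rw [inner_smul_left, hτ, mul_zero])
    rw [map_smul, inner_smul_left, inner_smul_right] at h1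
    simp only [conj_trivial] at h1
    have h2 := mul_le_mul_of_nonneg_right h1 (sq_nonneg ‖τ‖)
    refine le_trans (le_of_eq ?_) h2
    field_simp
  have hall : ∀ z ∈ frontier S.D, ∀ η : E, ‖η‖ = 1 → ⟪S.T z η, η⟫ ≤ M * Cb := by
    intro z hz η hη
    rw [hCb]
    exact S.inner_T_le_of_tangential ha haκ hM1 hz (hM z hz) hη
  have hint : ∀ z ∈ closure S.D, ∀ η : E, ‖η‖ = 1 → ⟪S.T z η, η⟫ ≤ Ce * M := by
    intro z hz η hη
    refine (S.inner_T_le_of_frontier_bound hall z hz η hη).trans ?_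
    have : 0 ≤ Λ * (3 * Λ ^ 4 + 1) / κ := by positivity
    rw [hCe]
    nlinarith
  have hup := S.inner_T1_normal_le ha haκ hM1 hy₀ hM hint hξ₀' hξb₀ hMdef.symm hC₁ hA
  have hlo := S.le_inner_T1_normal ha haκ hy₀ hξ₀' hξb₀
  rw [← hMdef] at hlo
  rw [le_div_iff₀ hθ]
  have h1 : θt * M ^ 2 ≤ M * (A + 2 * (Λ / a) * Λ + Λ / a) := by
    have : 0 ≤ Λ / a := by positivity
    nlinarith
  have h2 : M * (M * θt) ≤ M * (A + 2 * (Λ / a) * Λ + Λ / a) := by linarith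
  exact le_of_mul_le_mul_left h2 (by linarith)

/-- The boundary estimate for the second derivatives, with a constant depending only on the
structure constants. -/
theorem exists_boundary_bound (E : Type*) [NormedAddCommGroup E] [InnerProductSpace ℝ E]
    [FiniteDimensional ℝ E] (ι : Type*) [Fintype ι] {Λ κ : ℝ} (θt : ℝ) (hΛ : 1 ≤ Λ) (hκ : 0 < κ) :
    ∃ C : ℝ, 0 < C ∧ ∀ (ε : ℝ) (S : DualSystem E ι Λ κ θt ε), ∀ y ∈ frontier S.D, ∀ ξ : E,
      ‖ξ‖ = 1 → ⟪S.T y ξ, ξ⟫ ≤ C := by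
  set a := κ / (8 * Λ ^ 5) with ha_def
  have ha : 0 < a := by positivity
  have haκ : 4 * Λ ^ 5 * a < κ := by
    have : 4 * Λ ^ 5 * a = κ / 2 := by rw [ha_def]; field_simp; norm_num
    linarith
  set Cb := (1 + Λ / a) ^ 2 + Λ / a / a with hCb
  set Ce := 2 * Cb + 2 * (Λ * (3 * Λ ^ 4 + 1) / κ) with hCe
  set C₁ := 7 * Λ ^ 4 * (Λ / a) ^ 2 + Λ ^ 4 * (Λ / a / a) with hC₁
  set A := (3 * Λ ^ 4 + 2 * Ce + 4 * (Λ / a) * Λ ^ 6 + 8 * C₁ * Λ ^ 5 + 1) / κ with hA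
  set M := max 1 ((A + 2 * (Λ / a) * Λ + Λ / a) / θt)
  have hM1 : 1 ≤ M := le_max_left _ _
  refine ⟨M * Cb, by positivity, fun ε S y hy ξ hξ => ?_⟩
  refine S.inner_T_le_of_tangential ha haκ hM1 hy (fun τ hτ => ?_) hξ
  rcases eq_or_ne τ 0 with rfl | h0
  · simp
  have h0' := norm_ne_zero_iff.2 h0
  have h1 := S.tangential_le ha haκ hCb hCe hC₁ hA hy (ξ := ‖τ‖⁻¹ • τ)
    (norm_smul_inv_norm (𝕜 := ℝ) h0) (by rw [inner_smul_left, hτ, mul_zero])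
  rw [map_smul, inner_smul_left, inner_smul_right] at h1
  simp only [conj_trivial] at h1
  have h2 := mul_le_mul_of_nonneg_right h1 (sq_nonneg ‖τ‖)
  refine le_trans (le_of_eq ?_) h2
  field_simp

end DualSystem

/-! ### Gradients and their derivatives -/

theorem two_le_smooth : (2 : WithTop ℕ∞) ≤ (⊤ : ℕ∞) :=
  WithTop.coe_le_coe.2 (le_top : (2 : ℕ∞) ≤ ⊤)

section Gradient

variable {E : Type*} [NormedAddCommGroup E] [InnerProductSpace ℝ E] [CompleteSpace E]

/-- The Riesz isomorphism from the dual space. -/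
def rieszL (E : Type*) [NormedAddCommGroup E] [InnerProductSpace ℝ E] [CompleteSpace E] :
    (E →L[ℝ] ℝ) →L[ℝ] E where
  toFun l := (InnerProductSpace.toDual ℝ E).symm l
  map_add' := map_add _
  map_smul' c l := by simp
  cont := (InnerProductSpace.toDual ℝ E).symm.continuous

theorem rieszL_inner (l : E →L[ℝ] ℝ) (v : E) : ⟪rieszL E l, v⟫ = l v :=
  InnerProductSpace.toDual_symm_apply

theorem norm_rieszL (l : E →L[ℝ] ℝ) : ‖rieszL E l‖ = ‖l‖ :=
  (InnerProductSpace.toDual ℝ E).symm.norm_map l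

theorem gradient_eq_rieszL (u : E → ℝ) : gradient u = fun x => rieszL E (fderiv ℝ u x) := rfl

theorem innerSL_rieszL (l : E →L[ℝ] ℝ) : innerSL ℝ (rieszL E l) = l := by
  ext v
  rw [innerSL_apply_apply, rieszL_inner]

theorem hasFDerivAt_innerSL_gradient {u : E → ℝ} {x : E} (hu : DifferentiableAt ℝ u x) :
    HasFDerivAt u (innerSL ℝ (gradient u x)) x := by
  rw [gradient_eq_rieszL, innerSL_rieszL]
  exact hu.hasFDerivAt

theorem hasFDerivAt_gradient {u : E → ℝ} {x : E} (hu : DifferentiableAt ℝ (fderiv ℝ u) x) :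
    HasFDerivAt (gradient u) ((rieszL E).comp (fderiv ℝ (fderiv ℝ u) x)) x :=
  ((rieszL E).hasFDerivAt).comp x hu.hasFDerivAt

theorem inner_fderiv_gradient {u : E → ℝ} {x : E} (hu : DifferentiableAt ℝ (fderiv ℝ u) x)
    (a c : E) : ⟪fderiv ℝ (gradient u) x a, c⟫ = fderiv ℝ (fderiv ℝ u) x a c := by
  rw [(hasFDerivAt_gradient hu).fderiv, ContinuousLinearMap.comp_apply, rieszL_inner]

theorem contDiff_gradient {h : E → ℝ} (hh : ContDiff ℝ (⊤ : ℕ∞) h) :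
    ContDiff ℝ (⊤ : ℕ∞) (gradient h) :=
  (rieszL E).contDiff.comp (hh.fderiv_right (m := (⊤ : ℕ∞)) (by norm_cast))

/-- A function with nonpositive Hessian lies below its tangent planes. -/
theorem le_add_inner_gradient {h : E → ℝ} (hh : ContDiff ℝ (⊤ : ℕ∞) h)
    (hneg : ∀ x a, fderiv ℝ (fderiv ℝ h) x a a ≤ 0) (y z : E) :
    h z ≤ h y + ⟪gradient h y, z - y⟫ := by
  set e := z - y with he
  have hd1 : Differentiable ℝ h := hh.differentiable (by simp)
  have hd2 : Differentiable ℝ (fderiv ℝ h) :=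
    (hh.fderiv_right (m := (⊤ : ℕ∞)) (by norm_cast)).differentiable (by simp)
  have hline : ∀ t : ℝ, HasDerivAt (fun t : ℝ => y + t • e) e t := fun t => by
    simpa using ((hasDerivAt_id t).smul_const e).const_add y
  have h1 : ∀ t : ℝ, HasDerivAt (fun t : ℝ => h (y + t • e)) (fderiv ℝ h (y + t • e) e) t :=
    fun t => (hd1 _).hasFDerivAt.comp_hasDerivAt t (hline t)
  have h2 : ∀ t : ℝ, HasDerivAt (fun t : ℝ => fderiv ℝ h (y + t • e) e)
      (fderiv ℝ (fderiv ℝ h) (y + t • e) e e) t := fun t => by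
    have := ((hd2 _).hasFDerivAt.comp_hasDerivAt t (hline t)).clm_apply (hasDerivAt_const t e)
    simpa using this
  obtain ⟨t, ht, hs⟩ := exists_hasDerivAt_eq_slope _ _ (zero_lt_one (α := ℝ))
    (fun t _ => (h1 t).continuousAt.continuousWithinAt) (fun t _ => h1 t)
  obtain ⟨t', -, hs'⟩ := exists_hasDerivAt_eq_slope _ _ ht.1
    (fun t _ => (h2 t).continuousAt.continuousWithinAt) (fun t _ => h2 t)
  have h3 := hneg (y + t' • e) e
  rw [hs', sub_zero, div_le_iff₀ ht.1, zero_mul, hs] at h3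
  have h4 : y + e = z := by rw [he]; abel
  simp only [one_smul, zero_smul, add_zero, h4, sub_zero, div_one] at h3
  rw [gradient_eq_rieszL, rieszL_inner]
  linarith

end Gradient

section Convexity

variable {E : Type*} [NormedAddCommGroup E] [InnerProductSpace ℝ E]

theorem convex_setOf_pos {h : E → ℝ} {b : E → E}
    (hsup : ∀ y z, h z ≤ h y + ⟪b y, z - y⟫) : Convex ℝ {y | 0 < h y} := by
  intro y₁ hy₁ y₂ hy₂ s t hs ht hst
  simp only [mem_ofPred_eq] at *
  set z := s • y₁ + t • y₂ with hz
  have h1 := mul_le_mul_of_nonneg_left (hsup z y₁) hs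
  have h2 := mul_le_mul_of_nonneg_left (hsup z y₂) ht
  have h3 : s * ⟪b z, y₁ - z⟫ + t * ⟪b z, y₂ - z⟫ = 0 := by
    rw [← inner_smul_right, ← inner_smul_right, ← inner_add_right]
    have : s • (y₁ - z) + t • (y₂ - z) = 0 := by
      rw [smul_sub, smul_sub, sub_add_sub_comm, ← hz, ← add_smul, hst, one_smul, sub_self]
    rw [this, inner_zero_right]
  have h4 : h z = (s + t) * h z := by rw [hst, one_mul]
  rcases hs.eq_or_lt with h0 | h0
  · have : t = 1 := by linarith
    subst h0; subst this
    linarith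
  · nlinarith [mul_pos h0 hy₁, mul_nonneg ht hy₂.le]

end Convexity

section ClosureSmooth

variable {E F : Type*} [NormedAddCommGroup E] [NormedSpace ℝ E] [NormedAddCommGroup F]
  [NormedSpace ℝ F]

/-- If the second derivative exists (in the sense of not vanishing) up to the boundary, then the
full first derivative of a function smooth on the closure of a domain is smooth there. -/
theorem contDiffOn_fderiv_closure {D : Set E} (hD : IsOpen D) (huniq : UniqueDiffOn ℝ (closure D))
    {u : E → F} (hu : ContDiffOn ℝ (⊤ : ℕ∞) u (closure D))
    (hne : ∀ y ∈ closure D, fderiv ℝ (fderiv ℝ u) y ≠ 0) :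
    ContDiffOn ℝ (⊤ : ℕ∞) (fderiv ℝ u) (closure D) ∧
      ∀ y ∈ closure D, DifferentiableAt ℝ (fderiv ℝ u) y := by
  have hdiff : ∀ y ∈ closure D, DifferentiableAt ℝ (fderiv ℝ u) y := fun y hy => by
    by_contra hcon
    exact hne y hy (fderiv_zero_of_not_differentiableAt hcon)
  have hw : ContDiffOn ℝ (⊤ : ℕ∞) (fderivWithin ℝ u (closure D)) (closure D) :=
    hu.fderivWithin huniq (by norm_cast)
  refine ⟨hw.congr fun y hy => ?_, hdiff⟩
  have heq : EqOn (fderiv ℝ u) (fderivWithin ℝ u (closure D)) D := fun z hz =>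
    (fderivWithin_of_mem_nhds (Filter.mem_of_superset (hD.mem_nhds hz) subset_closure)).symm
  have hmem : (𝓝[D] y).NeBot := mem_closure_iff_nhdsWithin_neBot.1 hy
  have t1 : Filter.Tendsto (fderiv ℝ u) (𝓝[D] y) (𝓝 (fderiv ℝ u y)) :=
    (hdiff y hy).continuousAt.continuousWithinAt
  have t2 : Filter.Tendsto (fderivWithin ℝ u (closure D)) (𝓝[D] y)
      (𝓝 (fderivWithin ℝ u (closure D) y)) :=
    (hw.continuousOn y hy).mono subset_closure
  exact tendsto_nhds_unique (t1.congr' (Filter.eventually_of_mem self_mem_nhdsWithin heq)) t2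

/-- Symmetry of second derivatives up to the boundary. -/
theorem fderivWithin_fderivWithin_swap {D : Set E} (hD : IsOpen D)
    (huniq : UniqueDiffOn ℝ (closure D)) {g : E → F}
    (hg : ContDiffOn ℝ (⊤ : ℕ∞) g (closure D)) {y : E} (hy : y ∈ closure D) (a c : E) :
    fderivWithin ℝ (fderivWithin ℝ g (closure D)) (closure D) y a c =
      fderivWithin ℝ (fderivWithin ℝ g (closure D)) (closure D) y c a := by
  set s := closure D
  have hs : s ⊆ closure (interior s) :=
    closure_mono (interior_maximal subset_closure hD)
  have := (hg.of_le (m := (⊤ : ℕ∞)) le_rfl y hy).isSymmSndFDerivWithinAt (n := (⊤ : ℕ∞))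
    (by rw [minSmoothness_of_isRCLikeNormedField]; exact two_le_smooth) huniq (hs hy) hy
  exact this a c

end ClosureSmooth

section Symmetries

variable {E : Type*} [NormedAddCommGroup E] [InnerProductSpace ℝ E]

theorem inner_fderivWithin_symm {s : Set E} (huniq : UniqueDiffOn ℝ s) {T : E → E →L[ℝ] E}
    (hT : DifferentiableOn ℝ T s) (hsymm : ∀ y ∈ s, ∀ a c, ⟪T y a, c⟫ = ⟪T y c, a⟫)
    {y : E} (hy : y ∈ s) (e a c : E) :
    ⟪fderivWithin ℝ T s y e a, c⟫ = ⟪fderivWithin ℝ T s y e c, a⟫ := by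
  have key : ∀ a c : E, HasFDerivWithinAt (fun z => ⟪c, T z a⟫)
      ((innerSL ℝ c).comp ((fderivWithin ℝ T s y).flip a)) s y := by
    intro a c
    have h1 : HasFDerivWithinAt (fun z => T z a) ((fderivWithin ℝ T s y).flip a) s y := by
      simpa using (hT y hy).hasFDerivWithinAt.clm_apply (hasFDerivWithinAt_const a y _)
    exact ((innerSL ℝ c).hasFDerivAt).comp_hasFDerivWithinAt y h1
  have hsymm' : ∀ z ∈ s, ⟪c, T z a⟫ = ⟪a, T z c⟫ := fun z hz => by
    rw [real_inner_comm, hsymm z hz, real_inner_comm]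
  have h2 := HasFDerivWithinAt.congr (key c a) hsymm' (hsymm' y hy)
  have h3 := (huniq y hy).eq (key a c) h2
  have h4 := congrArg (fun l : E →L[ℝ] ℝ => l e) h3
  simpa [real_inner_comm] using h4

/-- The fourth order tensor of derivatives is totally symmetric. -/
theorem inner_third_fderivWithin_swap {D : Set E} (hD : IsOpen D)
    (huniq : UniqueDiffOn ℝ (closure D)) {G : E → E} {T : E → E →L[ℝ] E}
    {T1 : E → E →L[ℝ] E →L[ℝ] E} {T2 : E → E →L[ℝ] E →L[ℝ] E →L[ℝ] E}
    (hG : ContDiffOn ℝ (⊤ : ℕ∞) G (closure D))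
    (hT : T = fderivWithin ℝ G (closure D)) (hT1 : T1 = fderivWithin ℝ T (closure D))
    (hT2 : T2 = fderivWithin ℝ T1 (closure D))
    (hsymm : ∀ y ∈ closure D, ∀ a c, ⟪T y a, c⟫ = ⟪T y c, a⟫)
    {y : E} (hy : y ∈ closure D) (a c : E) :
    ⟪T2 y a a c, c⟫ = ⟪T2 y c c a, a⟫ := by
  have hTs : ContDiffOn ℝ (⊤ : ℕ∞) T (closure D) := by
    rw [hT]; exact hG.fderivWithin huniq (by norm_cast)
  have hT1s : ContDiffOn ℝ (⊤ : ℕ∞) T1 (closure D) := by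
    rw [hT1]; exact hTs.fderivWithin huniq (by norm_cast)
  have hd : ∀ e a : E, HasFDerivWithinAt (fun z => T1 z e a) (((T2 y).flip e).flip a)
      (closure D) y := by
    intro e a
    have h0 : HasFDerivWithinAt T1 (T2 y) (closure D) y := by
      rw [hT2]
      exact (hT1s.differentiableOn (by simp) y hy).hasFDerivWithinAt
    have h1 : HasFDerivWithinAt (fun z => T1 z e) ((T2 y).flip e) (closure D) y := by
      simpa using h0.clm_apply (hasFDerivWithinAt_const e y _)
    simpa using h1.clm_apply (hasFDerivWithinAt_const a y _)
  have s1 : ∀ e a c : E, T2 y e a c = T2 y a e c := by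
    intro e a c
    rw [hT2, hT1, fderivWithin_fderivWithin_swap hD huniq hTs hy]
  have s2 : ∀ e a c : E, T2 y e a c = T2 y e c a := by
    intro e a c
    have h2 := HasFDerivWithinAt.congr (hd c a) (f₁ := fun z => T1 z a c)
      (fun z hz => by
        rw [hT1, hT, fderivWithin_fderivWithin_swap hD huniq hG hz])
      (by rw [hT1, hT, fderivWithin_fderivWithin_swap hD huniq hG hy])
    simpa using congrArg (fun l : E →L[ℝ] E => l e) ((huniq y hy).eq (hd a c) h2)
  have s3 : ∀ e a c d : E, ⟪T2 y e a c, d⟫ = ⟪T2 y e a d, c⟫ := by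
    intro e a c d
    have k1 : HasFDerivWithinAt (fun z => ⟪d, T1 z a c⟫)
      ((innerSL ℝ d).comp (((T2 y).flip a).flip c)) (closure D) y :=
      ((innerSL ℝ d).hasFDerivAt).comp_hasFDerivWithinAt y (hd a c)
    have k2 : HasFDerivWithinAt (fun z => ⟪c, T1 z a d⟫)
      ((innerSL ℝ c).comp (((T2 y).flip a).flip d)) (closure D) y :=
      ((innerSL ℝ c).hasFDerivAt).comp_hasFDerivWithinAt y (hd a d)
    have hT1symm : ∀ z ∈ closure D, ⟪d, T1 z a c⟫ = ⟪c, T1 z a d⟫ := fun z hz => by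
      rw [real_inner_comm, hT1,
        inner_fderivWithin_symm huniq (hTs.differentiableOn (by simp)) hsymm hz, real_inner_comm]
    have h2 := HasFDerivWithinAt.congr k2 hT1symm (hT1symm y hy)
    have h4 := congrArg (fun l : E →L[ℝ] ℝ => l e) ((huniq y hy).eq k1 h2)
    simpa [real_inner_comm] using h4
  rw [s2, s1, s3, s2]

end Symmetries

/-! ### The right-hand side along the graph of the gradient map -/

section RightHandSide

theorem fderiv_fderiv_nonpos_of_midpoint {V : Type*} [NormedAddCommGroup V] [NormedSpace ℝ V]
    {f : V → ℝ} {w e : V} (hf : ContDiffAt ℝ 2 f w)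
    (hmid : ∀ᶠ t in 𝓝 (0 : ℝ), f (w + t • e) + f (w + t • -e) ≤ 2 * f w) :
    fderiv ℝ (fderiv ℝ f) w e e ≤ 0 := by
  have hd : ∀ᶠ z in 𝓝 w, DifferentiableAt ℝ f z :=
    (hf.eventually (by simp)).mono fun z hz => hz.differentiableAt (by simp)
  have hd2 : DifferentiableAt ℝ (fderiv ℝ f) w :=
    (hf.fderiv_right (m := 1) (by norm_num)).differentiableAt (by simp)
  have hjet : ∀ e : V, HasJet (fun t : ℝ => f (w + t • e)) 0
      (((fderiv ℝ f w).comp (ContinuousLinearMap.toSpanSingleton ℝ e)))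
      (fun v => v * v * fderiv ℝ (fderiv ℝ f) w e e) := by
    intro e
    have hline : ∀ t : ℝ, HasFDerivAt (fun t : ℝ => w + t • e)
        (ContinuousLinearMap.toSpanSingleton ℝ e) t := fun t =>
      ((ContinuousLinearMap.toSpanSingleton ℝ e).hasFDerivAt).const_add w
    have hcont : Filter.Tendsto (fun t : ℝ => w + t • e) (𝓝 0) (𝓝 w) := by
      simpa using (hline 0).continuousAt.tendsto
    refine ⟨fun t => (fderiv ℝ f (w + t • e)).comp (ContinuousLinearMap.toSpanSingleton ℝ e),
      ?_, by simp, fun v => ?_⟩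
    · filter_upwards [hcont.eventually hd] with t ht
      exact ht.hasFDerivAt.comp t (hline t)
    · have h1 : HasFDerivAt (fderiv ℝ f) (fderiv ℝ (fderiv ℝ f) w) (w + (0 : ℝ) • e) := by
        simpa using hd2.hasFDerivAt
      have h2 : HasFDerivAt (fun t : ℝ => fderiv ℝ f (w + t • e) (v • e)) _ 0 :=
        (h1.comp (0 : ℝ) (hline 0)).clm_apply (hasFDerivAt_const (v • e) 0)
      have h3 := h2.hasLineDerivAt v
      simpa [mul_assoc] using h3
  have hmax : IsLocalMax (fun t : ℝ => f (w + t • e) + f (w + t • -e)) 0 := by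
    filter_upwards [hmid] with t ht
    simpa [two_mul] using ht
  have h1 := ((hjet e).add (hjet (-e))).nonpos_of_isLocalMax hmax 1
  simp only [map_neg, _root_.neg_apply, neg_neg, one_mul] at h1
  linarith

variable {E : Type*} [NormedAddCommGroup E] [InnerProductSpace ℝ E]

theorem fderiv_partial_fst {f : E × E → ℝ} {x p : E} (hf : DifferentiableAt ℝ f (x, p)) :
    fderiv ℝ (fun x' => f (x', p)) x = (fderiv ℝ f (x, p)).comp (ContinuousLinearMap.inl ℝ E E) :=
  (hf.hasFDerivAt.comp x (hasFDerivAt_prodMk_left x p)).fderiv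

theorem fderiv_partial_mixed {f : E × E → ℝ} {x p : E} (hf : ContDiffAt ℝ 2 f (x, p)) (a e : E) :
    fderiv ℝ (fun p' => fderiv ℝ (fun x' => f (x', p')) x) p a e =
      fderiv ℝ (fderiv ℝ f) (x, p) (0, a) (e, 0) := by
  have hd : ∀ᶠ z in 𝓝 (x, p), DifferentiableAt ℝ f z :=
    (hf.eventually (by simp)).mono fun z hz => hz.differentiableAt (by simp)
  have hd2 : DifferentiableAt ℝ (fderiv ℝ f) (x, p) :=
    (hf.fderiv_right (m := 1) (by norm_num)).differentiableAt (by simp)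
  have hc : Filter.Tendsto (fun p' : E => (x, p')) (𝓝 p) (𝓝 (x, p)) :=
    (Continuous.prodMk_right x).tendsto p
  have heq : (fun p' => fderiv ℝ (fun x' => f (x', p')) x) =ᶠ[𝓝 p]
      fun p' => (fderiv ℝ f (x, p')).comp (ContinuousLinearMap.inl ℝ E E) :=
    (hc.eventually hd).mono fun p' hp' => fderiv_partial_fst hp'
  have h1 : HasFDerivAt (fun p' => fderiv ℝ f (x, p'))
      ((fderiv ℝ (fderiv ℝ f) (x, p)).comp (ContinuousLinearMap.inr ℝ E E)) p := by
    have h0 : HasFDerivAt (fun p' : E => (x, p')) (ContinuousLinearMap.inr ℝ E E) p :=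
      hasFDerivAt_prodMk_right x p
    exact HasFDerivAt.comp (g := fderiv ℝ f) (f := fun p' : E => (x, p')) p hd2.hasFDerivAt h0
  have h2 := h1.clm_comp (hasFDerivAt_const (ContinuousLinearMap.inl ℝ E E) p)
  rw [heq.fderiv_eq, h2.fderiv]
  simp

theorem hasJet_comp_graph [CompleteSpace E] {f : E × E → ℝ} {D : Set E} (hD : IsOpen D)
    {G : E → E} {T : E → E →L[ℝ] E} {T1 : E → E →L[ℝ] E →L[ℝ] E}
    (hf : ∀ y ∈ D, ContDiffAt ℝ 2 f (G y, y))
    (hG : ∀ y ∈ D, HasFDerivAt G (T y) y) (hT : ∀ y ∈ D, HasFDerivAt T (T1 y) y) (c : ℝ)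
    {y : E} (hy : y ∈ D) :
    HasJet (fun z => f (G z, z) + c) y
      ((innerSL ℝ (rieszL E ((fderiv ℝ f (G y, y)).comp (ContinuousLinearMap.inl ℝ E E)))).comp
          (T y) + (fderiv ℝ f (G y, y)).comp (ContinuousLinearMap.inr ℝ E E))
      (fun a => fderiv ℝ (fderiv ℝ f) (G y, y) (T y a, a) (T y a, a) +
        ⟪rieszL E ((fderiv ℝ f (G y, y)).comp (ContinuousLinearMap.inl ℝ E E)), T1 y a a⟫) := by
  have hgraph : ∀ z ∈ D, HasFDerivAt (fun z => (G z, z))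
      ((T z).prod (ContinuousLinearMap.id ℝ E)) z := fun z hz =>
    (hG z hz).prodMk (hasFDerivAt_id z)
  refine ⟨fun z => (fderiv ℝ f (G z, z)).comp ((T z).prod (ContinuousLinearMap.id ℝ E)), ?_, ?_,
    fun a => ?_⟩
  · filter_upwards [hD.mem_nhds hy] with z hz
    exact (HasFDerivAt.comp (g := f) (f := fun z => (G z, z)) z
      ((hf z hz).differentiableAt (by simp)).hasFDerivAt (hgraph z hz)).add_const c
  · ext a
    simp only [ContinuousLinearMap.comp_apply, ContinuousLinearMap.prod_apply, _root_.add_apply,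
      innerSL_apply_apply, rieszL_inner, ContinuousLinearMap.inl_apply,
      ContinuousLinearMap.inr_apply, ContinuousLinearMap.id_apply]
    rw [← map_add]
    simp
  · have hd2 : DifferentiableAt ℝ (fderiv ℝ f) (G y, y) :=
      ((hf y hy).fderiv_right (m := 1) (by norm_num)).differentiableAt (by simp)
    have h1 : HasFDerivAt (fun z => fderiv ℝ f (G z, z)) _ y :=
      HasFDerivAt.comp (g := fderiv ℝ f) (f := fun z => (G z, z)) y hd2.hasFDerivAt (hgraph y hy)
    have h2 : HasFDerivAt (fun z => T z a) ((T1 y).flip a) y := by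
      simpa using (hT y hy).clm_apply (hasFDerivAt_const a y)
    have h3 := (h1.clm_apply (h2.prodMk (hasFDerivAt_const a y))).hasLineDerivAt a
    simpa [add_comm, rieszL_inner] using h3

/-- The bound on the second derivative of the right-hand side in terms of its mixed
derivatives. -/
theorem second_deriv_graph_le {f : E × E → ℝ} {Ω : Set E} (hΩ : IsOpen Ω)
    {x p : E} (hx : x ∈ Ω) (hf : ContDiffAt ℝ 2 f (x, p))
    (hconc : ConcaveOn ℝ (closure Ω) fun x' => f (x', p)) {K ε : ℝ}
    (hK : ‖iteratedFDeriv ℝ 2 f (x, p)‖ ≤ K)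
    (hε : ‖fderiv ℝ (fun p' => fderiv ℝ (fun x' => f (x', p')) x) p‖ ≤ ε)
    (e : E) {a : E} (ha : ‖a‖ = 1) :
    fderiv ℝ (fderiv ℝ f) (x, p) (e, a) (e, a) ≤ 2 * ε * ‖e‖ + K := by
  set Q := fderiv ℝ (fderiv ℝ f) (x, p) with hQ
  have hsplit : ((e, a) : E × E) = (e, 0) + (0, a) := by simp
  have hsymm : Q (e, 0) (0, a) = Q (0, a) (e, 0) :=
    (hf.isSymmSndFDerivAt (by rw [minSmoothness_of_isRCLikeNormedField])) _ _
  have h1 : Q (e, 0) (e, 0) ≤ 0 := by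
    refine fderiv_fderiv_nonpos_of_midpoint hf ?_
    have hmem : ∀ e : E, ∀ᶠ t in 𝓝 (0 : ℝ), x + t • e ∈ Ω := fun e => by
      have hc : Filter.Tendsto (fun t : ℝ => x + t • e) (𝓝 0) (𝓝 x) := by
        have : Continuous fun t : ℝ => x + t • e := by fun_prop
        simpa using this.tendsto 0
      exact hc.eventually (hΩ.mem_nhds hx)
    filter_upwards [hmem e, hmem (-e)] with t h1 h2
    have h3 := hconc.2 (subset_closure h1) (subset_closure h2)
      (by norm_num : (0 : ℝ) ≤ 1 / 2) (by norm_num : (0 : ℝ) ≤ 1 / 2) (by norm_num)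
    have h4 : (1 / 2 : ℝ) • (x + t • e) + (1 / 2 : ℝ) • (x + t • -e) = x := by
      module
    rw [h4] at h3
    simp only [smul_eq_mul] at h3
    simp only [Prod.smul_mk, smul_zero, Prod.mk_add_mk, add_zero, Prod.neg_mk, neg_zero]
    linarith
  have h2 : Q (0, a) (e, 0) ≤ ε * ‖e‖ := by
    rw [hQ, ← fderiv_partial_mixed hf]
    refine (le_abs_self _).trans ?_
    have := ContinuousLinearMap.le_opNorm₂
      (fderiv ℝ (fun p' => fderiv ℝ (fun x' => f (x', p')) x) p) a e
    rw [Real.norm_eq_abs, ha, mul_one] at this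
    exact this.trans (mul_le_mul_of_nonneg_right hε (norm_nonneg e))
  have h3 : Q (0, a) (0, a) ≤ K := by
    have := (iteratedFDeriv ℝ 2 f (x, p)).le_opNorm ![(0, a), (0, a)]
    rw [iteratedFDeriv_two_apply] at this
    simp only [Fin.prod_univ_two, Matrix.cons_val_zero, Matrix.cons_val_one, Prod.norm_mk,
      norm_zero, ha, Real.norm_eq_abs] at this
    norm_num at this
    exact (le_abs_self _).trans (this.trans hK)
  rw [hsplit]
  simp only [map_add, _root_.add_apply]
  linarith

end RightHandSide

/-! ### Hessian matrices and the Minkowski operator -/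

section Hessian

theorem sum_smul_single (a : Euc n) : ∑ i, a i • EuclideanSpace.single i (1 : ℝ) = a := by
  ext j
  simp [Finset.sum_apply, Pi.single_apply]

theorem dotProduct_hess_mulVec (u : Euc n → ℝ) (x a c : Euc n) :
    (fun i => a i) ⬝ᵥ (Hess u x).mulVec (fun i => c i) = fderiv ℝ (fderiv ℝ u) x a c := by
  have hH : ∀ i j, Hess u x i j = fderiv ℝ (fderiv ℝ u) x (EuclideanSpace.single i 1)
      (EuclideanSpace.single j 1) := fun i j => by
    simp [Hess, iteratedFDeriv_two_apply]
  conv_rhs => rw [← sum_smul_single a, ← sum_smul_single c]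
  simp only [map_sum, map_smul, _root_.sum_apply, _root_.smul_apply, smul_eq_mul, dotProduct,
    Matrix.mulVec, hH, Finset.mul_sum]
  refine Finset.sum_comm.trans (Finset.sum_congr rfl fun i _ => Finset.sum_congr rfl fun j _ => ?_)
  ring

theorem dotProduct_self_eq_norm_sq (a : Euc n) :
    (fun i => a i) ⬝ᵥ (fun i => a i) = ‖a‖ ^ 2 := by
  rw [EuclideanSpace.real_norm_sq_eq]
  simp [dotProduct, sq]

theorem fderiv_fderiv_le_of_matLE {u : Euc n → ℝ} {x : Euc n} {t : ℝ}
    (h : MatLE (Hess u x) (t • (1 : Matrix (Fin n) (Fin n) ℝ))) (a : Euc n) :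
    fderiv ℝ (fderiv ℝ u) x a a ≤ t * ‖a‖ ^ 2 := by
  have h1 := h.dotProduct_mulVec_nonneg (fun i => a i)
  simp only [star_trivial, Matrix.sub_mulVec, Matrix.smul_mulVec, Matrix.one_mulVec,
    dotProduct_sub, dotProduct_smul, dotProduct_hess_mulVec, dotProduct_self_eq_norm_sq,
    smul_eq_mul] at h1
  linarith

theorem posDef_of_matLE {A : Matrix (Fin n) (Fin n) ℝ} {t : ℝ} (ht : 0 < t)
    (h : MatLE (t • (1 : Matrix (Fin n) (Fin n) ℝ)) A) : A.PosDef := by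
  have h1 : (t • (1 : Matrix (Fin n) (Fin n) ℝ)).PosDef := Matrix.PosDef.one.smul ht
  have h2 := h1.add_posSemidef h
  simpa using h2

theorem fderiv_fderiv_pos_of_posDef {u : Euc n → ℝ} {x : Euc n} (h : (Hess u x).PosDef)
    {a : Euc n} (ha : a ≠ 0) : 0 < fderiv ℝ (fderiv ℝ u) x a a := by
  have h1 := h.dotProduct_mulVec_pos (x := fun i => a i) (fun h0 => ha (by
    ext i; simpa using congrFun h0 i))
  simpa only [star_trivial, dotProduct_hess_mulVec] using h1

theorem fderiv_fderiv_symm_of_isHermitian {u : Euc n → ℝ} {x : Euc n} (h : (Hess u x).IsHermitian)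
    (a c : Euc n) : fderiv ℝ (fderiv ℝ u) x a c = fderiv ℝ (fderiv ℝ u) x c a := by
  rw [← dotProduct_hess_mulVec, ← dotProduct_hess_mulVec, Matrix.dotProduct_mulVec,
    ← Matrix.mulVec_transpose, dotProduct_comm]
  rw [show (Hess u x)ᵀ = Hess u x by
    rw [← Matrix.conjTranspose_eq_transpose_of_trivial]; exact h]

theorem exists_ne_zero_of_two_le (hn : 2 ≤ n) : ∃ a : Euc n, a ≠ 0 :=
  ⟨EuclideanSpace.single ⟨0, by omega⟩ 1, by simp⟩

theorem fderiv_fderiv_ne_zero_of_posDef (hn : 2 ≤ n) {u : Euc n → ℝ} {x : Euc n}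
    (h : (Hess u x).PosDef) : fderiv ℝ (fderiv ℝ u) x ≠ 0 := by
  obtain ⟨a, ha⟩ := exists_ne_zero_of_two_le hn
  intro h0
  have := fderiv_fderiv_pos_of_posDef h ha
  simp [h0] at this

theorem quadSup_hess_le (hn : 2 ≤ n) {u : Euc n → ℝ} {x : Euc n} {C : ℝ}
    (h : ∀ a : Euc n, ‖a‖ = 1 → fderiv ℝ (fderiv ℝ u) x a a ≤ C) : quadSup (Hess u x) ≤ C := by
  have : Nonempty (Metric.sphere (0 : Euc n) 1) :=
    ⟨⟨EuclideanSpace.single ⟨0, by omega⟩ 1, by simp⟩⟩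
  refine ciSup_le fun ξ => ?_
  rw [dotProduct_hess_mulVec]
  exact h ξ (by simp)

end Hessian

section Frame

/-- The frame of vector fields whose Gram operator is `(I + y yᵀ / v²) / v` with
`v = √(1 - |y|²)`. -/
def minkFrame : Option (Fin n) → Euc n → Euc n
  | none, y => (√(√(1 - ‖y‖ ^ 2)))⁻¹ ^ 3 • y
  | some i, y => (√(√(1 - ‖y‖ ^ 2)))⁻¹ • EuclideanSpace.single i 1

theorem one_sub_norm_sq_pos {y : Euc n} (hy : y ∈ Metric.ball (0 : Euc n) 1) :
    0 < 1 - ‖y‖ ^ 2 := by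
  have : ‖y‖ < 1 := by simpa using hy
  nlinarith [norm_nonneg y]

theorem contDiffOn_minkFrame (i : Option (Fin n)) :
    ContDiffOn ℝ (⊤ : ℕ∞) (minkFrame i) (Metric.ball (0 : Euc n) 1) := by
  have h0 : ContDiffOn ℝ (⊤ : ℕ∞) (fun y : Euc n => (√(√(1 - ‖y‖ ^ 2)))⁻¹)
      (Metric.ball (0 : Euc n) 1) := by
    refine ContDiffOn.inv (ContDiffOn.sqrt (ContDiffOn.sqrt ?_ ?_) ?_) ?_
    · exact (contDiff_const.sub (contDiff_norm_sq ℝ)).contDiffOn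
    · exact fun y hy => (one_sub_norm_sq_pos hy).ne'
    · exact fun y hy => (Real.sqrt_pos.2 (one_sub_norm_sq_pos hy)).ne'
    · exact fun y hy => (Real.sqrt_pos.2 (Real.sqrt_pos.2 (one_sub_norm_sq_pos hy))).ne'
  cases i with
  | none => exact (h0.pow 3).smul contDiffOn_id
  | some i => exact h0.smul contDiffOn_const

/-- The trace of an operator against the frame. -/
theorem sum_inner_minkFrame {y : Euc n} (P : Euc n →L[ℝ] Euc n) :
    ∑ i, ⟪minkFrame i y, P (minkFrame i y)⟫ =
      (√(1 - ‖y‖ ^ 2))⁻¹ * ∑ i, P (EuclideanSpace.single i 1) i +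
        (√(1 - ‖y‖ ^ 2))⁻¹ ^ 3 * ⟪y, P y⟫ := by
  have h1 : (√(√(1 - ‖y‖ ^ 2)))⁻¹ ^ 2 = (√(1 - ‖y‖ ^ 2))⁻¹ := by
    rw [inv_pow, Real.sq_sqrt (Real.sqrt_nonneg _)]
  rw [Fintype.sum_option, ← h1]
  simp only [minkFrame]
  generalize (√(√(1 - ‖y‖ ^ 2)))⁻¹ = α
  simp only [map_smul, inner_smul_left, inner_smul_right, Finset.mul_sum]
  rw [add_comm]
  congr 1
  · refine Finset.sum_congr rfl fun i _ => ?_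
    simp [EuclideanSpace.inner_single_left]
    ring
  · simp
    ring

theorem norm_sq_le_sum_inner_minkFrame {y : Euc n} (hy : y ∈ Metric.ball (0 : Euc n) 1)
    (z : Euc n) : ‖z‖ ^ 2 ≤ ∑ i, ⟪minkFrame i y, z⟫ ^ 2 := by
  have h0 := one_sub_norm_sq_pos hy
  have h1 : 1 ≤ (√(√(1 - ‖y‖ ^ 2)))⁻¹ ^ 2 := by
    rw [inv_pow, Real.sq_sqrt (Real.sqrt_nonneg _)]
    refine (one_le_inv₀ (Real.sqrt_pos.2 h0)).2 ?_
    rw [Real.sqrt_le_one]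
    nlinarith [norm_nonneg y]
  rw [Fintype.sum_option]
  have h2 : ∑ i, ⟪minkFrame (some i) y, z⟫ ^ 2 = (√(√(1 - ‖y‖ ^ 2)))⁻¹ ^ 2 * ‖z‖ ^ 2 := by
    rw [EuclideanSpace.real_norm_sq_eq z, Finset.mul_sum]
    refine Finset.sum_congr rfl fun i _ => ?_
    simp [minkFrame, inner_smul_left, EuclideanSpace.inner_single_left, mul_pow]
  rw [h2]
  nlinarith [sq_nonneg ‖z‖, sq_nonneg (⟪minkFrame none y, z⟫)]

theorem sum_norm_sq_minkFrame_le {y : Euc n} {Λ : ℝ} (h : ∀ i, ‖minkFrame i y‖ ≤ Λ) :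
    ∑ i : Option (Fin n), ‖minkFrame i y‖ ^ 2 ≤ (n + 1) * Λ ^ 2 := by
  refine (Finset.sum_le_card_nsmul _ _ (Λ ^ 2) fun i _ => ?_).trans ?_
  · exact pow_le_pow_left₀ (norm_nonneg _) (h i) 2
  · simp

/-- The Minkowski operator as a trace of the Hessian against the frame. -/
theorem minkDiv_eq_sum_inner {u : Euc n → ℝ} {x : Euc n} (hu : DifferentiableAt ℝ (gradient u) x)
    (hx : ‖gradient u x‖ < 1) :
    MinkDiv u x = ∑ i, ⟪minkFrame i (gradient u x),
      fderiv ℝ (gradient u) x (minkFrame i (gradient u x))⟫ := by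
  set g := gradient u with hg
  set P := fderiv ℝ g x with hP
  have h0 : 0 < 1 - ‖g x‖ ^ 2 := one_sub_norm_sq_pos (by simpa using hx)
  have hw := Real.sqrt_pos.2 h0
  have hgd : HasFDerivAt g P x := hu.hasFDerivAt
  have hm : HasFDerivAt (fun y => 1 - ‖g y‖ ^ 2) (-(2 • (innerSL ℝ (g x)).comp P)) x :=
    hgd.norm_sq.const_sub 1
  have hs := (hasDerivAt_inv hw.ne').comp_hasFDerivAt x (hm.sqrt h0.ne')
  have key : ∀ i, fderiv ℝ (fun y => (√(1 - ‖g y‖ ^ 2))⁻¹ * g y i) x (EuclideanSpace.single i 1) =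
      (√(1 - ‖g x‖ ^ 2))⁻¹ * P (EuclideanSpace.single i 1) i +
        (√(1 - ‖g x‖ ^ 2))⁻¹ ^ 3 * ⟪g x, P (g x i • EuclideanSpace.single i 1)⟫ := by
    intro i
    have hi : HasFDerivAt (fun y => g y i) ((EuclideanSpace.proj i : Euc n →L[ℝ] ℝ).comp P) x :=
      ((EuclideanSpace.proj i : Euc n →L[ℝ] ℝ).hasFDerivAt).comp x hgd
    have hmul : HasFDerivAt (fun y => (√(1 - ‖g y‖ ^ 2))⁻¹ * g y i) _ x := hs.mul hi
    rw [hmul.fderiv]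
    simp [inner_smul_right]
    field_simp
  unfold MinkDiv
  rw [sum_inner_minkFrame, Finset.sum_congr rfl fun i _ => key i, Finset.sum_add_distrib,
    ← Finset.mul_sum, ← Finset.mul_sum, ← inner_sum, ← map_sum, sum_smul_single]

end Frame

/-! ### A priori bounds for the right-hand side -/

section APriori

theorem prod_le_pow_sum_div (hn : 0 < n) {z : Fin n → ℝ} (hz : ∀ i, 0 ≤ z i) :
    ∏ i, z i ≤ ((∑ i, z i) / n) ^ n := by
  have hn' : (n : ℝ) ≠ 0 := by positivity
  have h1 := Real.geom_mean_le_arith_mean Finset.univ (fun _ => (1 : ℝ)) z (by simp)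
    (by simpa using hn) (fun i _ => hz i)
  simp only [Real.rpow_one, one_mul, Finset.sum_const, Finset.card_univ, Fintype.card_fin,
    nsmul_eq_mul, mul_one] at h1
  have h2 := pow_le_pow_left₀ (Real.rpow_nonneg (Finset.prod_nonneg fun i _ => hz i) _) h1 n
  rwa [← Real.rpow_natCast, ← Real.rpow_mul (Finset.prod_nonneg fun i _ => hz i),
    inv_mul_cancel₀ hn', Real.rpow_one] at h2

theorem abs_det_le_pow_trace_div (hn : 0 < n) {P : Euc n →L[ℝ] Euc n}
    (hsymm : ∀ a c, ⟪P a, c⟫ = ⟪a, P c⟫) (hpos : ∀ a, 0 ≤ ⟪P a, a⟫) :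
    |P.det| ≤ ((∑ i, P (EuclideanSpace.single i 1) i) / n) ^ n := by
  have hS : (P : Euc n →ₗ[ℝ] Euc n).IsSymmetric := fun a c => hsymm a c
  have hfin : Module.finrank ℝ (Euc n) = n := by simp
  have hev : ∀ i, 0 ≤ hS.eigenvalues hfin i := fun i => by
    have h1 := hpos (hS.eigenvectorBasis hfin i)
    have h2 : P (hS.eigenvectorBasis hfin i) =
        hS.eigenvalues hfin i • hS.eigenvectorBasis hfin i :=
      hS.apply_eigenvectorBasis hfin i
    rw [h2, inner_smul_left, real_inner_self_eq_norm_sq] at h1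
    simpa using h1
  have htr : ∑ i, P (EuclideanSpace.single i 1) i = ∑ i, hS.eigenvalues hfin i := by
    have h1 := LinearMap.trace_eq_sum_inner (P : Euc n →ₗ[ℝ] Euc n)
      (EuclideanSpace.basisFun (Fin n) ℝ)
    rw [hS.trace_eq_sum_eigenvalues hfin] at h1
    rw [show (∑ i, hS.eigenvalues hfin i) = _ from h1]
    simp [EuclideanSpace.inner_single_left]
  have hdet : P.det = ∏ i, hS.eigenvalues hfin i := hS.det_eq_prod_eigenvalues hfin
  rw [htr, hdet, abs_of_nonneg (Finset.prod_nonneg fun i _ => hev i)]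
  exact prod_le_pow_sum_div hn hev

theorem trace_nonneg {P : Euc n →L[ℝ] Euc n} (hpos : ∀ a, 0 ≤ ⟪P a, a⟫) :
    0 ≤ ∑ i, P (EuclideanSpace.single i 1) i :=
  Finset.sum_nonneg fun i _ => by
    simpa [EuclideanSpace.inner_single_right] using hpos (EuclideanSpace.single i 1)

theorem trace_le_sum_inner_minkFrame {P : Euc n →L[ℝ] Euc n} (hpos : ∀ a, 0 ≤ ⟪P a, a⟫)
    {y : Euc n} (hy : ‖y‖ < 1) :
    ∑ i, P (EuclideanSpace.single i 1) i ≤ ∑ i, ⟪minkFrame i y, P (minkFrame i y)⟫ := by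
  rw [sum_inner_minkFrame]
  have h0 := one_sub_norm_sq_pos (y := y) (by simpa using hy)
  have h1 : 1 ≤ (√(1 - ‖y‖ ^ 2))⁻¹ := by
    refine (one_le_inv₀ (Real.sqrt_pos.2 h0)).2 ?_
    rw [Real.sqrt_le_one]
    nlinarith [norm_nonneg y]
  have h2 := trace_nonneg hpos
  have h3 := hpos y
  rw [real_inner_comm] at h3
  have h4 : 0 ≤ (√(1 - ‖y‖ ^ 2))⁻¹ ^ 3 * ⟪y, P y⟫ := by positivity
  nlinarith

theorem volume_image_le_of_trace_le (hn : 0 < n) {Ω : Set (Euc n)} (hΩ : IsOpen Ω)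
    {g : Euc n → Euc n} {P : Euc n → Euc n →L[ℝ] Euc n} {m : ℝ}
    (hg : ∀ x ∈ Ω, HasFDerivAt g (P x) x)
    (hsymm : ∀ x ∈ Ω, ∀ a c, ⟪P x a, c⟫ = ⟪a, P x c⟫) (hpos : ∀ x ∈ Ω, ∀ a, 0 ≤ ⟪P x a, a⟫)
    (htr : ∀ x ∈ Ω, ∑ i, P x (EuclideanSpace.single i 1) i ≤ m) :
    volume (g '' Ω) ≤ ENNReal.ofReal ((m / n) ^ n) * volume Ω := by
  refine (addHaar_image_le_lintegral_abs_det_fderiv volume hΩ.measurableSet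
    (fun x hx => (hg x hx).hasFDerivWithinAt)).trans ?_
  rw [← setLIntegral_const]
  refine setLIntegral_mono' hΩ.measurableSet fun x hx => ENNReal.ofReal_le_ofReal ?_
  refine (abs_det_le_pow_trace_div hn (hsymm x hx) (hpos x hx)).trans ?_
  have h1 := trace_nonneg (hpos x hx)
  gcongr
  exact htr x hx

/-- Some value of the trace is bounded below in terms of the volume of the image. -/
theorem exists_le_trace (hn : 0 < n) {Ω Ωt : Set (Euc n)} (hΩ : IsOpen Ω)
    (hΩb : Bornology.IsBounded Ω) (hΩne : Ω.Nonempty) (hΩt : IsOpen Ωt)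
    (hΩtb : Bornology.IsBounded Ωt) (hΩtne : Ωt.Nonempty)
    {g : Euc n → Euc n} {P : Euc n → Euc n →L[ℝ] Euc n}
    (hg : ∀ x ∈ Ω, HasFDerivAt g (P x) x) (himg : g '' Ω = Ωt)
    (hsymm : ∀ x ∈ Ω, ∀ a c, ⟪P x a, c⟫ = ⟪a, P x c⟫) (hpos : ∀ x ∈ Ω, ∀ a, 0 ≤ ⟪P x a, a⟫) :
    ∃ x ∈ Ω, 3 / 4 * (n * ((volume Ωt).toReal / (volume Ω).toReal) ^ ((1 : ℝ) / n)) ≤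
      ∑ i, P x (EuclideanSpace.single i 1) i := by
  by_contra! hcon
  set q : ℝ := ((volume Ωt).toReal / (volume Ω).toReal) ^ ((1 : ℝ) / n) with hq
  have hn' : (n : ℝ) ≠ 0 := by positivity
  have hv : 0 < (volume Ω).toReal :=
    ENNReal.toReal_pos (hΩ.measure_pos volume hΩne).ne' hΩb.measure_lt_top.ne
  have hvt : 0 < (volume Ωt).toReal :=
    ENNReal.toReal_pos (hΩt.measure_pos volume hΩtne).ne' hΩtb.measure_lt_top.ne
  have hqn : q ^ n = (volume Ωt).toReal / (volume Ω).toReal := by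
    rw [hq, ← Real.rpow_natCast, ← Real.rpow_mul (by positivity), one_div,
      inv_mul_cancel₀ hn', Real.rpow_one]
  have h1 := volume_image_le_of_trace_le hn hΩ hg hsymm hpos (fun x hx => (hcon x hx).le)
  have h2 : (3 / 4 * (n * q) / n) = 3 / 4 * q := by field_simp
  rw [himg, h2, mul_pow, hqn] at h1
  have h3 := ENNReal.toReal_mono
    (ENNReal.mul_ne_top ENNReal.ofReal_ne_top hΩb.measure_lt_top.ne) h1
  rw [ENNReal.toReal_mul, ENNReal.toReal_ofReal (by positivity), mul_assoc,
    div_mul_cancel₀ _ hv.ne'] at h3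
  have h4 : (3 / 4 : ℝ) ^ n < 1 := pow_lt_one₀ (by norm_num) (by norm_num) hn.ne'
  nlinarith

/-- A function with gradient bounded by one has a point of controlled Hessian. -/
theorem exists_hessian_le {E : Type*} [NormedAddCommGroup E] [InnerProductSpace ℝ E]
    [FiniteDimensional ℝ E] {Ω : Set E} (hΩ : IsOpen Ω) {x₀ : E} {r : ℝ} (hr : 0 < r)
    (hball : Metric.closedBall x₀ r ⊆ Ω) {u : E → ℝ} (hu : ∀ x ∈ Ω, DifferentiableAt ℝ u x)
    (hu2 : ∀ x ∈ Ω, DifferentiableAt ℝ (fderiv ℝ u) x) (hgrad : ∀ x ∈ Ω, ‖fderiv ℝ u x‖ ≤ 1) :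
    ∃ x ∈ Ω, ∀ a, fderiv ℝ (fderiv ℝ u) x a a ≤ 4 / r * ‖a‖ ^ 2 := by
  set φ : E → ℝ := fun x => u x - 2 / r * ‖x - x₀‖ ^ 2 with hφ
  have hcont : ContinuousOn φ (Metric.closedBall x₀ r) := by
    refine ContinuousOn.sub (fun x hx => (hu x (hball hx)).continuousAt.continuousWithinAt) ?_
    fun_prop
  obtain ⟨x, hx, hmax⟩ := (isCompact_closedBall x₀ r).exists_isMaxOn
    ⟨x₀, Metric.mem_closedBall_self hr.le⟩ hcont
  have hxlt : x ∈ Metric.ball x₀ r := by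
    have hx' : ‖x - x₀‖ ≤ r := by simpa [dist_eq_norm] using hx
    rw [Metric.mem_ball, dist_eq_norm]
    refine lt_of_le_of_ne hx' fun heq => ?_
    have h1 : φ x₀ ≤ φ x := hmax (Metric.mem_closedBall_self hr.le)
    have h2 : ‖u x - u x₀‖ ≤ 1 * ‖x - x₀‖ :=
      (convex_closedBall x₀ r).norm_image_sub_le_of_norm_fderiv_le
        (fun z hz => hu z (hball hz)) (fun z hz => hgrad z (hball hz))
        (Metric.mem_closedBall_self hr.le) hx
    rw [Real.norm_eq_abs] at h2
    have h3 := (le_abs_self _).trans h2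
    simp only [hφ, sub_self, norm_zero, heq] at h1 h3
    have h4 : 2 / r * r ^ 2 = 2 * r := by field_simp
    rw [h4] at h1
    norm_num at h1
    linarith
  refine ⟨x, hball hx, fun a => ?_⟩
  have hloc : IsLocalMax φ x := by
    filter_upwards [Metric.isOpen_ball.mem_nhds hxlt] with z hz
    exact hmax (Metric.ball_subset_closedBall hz)
  have hsub : ∀ z : E, HasFDerivAt (fun z => z - x₀) (ContinuousLinearMap.id ℝ E) z := fun z =>
    (hasFDerivAt_id z).sub_const x₀
  have hjet : HasJet φ x (fderiv ℝ u x - (2 / r) • (2 • innerSL ℝ (x - x₀)))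
      (fun a => fderiv ℝ (fderiv ℝ u) x a a - 4 / r * ‖a‖ ^ 2) := by
    refine ⟨fun z => fderiv ℝ u z - (2 / r) • (2 • innerSL ℝ (z - x₀)), ?_, rfl, fun a => ?_⟩
    · filter_upwards [hΩ.mem_nhds (hball hx)] with z hz
      have h1 := ((hsub z).norm_sq).const_mul (2 / r)
      exact (hu z hz).hasFDerivAt.sub h1
    · have h1 : HasFDerivAt (fun z => fderiv ℝ u z a) _ x :=
        (hu2 x (hball hx)).hasFDerivAt.clm_apply (hasFDerivAt_const a x)
      have h2 := ((hsub x).inner ℝ (hasFDerivAt_const a x)).const_mul (4 / r)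
      have h3 := (h1.sub h2).hasLineDerivAt a
      convert h3 using 1
      · ext z
        simp [inner_sub_left]
        ring
      · simp
  linarith [hjet.nonpos_of_isLocalMax hloc a]

end APriori

/-! ### The geometry of the problem -/

section Setup

theorem eventually_forall_norm_le {X V : Type*} [TopologicalSpace X] [NormedAddCommGroup V]
    {s : Set X} (hs : IsCompact s) {φ : X → V} (hφ : ContinuousOn φ s) :
    ∀ᶠ Λ : ℝ in Filter.atTop, ∀ y ∈ s, ‖φ y‖ ≤ Λ := by
  obtain ⟨C, hC⟩ := hs.exists_bound_of_continuousOn hφ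
  filter_upwards [Filter.eventually_ge_atTop C] with Λ hΛ y hy
  exact (hC y hy).trans hΛ

theorem uniqueDiffOn_closure {E : Type*} [NormedAddCommGroup E] [NormedSpace ℝ E] {D : Set E}
    (hD : IsOpen D) (hconv : Convex ℝ D) (hne : D.Nonempty) : UniqueDiffOn ℝ (closure D) :=
  uniqueDiffOn_convex hconv.closure (hne.mono (interior_maximal subset_closure hD))

/-- The regularity of the gradient map of a uniformly convex function. -/
theorem contDiffOn_gradient_of_posDef (hn : 2 ≤ n) {D : Set (Euc n)} (hD : IsOpen D)
    (huniq : UniqueDiffOn ℝ (closure D)) {u : Euc n → ℝ}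
    (hu : ContDiffOn ℝ (⊤ : ℕ∞) u (closure D)) (hpos : ∀ x ∈ closure D, (Hess u x).PosDef) :
    ContDiffOn ℝ (⊤ : ℕ∞) (gradient u) (closure D) ∧
      ∀ y ∈ closure D, DifferentiableAt ℝ (fderiv ℝ u) y := by
  obtain ⟨h1, h2⟩ := contDiffOn_fderiv_closure hD huniq hu
    fun y hy => fderiv_fderiv_ne_zero_of_posDef hn (hpos y hy)
  exact ⟨(rieszL (Euc n)).contDiff.comp_contDiffOn h1, h2⟩

variable {Ω Ωt : Set (Euc n)} {ht h : Euc n → ℝ} {θt θ : ℝ}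

theorem IsSmoothSol.posDef {f : Euc n × Euc n → ℝ} {c : ℝ} {u : Euc n → ℝ}
    (hsol : IsSmoothSol Ω Ωt f c u) {x : Euc n} (hx : x ∈ closure Ω) : (Hess u x).PosDef := by
  obtain ⟨δ, hδ, hle⟩ := hsol.2.1
  exact posDef_of_matLE hδ (hle x hx)

theorem IsSmoothSol.exists_eq_gradient {f : Euc n × Euc n → ℝ} {c : ℝ} {u : Euc n → ℝ}
    (hsol : IsSmoothSol Ω Ωt f c u) (hcomp : IsCompact (closure Ω))
    (hcont : ContinuousOn (gradient u) (closure Ω)) {y : Euc n} (hy : y ∈ closure Ωt) :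
    ∃ x ∈ closure Ω, gradient u x = y := by
  have h1 : closure Ωt ⊆ gradient u '' closure Ω := by
    refine closure_minimal ?_ (hcomp.image_of_continuousOn hcont).isClosed
    rw [← hsol.2.2.2.2]
    exact image_mono subset_closure
  exact h1 hy

/-- The dual gradient map inverts the gradient map. -/
theorem IsLegendre.gradient_spec {f : Euc n × Euc n → ℝ} {c : ℝ} {u ut : Euc n → ℝ}
    (hsol : IsSmoothSol Ω Ωt f c u) (hleg : IsLegendre Ω Ωt u ut) (hΩt : IsOpen Ωt)
    (hΩ : IsOpen Ω) (hcomp : IsCompact (closure Ω))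
    (hcont : ContinuousOn (gradient u) (closure Ω)) :
    (∀ y ∈ closure Ωt, gradient ut y ∈ closure Ω ∧ gradient u (gradient ut y) = y ∧
      (Hess ut y).PosDef) ∧ (∀ y ∈ Ωt, gradient ut y ∈ Ω) ∧
      ∀ y ∈ frontier Ωt, gradient ut y ∈ frontier Ω := by
  have himg := hsol.2.2.2.2
  have h1 : ∀ y ∈ closure Ωt, gradient ut y ∈ closure Ω ∧ gradient u (gradient ut y) = y ∧
      (Hess ut y).PosDef := by
    intro y hy
    obtain ⟨x, hx, rfl⟩ := hsol.exists_eq_gradient hcomp hcont hy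
    rw [hleg.2.2.1 x hx, hleg.2.2.2 x hx]
    exact ⟨hx, rfl, (hsol.posDef hx).inv⟩
  refine ⟨h1, fun y hy => ?_, fun y hy => ?_⟩
  · rw [← himg] at hy
    obtain ⟨x, hx, rfl⟩ := hy
    rwa [hleg.2.2.1 x (subset_closure hx)]
  · rw [hΩt.frontier_eq] at hy
    rw [hΩ.frontier_eq]
    obtain ⟨h2, h3, -⟩ := h1 y hy.1
    refine ⟨h2, fun h4 => hy.2 ?_⟩
    rw [← himg]
    exact ⟨_, h4, h3⟩

/-- The derivatives of the two gradient maps are inverse to each other. -/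
theorem IsLegendre.fderiv_gradient_apply {u ut : Euc n → ℝ} (hleg : IsLegendre Ω Ωt u ut)
    (hΩ : IsOpen Ω) {x : Euc n} (hx : x ∈ Ω) (hu : DifferentiableAt ℝ (gradient u) x)
    (hut : DifferentiableAt ℝ (gradient ut) (gradient u x)) (a : Euc n) :
    fderiv ℝ (gradient ut) (gradient u x) (fderiv ℝ (gradient u) x a) = a := by
  have h1 := hut.hasFDerivAt.comp x hu.hasFDerivAt
  have h2 : HasFDerivAt (gradient ut ∘ gradient u) (ContinuousLinearMap.id ℝ (Euc n)) x := by
    refine (hasFDerivAt_id x).congr_of_eventuallyEq ?_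
    filter_upwards [hΩ.mem_nhds hx] with z hz
    exact hleg.2.2.1 z (subset_closure hz)
  have h3 := congrArg (fun L : Euc n →L[ℝ] Euc n => L a) (h1.unique h2)
  simpa using h3

theorem contDiffOn_fderiv_minkFrame (i : Option (Fin n)) :
    ContDiffOn ℝ (⊤ : ℕ∞) (fderiv ℝ (minkFrame i)) (Metric.ball (0 : Euc n) 1) :=
  (contDiffOn_minkFrame i).fderiv_of_isOpen Metric.isOpen_ball (by norm_cast)

theorem contDiffOn_fderiv_fderiv_minkFrame (i : Option (Fin n)) :
    ContDiffOn ℝ (⊤ : ℕ∞) (fderiv ℝ (fderiv ℝ (minkFrame i))) (Metric.ball (0 : Euc n) 1) :=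
  (contDiffOn_fderiv_minkFrame i).fderiv_of_isOpen Metric.isOpen_ball (by norm_cast)

/-- `Λ` bounds the data of the problem which do not depend on the solution. -/
structure DataBound (Ω Ωt : Set (Euc n)) (ht h : Euc n → ℝ) (Λ : ℝ) : Prop where
  one_le : 1 ≤ Λ
  card_le : (n + 1 : ℝ) ≤ Λ
  h_le : ∀ y ∈ closure Ωt, ‖h y‖ ≤ Λ
  b_le : ∀ y ∈ closure Ωt, ‖gradient h y‖ ≤ Λ
  B_le : ∀ y ∈ closure Ωt, ‖fderiv ℝ (gradient h) y‖ ≤ Λ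
  B1_le : ∀ y ∈ closure Ωt, ‖fderiv ℝ (fderiv ℝ (gradient h)) y‖ ≤ Λ
  bt_le : ∀ x ∈ closure Ω, ‖gradient ht x‖ ≤ Λ
  Bt_le : ∀ x ∈ closure Ω, ‖fderiv ℝ (gradient ht) x‖ ≤ Λ
  diam_le : ∀ x ∈ closure Ω, ∀ z ∈ closure Ω, ‖x - z‖ ≤ Λ
  r_le : ∀ i, ∀ y ∈ closure Ωt, ‖minkFrame i y‖ ≤ Λ
  r1_le : ∀ i, ∀ y ∈ closure Ωt, ‖fderiv ℝ (minkFrame i) y‖ ≤ Λ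
  r2_le : ∀ i, ∀ y ∈ closure Ωt, ‖fderiv ℝ (fderiv ℝ (minkFrame i)) y‖ ≤ Λ

theorem eventually_dataBound (hdom : DomainSetup Ω Ωt ht h θt θ)
    (hball : closure Ωt ⊆ Metric.ball (0 : Euc n) 1) :
    ∀ᶠ Λ : ℝ in Filter.atTop, DataBound Ω Ωt ht h Λ := by
  obtain ⟨-, -, hΩb, hΩtb, -, -, hht, hh, -⟩ := hdom
  have hc := hΩb.isCompact_closure
  have hct := hΩtb.isCompact_closure
  have hb := contDiff_gradient hh
  have hbt := contDiff_gradient hht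
  have hB : ContDiff ℝ (⊤ : ℕ∞) (fderiv ℝ (gradient h)) := hb.fderiv_right (by norm_cast)
  have hBt : ContDiff ℝ (⊤ : ℕ∞) (fderiv ℝ (gradient ht)) := hbt.fderiv_right (by norm_cast)
  have hB1 : ContDiff ℝ (⊤ : ℕ∞) (fderiv ℝ (fderiv ℝ (gradient h))) :=
    hB.fderiv_right (by norm_cast)
  have hdiam : ∀ᶠ Λ : ℝ in Filter.atTop, ∀ p ∈ closure Ω ×ˢ closure Ω, ‖p.1 - p.2‖ ≤ Λ :=
    eventually_forall_norm_le (hc.prod hc) (by fun_prop)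
  filter_upwards [Filter.eventually_ge_atTop 1, Filter.eventually_ge_atTop (n + 1 : ℝ),
    eventually_forall_norm_le hct hh.continuous.continuousOn,
    eventually_forall_norm_le hct hb.continuous.continuousOn,
    eventually_forall_norm_le hct hB.continuous.continuousOn,
    eventually_forall_norm_le hct hB1.continuous.continuousOn,
    eventually_forall_norm_le hc hbt.continuous.continuousOn,
    eventually_forall_norm_le hc hBt.continuous.continuousOn, hdiam,
    Filter.eventually_all.2 fun i => eventually_forall_norm_le hct
      ((contDiffOn_minkFrame i).continuousOn.mono hball),
    Filter.eventually_all.2 fun i => eventually_forall_norm_le hct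
      ((contDiffOn_fderiv_minkFrame i).continuousOn.mono hball),
    Filter.eventually_all.2 fun i => eventually_forall_norm_le hct
      ((contDiffOn_fderiv_fderiv_minkFrame i).continuousOn.mono hball)]
    with Λ h1 h2 h3 h4 h5 h6 h7 h8 h9 h10 h11 h12
  exact ⟨h1, h2, h3, h4, h5, h6, h7, h8, fun x hx z hz => h9 (x, z) ⟨hx, hz⟩, h10, h11, h12⟩

end Setup

/-! ### The dual system of a solution -/

section Solution

variable {Ω Ωt : Set (Euc n)} {ht h : Euc n → ℝ} {θt θ : ℝ}

theorem IsSmoothSol.gradient_mem {f : Euc n × Euc n → ℝ} {c : ℝ} {u : Euc n → ℝ}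
    (hsol : IsSmoothSol Ω Ωt f c u) {x : Euc n} (hx : x ∈ Ω) : gradient u x ∈ Ωt :=
  hsol.2.2.2.2 ▸ mem_image_of_mem _ hx

/-- Two-sided bounds on the right-hand side along a solution. -/
theorem IsSmoothSol.rhs_bounds (hn : 2 ≤ n) (hdom : DomainSetup Ω Ωt ht h θt θ)
    {f : Euc n × Euc n → ℝ} {c K Λ r : ℝ} {x₀ : Euc n} {u : Euc n → ℝ}
    (hsol : IsSmoothSol Ω Ωt f c u) (hd : ∀ x ∈ closure Ω, DifferentiableAt ℝ (fderiv ℝ u) x)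
    (hΛ : DataBound Ω Ωt ht h Λ) (hr : 0 < r) (hball : Metric.closedBall x₀ r ⊆ Ω)
    (hK : C2Bound Ω Ωt f K) (hosc : OSCcond Ω Ωt f) {x : Euc n} (hx : x ∈ Ω) :
    n * ((volume Ωt).toReal / (volume Ω).toReal) ^ ((1 : ℝ) / n) / 4 ≤ f (x, gradient u x) + c ∧
      f (x, gradient u x) + c ≤ 4 / r * ((n + 1) * Λ ^ 2) + 2 * K := by
  obtain ⟨hΩ, hΩt, hΩb, hΩtb, hΩne, hΩtne, -⟩ := hdom
  have hsub : ∀ {z}, z ∈ Ω → z ∈ closure Ω := fun hz => subset_closure hz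
  have hgrad : ∀ z ∈ Ω, DifferentiableAt ℝ (gradient u) z := fun z hz =>
    (hasFDerivAt_gradient (hd z (hsub hz))).differentiableAt
  have hform : ∀ z ∈ Ω, ∀ a b, ⟪fderiv ℝ (gradient u) z a, b⟫ = fderiv ℝ (fderiv ℝ u) z a b :=
    fun z hz => inner_fderiv_gradient (hd z (hsub hz))
  have hsymm : ∀ z ∈ Ω, ∀ a b, ⟪fderiv ℝ (gradient u) z a, b⟫ =
      ⟪a, fderiv ℝ (gradient u) z b⟫ := fun z hz a b => by
    rw [hform z hz, real_inner_comm, hform z hz,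
      fderiv_fderiv_symm_of_isHermitian (hsol.posDef (hsub hz)).isHermitian]
  have hpos : ∀ z ∈ Ω, ∀ a, 0 ≤ ⟪fderiv ℝ (gradient u) z a, a⟫ := fun z hz a => by
    rw [hform z hz]
    rcases eq_or_ne a 0 with rfl | ha
    · simp
    · exact (fderiv_fderiv_pos_of_posDef (hsol.posDef (hsub hz)) ha).le
  have heq : ∀ z ∈ Ω, f (z, gradient u z) + c = ∑ i, ⟪minkFrame i (gradient u z),
      fderiv ℝ (gradient u) z (minkFrame i (gradient u z))⟫ := fun z hz => by
    rw [← hsol.2.2.2.1 z hz, minkDiv_eq_sum_inner (hgrad z hz) (hsol.2.2.1 z (hsub hz))]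
  have hmem : ∀ z ∈ Ω, gradient u z ∈ closure Ωt := fun z hz =>
    subset_closure (hsol.gradient_mem hz)
  constructor
  · obtain ⟨z, hz, hle⟩ := exists_le_trace (by omega) hΩ hΩb hΩne hΩt hΩtb hΩtne
      (fun z hz => (hgrad z hz).hasFDerivAt) hsol.2.2.2.2 hsymm hpos
    have h1 := hle.trans (trace_le_sum_inner_minkFrame (hpos z hz) (hsol.2.2.1 z (hsub hz)))
    rw [← heq z hz] at h1
    have h2 := (abs_le.1 (hosc x (hsub hx) z (hsub hz) _ (hmem x hx) _ (hmem z hz))).1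
    linarith
  · obtain ⟨z, hz, hle⟩ := exists_hessian_le hΩ hr hball
      (fun z hz => (hsol.1.contDiffAt (Filter.mem_of_superset (hΩ.mem_nhds hz)
        subset_closure)).differentiableAt (by simp)) (fun z hz => hd z (hsub hz))
      (fun z hz => by
        rw [← norm_rieszL]
        exact (hsol.2.2.1 z (hsub hz)).le)
    have h1 : f (z, gradient u z) + c ≤ 4 / r * ((n + 1) * Λ ^ 2) := by
      rw [heq z hz]
      refine le_trans ?_ (mul_le_mul_of_nonneg_left
        (sum_norm_sq_minkFrame_le fun i => hΛ.r_le i _ (hmem z hz)) (by positivity))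
      rw [Finset.mul_sum]
      refine Finset.sum_le_sum fun i _ => ?_
      rw [real_inner_comm, hform z hz]
      exact hle _
    have h2 := (abs_le.1 (hK.2 _ (mk_mem_prod (hsub hz) (hmem z hz))).1).1
    have h3 := (abs_le.1 (hK.2 _ (mk_mem_prod (hsub hx) (hmem x hx))).1).2
    linarith

/-- The barrier inequality for the defining function. -/
theorem sum_barrier_le {E : Type*} [NormedAddCommGroup E] [InnerProductSpace ℝ E]
    {ι : Type*} [Fintype ι] {Λ θ c₁ ε F : ℝ} (hΛ : 1 ≤ Λ) (hθ : 0 < θ) (hc₁ : 0 < c₁)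
    (hcard : (Fintype.card ι : ℝ) ≤ Λ) {B : E →L[ℝ] E} (hB : ∀ a, ⟪B a, a⟫ ≤ -θ * ‖a‖ ^ 2)
    {r v : ι → E} (hr : ∀ i, ‖r i‖ ≤ Λ) (heq : ∑ i, ⟪r i, v i⟫ = F) (hF : c₁ ≤ F)
    {b fx : E} (hb : ‖b‖ ≤ Λ) (hfx : ‖fx‖ ≤ ε) (hε : 4 * ε * Λ ≤ θ * c₁ ^ 2 / (2 * Λ ^ 3)) :
    ∑ i, ⟪B (v i), v i⟫ + ⟪b, fx⟫ ≤ -(θ * c₁ ^ 2 / (2 * Λ ^ 3)) := by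
  have hΛ0 : 0 < Λ := by linarith
  have h1 : F ≤ Λ * ∑ i, ‖v i‖ := by
    rw [← heq, Finset.mul_sum]
    refine Finset.sum_le_sum fun i _ => (real_inner_le_norm _ _).trans ?_
    exact mul_le_mul_of_nonneg_right (hr i) (norm_nonneg _)
  have h2 : (∑ i, ‖v i‖) ^ 2 ≤ Λ * ∑ i, ‖v i‖ ^ 2 := by
    refine (sq_sum_le_card_mul_sum_sq (s := Finset.univ) (f := fun i => ‖v i‖)).trans ?_
    exact mul_le_mul_of_nonneg_right (by simpa using hcard)
      (Finset.sum_nonneg fun i _ => sq_nonneg _)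
  have h3 : c₁ ^ 2 ≤ Λ ^ 3 * ∑ i, ‖v i‖ ^ 2 := by
    have h4 : c₁ ^ 2 ≤ (Λ * ∑ i, ‖v i‖) ^ 2 := pow_le_pow_left₀ hc₁.le (hF.trans h1) 2
    have h5 := mul_le_mul_of_nonneg_left h2 (sq_nonneg Λ)
    nlinarith
  have h4 : c₁ ^ 2 / Λ ^ 3 ≤ ∑ i, ‖v i‖ ^ 2 := by
    rw [div_le_iff₀ (by positivity)]
    linarith
  have h5 : ∑ i, ⟪B (v i), v i⟫ ≤ -θ * ∑ i, ‖v i‖ ^ 2 := by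
    rw [Finset.mul_sum]
    exact Finset.sum_le_sum fun i _ => hB _
  have h6 : ⟪b, fx⟫ ≤ Λ * ε := (real_inner_le_norm _ _).trans
    (mul_le_mul hb hfx (norm_nonneg _) hΛ0.le)
  have h7 : θ * c₁ ^ 2 / (2 * Λ ^ 3) = θ * (c₁ ^ 2 / Λ ^ 3) / 2 := by field_simp
  have h8 := mul_le_mul_of_nonneg_left h4 hθ.le
  have h9 : 0 < c₁ ^ 2 / Λ ^ 3 := by positivity
  have h10 : 0 ≤ ε := (norm_nonneg _).trans hfx
  rw [h7] at hε ⊢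
  nlinarith [mul_nonneg h10 hΛ0.le]

/-- The dual system associated with the Legendre transform of a solution. -/
theorem exists_dualSystem (hn : 2 ≤ n) (hdom : DomainSetup Ω Ωt ht h θt θ)
    (hball : closure Ωt ⊆ Metric.ball (0 : Euc n) 1) {f : Euc n × Euc n → ℝ} {c K Λ c₁ ε : ℝ}
    {u ut : Euc n → ℝ} (hsol : IsSmoothSol Ω Ωt f c u) (hleg : IsLegendre Ω Ωt u ut)
    (hΛ : DataBound Ω Ωt ht h Λ) (hA : InA Ω Ωt f) (hK : C2Bound Ω Ωt f K) (hKΛ : K ≤ Λ)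
    (hx : DxBound Ω Ωt f ε) (hxp : DxpBound Ω Ωt f ε) (hc₁ : 0 < c₁)
    (hF : ∀ x ∈ Ω, c₁ ≤ f (x, gradient u x) + c ∧ f (x, gradient u x) + c ≤ Λ) (hε0 : 0 ≤ ε)
    (hε1 : ε ≤ 1) (hε : 4 * ε * Λ ≤ θ * c₁ ^ 2 / (2 * Λ ^ 3)) :
    ∃ S : DualSystem (Euc n) (Option (Fin n)) Λ (θ * c₁ ^ 2 / (2 * Λ ^ 3)) θt ε,
      S.D = Ωt ∧ ∀ y ∈ closure Ωt, ∀ a b, ⟪S.T y a, b⟫ = fderiv ℝ (fderiv ℝ ut) y a b := by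
  obtain ⟨hΩ, hΩt, hΩb, hΩtb, hΩne, hΩtne, hht, hh, hΩeq, hΩteq, hbtn, hbn, hθt, hθ, hHt, hH⟩ :=
    hdom
  have hcomp := hΩb.isCompact_closure
  have hcompt := hΩtb.isCompact_closure
  have hdh : ∀ x, DifferentiableAt ℝ (fderiv ℝ h) x := fun x =>
    (hh.fderiv_right (m := (⊤ : ℕ∞)) (by norm_cast)).differentiable (by simp) x
  have hdht : ∀ x, DifferentiableAt ℝ (fderiv ℝ ht) x := fun x =>
    (hht.fderiv_right (m := (⊤ : ℕ∞)) (by norm_cast)).differentiable (by simp) x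
  have hHneg : ∀ x a, ⟪fderiv ℝ (gradient h) x a, a⟫ ≤ -θ * ‖a‖ ^ 2 := fun x a => by
    rw [inner_fderiv_gradient (hdh x)]
    exact fderiv_fderiv_le_of_matLE (hH x) a
  have hHtneg : ∀ x a, ⟪fderiv ℝ (gradient ht) x a, a⟫ ≤ -θt * ‖a‖ ^ 2 := fun x a => by
    rw [inner_fderiv_gradient (hdht x)]
    exact fderiv_fderiv_le_of_matLE (hHt x) a
  have hsuper : ∀ y z, h z ≤ h y + ⟪gradient h y, z - y⟫ := le_add_inner_gradient hh
    fun x a => by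
      rw [← inner_fderiv_gradient (hdh x)]
      nlinarith [hHneg x a, sq_nonneg ‖a‖]
  have hsupert : ∀ y z, ht z ≤ ht y + ⟪gradient ht y, z - y⟫ := le_add_inner_gradient hht
    fun x a => by
      rw [← inner_fderiv_gradient (hdht x)]
      nlinarith [hHtneg x a, sq_nonneg ‖a‖]
  have hconv : Convex ℝ Ω := hΩeq ▸ convex_setOf_pos hsupert
  have hconvt : Convex ℝ Ωt := hΩteq ▸ convex_setOf_pos hsuper
  have huniq := uniqueDiffOn_closure hΩ hconv hΩne
  have huniqt := uniqueDiffOn_closure hΩt hconvt hΩtne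
  obtain ⟨hgu, hdu⟩ := contDiffOn_gradient_of_posDef hn hΩ huniq hsol.1 fun x hx => hsol.posDef hx
  obtain ⟨hspec, hint, hfront⟩ := hleg.gradient_spec hsol hΩt hΩ hcomp hgu.continuousOn
  obtain ⟨hgut, hdut⟩ := contDiffOn_gradient_of_posDef hn hΩt huniqt hleg.1
    fun y hy => (hspec y hy).2.2
  set s := closure Ωt with hs
  have hsub : ∀ {y}, y ∈ Ωt → y ∈ s := fun hy => subset_closure hy
  have hnhds : ∀ {y}, y ∈ Ωt → s ∈ 𝓝 y := fun hy =>
    Filter.mem_of_superset (hΩt.mem_nhds hy) subset_closure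
  set T := fderivWithin ℝ (gradient ut) s with hT
  have hTs : ContDiffOn ℝ (⊤ : ℕ∞) T s := hgut.fderivWithin huniqt (by norm_cast)
  set T1 := fderivWithin ℝ T s with hT1
  have hT1s : ContDiffOn ℝ (⊤ : ℕ∞) T1 s := hTs.fderivWithin huniqt (by norm_cast)
  set T2 := fderivWithin ℝ T1 s with hT2
  have hGd : ∀ y ∈ s, DifferentiableAt ℝ (gradient ut) y := fun y hy =>
    (hasFDerivAt_gradient (hdut y hy)).differentiableAt
  have hTeq : ∀ y ∈ s, T y = fderiv ℝ (gradient ut) y := fun y hy =>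
    (hGd y hy).fderivWithin (huniqt y hy)
  have hTform : ∀ y ∈ s, ∀ a b, ⟪T y a, b⟫ = fderiv ℝ (fderiv ℝ ut) y a b := fun y hy a b => by
    rw [hTeq y hy, inner_fderiv_gradient (hdut y hy)]
  have hTsymm : ∀ y ∈ s, ∀ a b, ⟪T y a, b⟫ = ⟪T y b, a⟫ := fun y hy a b => by
    rw [hTform y hy, hTform y hy,
      fderiv_fderiv_symm_of_isHermitian (hspec y hy).2.2.isHermitian]
  have hGT : ∀ y ∈ Ωt, HasFDerivAt (gradient ut) (T y) y := fun y hy => by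
    rw [hTeq y (hsub hy)]
    exact (hGd y (hsub hy)).hasFDerivAt
  have hTT1 : ∀ y ∈ s, HasFDerivWithinAt T (T1 y) s y := fun y hy =>
    (hTs.differentiableOn (by simp) y hy).hasFDerivWithinAt
  have hT1T2 : ∀ y ∈ s, HasFDerivWithinAt T1 (T2 y) s y := fun y hy =>
    (hT1s.differentiableOn (by simp) y hy).hasFDerivWithinAt
  have hfC2 : ∀ y ∈ Ωt, ContDiffAt ℝ 2 f (gradient ut y, y) := fun y hy =>
    hA.1.contDiffAt (Filter.mem_of_superset
      ((hΩ.prod hΩt).mem_nhds (mk_mem_prod (hint y hy) hy))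
      (prod_mono subset_closure subset_closure))
  have hfx : ∀ y ∈ Ωt, ‖rieszL (Euc n) ((fderiv ℝ f (gradient ut y, y)).comp
      (ContinuousLinearMap.inl ℝ (Euc n) (Euc n)))‖ ≤ ε := fun y hy => by
    rw [norm_rieszL, ← fderiv_partial_fst ((hfC2 y hy).differentiableAt (by simp))]
    exact hx _ (hspec y (hsub hy)).1 _ (hsub hy)
  have heq : ∀ y ∈ Ωt, ∑ i, ⟪minkFrame i y,
      fderiv ℝ (gradient u) (gradient ut y) (minkFrame i y)⟫ = f (gradient ut y, y) + c := by
    intro y hy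
    have h1 := (hspec y (hsub hy)).2.1
    have h2 := minkDiv_eq_sum_inner (u := u) (x := gradient ut y)
      (hasFDerivAt_gradient (hdu _ (hspec y (hsub hy)).1)).differentiableAt
      (hsol.2.2.1 _ (hspec y (hsub hy)).1)
    rw [hsol.2.2.2.1 _ (hint y hy), h1] at h2
    exact h2.symm
  have hF' : ∀ y ∈ Ωt, c₁ ≤ f (gradient ut y, y) + c ∧ f (gradient ut y, y) + c ≤ Λ :=
    fun y hy => by
      have h1 := hF _ (hint y hy)
      rwa [(hspec y (hsub hy)).2.1] at h1
  have hcard : (Fintype.card (Option (Fin n)) : ℝ) ≤ Λ := by simpa using hΛ.card_le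
  have hΛ0 : 0 < Λ := by linarith [hΛ.one_le]
  refine ⟨{
    D := Ωt
    h := h
    b := gradient h
    B := fderiv ℝ (gradient h)
    B1 := fderiv ℝ (fderiv ℝ (gradient h))
    ht := ht
    bt := gradient ht
    Bt := fderiv ℝ (gradient ht)
    r := minkFrame
    r1 := fun i => fderiv ℝ (minkFrame i)
    r2 := fun i => fderiv ℝ (fderiv ℝ (minkFrame i))
    G := gradient ut
    T := T
    T1 := T1
    T2 := T2
    v := fun y i => fderiv ℝ (gradient u) (gradient ut y) (minkFrame i y)
    F := fun y => f (gradient ut y, y) + c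
    fx := fun y => rieszL (Euc n) ((fderiv ℝ f (gradient ut y, y)).comp
      (ContinuousLinearMap.inl ℝ (Euc n) (Euc n)))
    fp := fun y => (fderiv ℝ f (gradient ut y, y)).comp
      (ContinuousLinearMap.inr ℝ (Euc n) (Euc n))
    qF := fun y a => fderiv ℝ (fderiv ℝ f) (gradient ut y, y) (T y a, a) (T y a, a) +
      ⟪rieszL (Euc n) ((fderiv ℝ f (gradient ut y, y)).comp
        (ContinuousLinearMap.inl ℝ (Euc n) (Euc n))), T1 y a a⟫
    one_le := hΛ.one_le
    κ_pos := by positivity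
    θt_pos := hθt
    ε_nonneg := hε0
    ε_le_one := hε1
    ε_small := hε
    card_le := hcard
    D_open := hΩt
    D_convex := hconvt
    D_compact := hcompt
    D_eq := hΩteq
    h_deriv := fun y => hasFDerivAt_innerSL_gradient (hh.differentiable (by simp) y)
    b_deriv := fun y => ((contDiff_gradient hh).differentiable (by simp) y).hasFDerivAt
    B_deriv := fun y => (((contDiff_gradient hh).fderiv_right (m := (⊤ : ℕ∞))
      (by norm_cast)).differentiable (by simp) y).hasFDerivAt
    h_super := hsuper
    h_le := fun y hy => (le_abs_self _).trans (hΛ.h_le y hy)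
    B_le := hΛ.B_le
    B1_le := hΛ.B1_le
    b_le := hΛ.b_le
    b_norm := hbn
    ht_deriv := fun y => hasFDerivAt_innerSL_gradient (hht.differentiable (by simp) y)
    bt_deriv := fun y => ((contDiff_gradient hht).differentiable (by simp) y).hasFDerivAt
    Bt_neg := hHtneg
    bt_le := fun y hy => hΛ.bt_le _ (hspec y hy).1
    Bt_le := fun y hy => hΛ.Bt_le _ (hspec y hy).1
    bt_lip := fun y hy z hz => hconv.closure.norm_image_sub_le_of_norm_fderiv_le
      (fun x _ => (contDiff_gradient hht).differentiable (by simp) x) hΛ.Bt_le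
      (hspec z hz).1 (hspec y hy).1
    G_diam := fun y hy z hz => hΛ.diam_le _ (hspec y hy).1 _ (hspec z hz).1
    ht_nonneg := fun y hy => by
      have h1 : closure Ω ⊆ {x | 0 ≤ ht x} := by
        refine closure_minimal ?_ (isClosed_le continuous_const hht.continuous)
        rw [hΩeq]
        exact fun x (hx : 0 < ht x) => hx.le
      exact h1 (hspec y hy).1
    ht_frontier := fun y hy => by
      have h1 := hfront y hy
      rw [hΩeq] at h1
      exact (frontier_lt_subset_eq continuous_const hht.continuous h1).symm
    bt_norm := fun y hy => hbtn _ (hfront y hy)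
    r_deriv := fun i y hy => ((contDiffOn_minkFrame i).contDiffAt
      (Metric.isOpen_ball.mem_nhds (hball (hsub hy)))).differentiableAt (by simp) |>.hasFDerivAt
    r1_deriv := fun i y hy => ((contDiffOn_fderiv_minkFrame i).contDiffAt
      (Metric.isOpen_ball.mem_nhds (hball (hsub hy)))).differentiableAt (by simp) |>.hasFDerivAt
    r_le := fun i y hy => hΛ.r_le i y (hsub hy)
    r1_le := fun i y hy => hΛ.r1_le i y (hsub hy)
    r2_le := fun i y hy => hΛ.r2_le i y (hsub hy)
    r_frame := fun y hy z => norm_sq_le_sum_inner_minkFrame (hball (hsub hy)) z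
    G_deriv := fun y hy => (hgut.differentiableOn (by simp) y hy).hasFDerivWithinAt
    T_deriv := hTT1
    T1_deriv := fun y hy => (hT1T2 y (hsub hy)).hasFDerivAt (hnhds hy)
    T_symm := fun y hy a b => by rw [hTsymm y hy, real_inner_comm]
    T_pos := fun y hy a ha => by
      rw [hTform y hy]
      exact fderiv_fderiv_pos_of_posDef (hspec y hy).2.2 ha
    T1_swap := fun y hy a b => fderivWithin_fderivWithin_swap hΩt huniqt hgut hy a b
    T1_symm := fun y hy a b d => inner_fderivWithin_symm huniqt
      (hTs.differentiableOn (by simp)) hTsymm hy a b d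
    T2_swap := fun y hy a b => inner_third_fderivWithin_swap hΩt huniqt hgut hT hT1 hT2 hTsymm
      (hsub hy) a b
    v_spec := fun y hy i => by
      have h1 := (hspec y (hsub hy)).2.1
      have h2 := hleg.fderiv_gradient_apply hΩ (hint y hy)
        (hasFDerivAt_gradient (hdu _ (hspec y (hsub hy)).1)).differentiableAt
        (by rw [h1]; exact hGd y (hsub hy)) (minkFrame i y)
      rw [hTeq y (hsub hy)]
      rwa [h1] at h2
    equation := heq
    F_le := fun y hy => (hF' y hy).2
    F_jet := fun y hy => hasJet_comp_graph hΩt hfC2 hGT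
      (fun z hz => (hTT1 z (hsub hz)).hasFDerivAt (hnhds hz)) c hy
    qF_le := fun y hy a ha => by
      have h1 := second_deriv_graph_le hΩ (hint y hy) (hfC2 y hy) (hA.2 y (hsub hy))
        (hK.2 _ (mk_mem_prod (hspec y (hsub hy)).1 (hsub hy))).2.2
        (hxp _ (hspec y (hsub hy)).1 _ (hsub hy)) (T y a) ha
      linarith
    fp_le := fun y hy => by
      have h1 := (hK.2 _ (mk_mem_prod (hspec y (hsub hy)).1 (hsub hy))).2.1
      refine (ContinuousLinearMap.opNorm_comp_le _ _).trans ?_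
      have h2 := ContinuousLinearMap.norm_inr_le_one ℝ (Euc n) (Euc n)
      nlinarith [norm_nonneg (fderiv ℝ f (gradient ut y, y))]
    barrier := fun y hy => sum_barrier_le hΛ.one_le hθ hc₁ hcard (hHneg y)
      (fun i => hΛ.r_le i y (hsub hy)) (heq y hy) (hF' y hy).1 (hΛ.b_le y (hsub hy))
      (hfx y hy) hε
    fx_le := hfx }, rfl, hTform⟩

end Solution

theorem statement_17 {n : ℕ} (hn : 2 ≤ n)
    (Ω Ωt : Set (Euc n)) (ht h : Euc n → ℝ) (θt θ : ℝ)
    (hdom : DomainSetup Ω Ωt ht h θt θ)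
    (hball : closure Ωt ⊆ Metric.ball (0 : Euc n) 1)
    :
    ∀ K : ℝ, 0 < K →
      ∃ ε C₃₄ : ℝ, 0 < ε ∧ 0 < C₃₄ ∧
        ∀ f : Euc n × Euc n → ℝ, InA Ω Ωt f → C2Bound Ω Ωt f K → OSCcond Ω Ωt f →
          DxBound Ω Ωt f ε → DxpBound Ω Ωt f ε →
        ∀ (c : ℝ) (u ut : Euc n → ℝ), IsSmoothSol Ω Ωt f c u → IsLegendre Ω Ωt u ut →
        ∀ y ∈ frontier Ωt, quadSup (Hess ut y) ≤ C₃₄ := by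
  intro K hK
  have hdom' := hdom
  obtain ⟨hΩ, hΩt, hΩb, hΩtb, hΩne, hΩtne, hht, hh, hΩeq, -, -, -, hθt, hθ, hHt, -⟩ := hdom'
  obtain ⟨Λ₀, hΛ₀⟩ := (eventually_dataBound hdom hball).exists
  obtain ⟨x₀, hx₀⟩ := hΩne
  obtain ⟨r, hr, hr'⟩ := Metric.nhds_basis_closedBall.mem_iff.1 (hΩ.mem_nhds hx₀)
  obtain ⟨Λ, hΛ, hKΛ, hMΛ⟩ := ((eventually_dataBound hdom hball).and
    ((Filter.eventually_ge_atTop K).and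
      (Filter.eventually_ge_atTop (4 / r * ((n + 1) * Λ₀ ^ 2) + 2 * K)))).exists
  have hΛ0 : 0 < Λ := by linarith [hΛ.one_le]
  set c₁ : ℝ := n * ((volume Ωt).toReal / (volume Ω).toReal) ^ ((1 : ℝ) / n) / 4 with hc₁def
  have hc₁ : 0 < c₁ := by
    have hv : 0 < (volume Ω).toReal :=
      ENNReal.toReal_pos (hΩ.measure_pos volume ⟨x₀, hx₀⟩).ne' hΩb.measure_lt_top.ne
    have hvt : 0 < (volume Ωt).toReal :=
      ENNReal.toReal_pos (hΩt.measure_pos volume hΩtne).ne' hΩtb.measure_lt_top.ne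
    have hn' : (0 : ℝ) < n := by
      have : 0 < n := by omega
      exact_mod_cast this
    positivity
  set κ : ℝ := θ * c₁ ^ 2 / (2 * Λ ^ 3) with hκdef
  have hκ : 0 < κ := by positivity
  obtain ⟨C, hC, hbound⟩ := DualSystem.exists_boundary_bound (Euc n) (Option (Fin n)) θt
    hΛ.one_le hκ
  have hε : 4 * min 1 (κ / (4 * Λ)) * Λ ≤ κ := by
    have h1 : min 1 (κ / (4 * Λ)) ≤ κ / (4 * Λ) := min_le_right _ _
    rw [le_div_iff₀ (by positivity)] at h1
    linarith
  refine ⟨min 1 (κ / (4 * Λ)), C, by positivity, hC, ?_⟩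
  intro f hA hf hosc hx hxp c u ut hsol hleg y hy
  have hconv : Convex ℝ Ω := by
    rw [hΩeq]
    refine convex_setOf_pos (le_add_inner_gradient hht fun x a => ?_)
    have h1 := fderiv_fderiv_le_of_matLE (hHt x) a
    nlinarith [sq_nonneg ‖a‖]
  have hd := (contDiffOn_gradient_of_posDef hn hΩ (uniqueDiffOn_closure hΩ hconv ⟨x₀, hx₀⟩)
    hsol.1 fun x hx => hsol.posDef hx).2
  obtain ⟨S, hSD, hST⟩ := exists_dualSystem hn hdom hball hsol hleg hΛ hA hf hKΛ hx hxp hc₁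
    (fun x hx => by
      have h1 := hsol.rhs_bounds hn hdom hd hΛ₀ hr hr' hf hosc hx
      exact ⟨h1.1, h1.2.trans hMΛ⟩) (by positivity) (min_le_left _ _) hε
  refine quadSup_hess_le hn fun a ha => ?_
  rw [← hST y (frontier_subset_closure hy)]
  exact hbound _ S y (by rwa [hSD]) a ha

end
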